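/- Let R be a commutative Noetherian local ring that is a quotient of a regular local ring by a regular sequence contained in the square of the maximal ideal of length c ≥ 1 (a complete intersection of codimension c, with the unramified hypothesis in mixed characteristic). Let N be a finitely generated R-module that is eventually periodic of period one, i.e., Ω_R^n N ≅ Ω_R^{n+1} N for all n ≫ 0. Then N is c-Tor-rigid: if Tor_i^R(N, X) = 0 for c consecutive values i = t+1, …, t+c for some finitely generated X, then Tor_i^R(N, X) = 0 for all i ≥ t+1. -/

import Mathlib

open CategoryTheory IsLocalRing

section Defs
variable (R : Type) [CommRing R]

/-- vanishing of `Tor_n(M, N)` -/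
noncomputable abbrev TorZero [IsNoetherianRing R] (n : ℕ) (M N : ModuleCat.{0} R) : Prop :=
  Subsingleton (((Tor (ModuleCat.{0} R) n).obj M).obj N)

/-- vanishing of `Ext^n(M, N)` -/
noncomputable abbrev ExtZero (n : ℕ) (M N : ModuleCat.{0} R) : Prop :=
  Subsingleton (((Ext R (ModuleCat.{0} R) n).obj (Opposite.op M)).obj N)

/-- `x` annihilates `Ext^n(M, N)` -/
noncomputable abbrev SMulExtZero (x : R) (n : ℕ) (M N : ModuleCat.{0} R) : Prop :=
  ∀ e : ((Ext R (ModuleCat.{0} R) n).obj (Opposite.op M)).obj N, x • e = 0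

/-- `M` is a minimal first syzygy `Ω N` of `N` over the local ring `R`:
the kernel of a minimal free cover of `N`. -/
def IsSyzygyOf [IsLocalRing R] (N M : ModuleCat.{0} R) : Prop :=
  ∃ (q : ℕ) (g : (Fin q → R) →ₗ[R] N), Function.Surjective g ∧
    (LinearMap.ker g : Submodule R (Fin q → R)) ≤ (maximalIdeal R) • ⊤ ∧
    Nonempty (M ≃ₗ[R] LinearMap.ker g)

/-- `M` is a minimal `n`-th syzygy `Ω^n N` of `N` (with `Ω^0 N = N`). -/
def IsNthSyzygyOf [IsLocalRing R] : ℕ → ModuleCat.{0} R → ModuleCat.{0} R → Prop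
  | 0, N, M => Nonempty (M ≃ₗ[R] N)
  | (n+1), N, M => ∃ K : ModuleCat.{0} R, IsSyzygyOf R N K ∧ IsNthSyzygyOf n K M

/-- `M` and `N` are stably isomorphic (isomorphic up to free direct summands). -/
def StablyIso (M N : ModuleCat.{0} R) : Prop :=
  ∃ p q : ℕ, Nonempty ((↥M × (Fin p → R)) ≃ₗ[R] (↥N × (Fin q → R)))

/-- Tor-rigidity: one vanishing Tor (against any f.g. module) forces all higher ones. -/
noncomputable def TorRigid [IsNoetherianRing R] (M : ModuleCat.{0} R) : Prop :=
  ∀ (N : ModuleCat.{0} R), Module.Finite R N →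
    ∀ i : ℕ, 1 ≤ i → TorZero R i M N → ∀ j, i ≤ j → TorZero R j M N

/-- `n`-Tor-rigidity: `n` consecutive vanishing Tor's force all higher ones. -/
noncomputable def NTorRigid [IsNoetherianRing R] (n : ℕ) (M : ModuleCat.{0} R) : Prop :=
  ∀ (N : ModuleCat.{0} R), Module.Finite R N → ∀ t : ℕ,
    (∀ i, t + 1 ≤ i → i ≤ t + n → TorZero R i M N) → ∀ j, t + 1 ≤ j → TorZero R j M N

/-- the `𝔞`-depth of `M`: `∞` if `𝔞M = M`, otherwise the supremum (= common length) of
maximal `M`-regular sequences contained in `𝔞`. -/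
noncomputable def edepth (𝔞 : Ideal R) (M : Type) [AddCommGroup M] [Module R M] : ℕ∞ :=
  letI := Classical.dec (𝔞 • (⊤ : Submodule R M) = ⊤)
  if 𝔞 • (⊤ : Submodule R M) = ⊤ then ⊤
  else sSup {n : ℕ∞ | ∃ rs : List R, (rs.length : ℕ∞) = n ∧ (∀ r ∈ rs, r ∈ 𝔞) ∧
    RingTheory.Sequence.IsRegular M rs}

/-- `T` is an Auslander transpose of `N`, computed from a minimal free presentation. -/
def IsTransposeOf [IsLocalRing R] (N T : ModuleCat.{0} R) : Prop :=
  ∃ (q p : ℕ) (g : (Fin q → R) →ₗ[R] N) (f : (Fin p → R) →ₗ[R] (Fin q → R)),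
    Function.Surjective g ∧
    LinearMap.range f = LinearMap.ker g ∧
    (LinearMap.ker g : Submodule R (Fin q → R)) ≤ (maximalIdeal R) • ⊤ ∧
    (LinearMap.ker f : Submodule R (Fin p → R)) ≤ (maximalIdeal R) • ⊤ ∧
    Nonempty (T ≃ₗ[R] (Module.Dual R (Fin p → R) ⧸ LinearMap.range f.dualMap))

/-- `depth (R_𝔭)`, the depth of the local ring `R_𝔭`. -/
noncomputable def depthLoc (𝔭 : Ideal R) [𝔭.IsPrime] : ℕ∞ :=
  edepth (Localization.AtPrime 𝔭) (maximalIdeal (Localization.AtPrime 𝔭)) (Localization.AtPrime 𝔭)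

/-- `depth_{R_𝔭} (M_𝔭)`, the depth of the localized module over the localized ring. -/
noncomputable def primeDepth (𝔭 : Ideal R) [𝔭.IsPrime] (M : Type) [AddCommGroup M]
    [Module R M] : ℕ∞ :=
  edepth (Localization.AtPrime 𝔭) (maximalIdeal (Localization.AtPrime 𝔭))
    (LocalizedModule 𝔭.primeCompl M)

/-- A Noetherian local ring is Gorenstein iff `R` has finite injective dimension as an
`R`-module, i.e. `Ext^i(k, R) = 0` for all sufficiently large `i`. -/
noncomputable def IsGorensteinLocal [IsLocalRing R] : Prop :=
  ∃ d : ℕ, ∀ i : ℕ, d < i → ExtZero R i (ModuleCat.of R (R ⧸ maximalIdeal R)) (ModuleCat.of R R)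

/-- An unramified regular local ring: the maximal ideal is generated by `dim R` elements, and
no rational prime that is a nonzero element of the maximal ideal lies in its square. -/
def IsUnramifiedRegularLocal [IsLocalRing R] : Prop :=
  (∃ s : Finset R, Ideal.span (s : Set R) = maximalIdeal R ∧
    (s.card : WithBot ℕ∞) = ringKrullDim R) ∧
  ∀ p : ℕ, p.Prime → (p : R) ≠ 0 → (p : R) ∈ maximalIdeal R → (p : R) ∉ (maximalIdeal R) ^ 2

end Defs

/-! ## Elementary Tor -/
section TorKit
open TensorProduct Function

/-- a flat resolution, recorded through its syzygies `K n`; `Q (n+1)` covers `K n`. -/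
structure FlatRes (R Y : Type) [CommRing R] [AddCommGroup Y] [Module R Y] where
  K : ℕ → ModuleCat.{0} R
  Q : ℕ → ModuleCat.{0} R
  u : ∀ n, K n →ₗ[R] Q n
  v : ∀ n, Q (n+1) →ₗ[R] K n
  e : K 0 ≃ₗ[R] Y
  flat : ∀ n, Module.Flat R (Q n)
  sub : Subsingleton (Q 0)
  inj : ∀ n, Injective (u (n+1))
  surj : ∀ n, Surjective (v n)
  exact : ∀ n, Exact (u (n+1)) (v n)

/-- one step -/
noncomputable def stepRes (R : Type) [CommRing R] (Y : ModuleCat.{0} R) :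
    (K : ModuleCat.{0} R) × (Q : ModuleCat.{0} R) × (K →ₗ[R] Q) :=
  ⟨ModuleCat.of R (LinearMap.ker (Finsupp.linearCombination R (id : Y → Y))),
   ModuleCat.of R (Y →₀ R), (LinearMap.ker (Finsupp.linearCombination R (id : Y → Y))).subtype⟩

/-- recursion for the canonical resolution -/
noncomputable def recRes (R Y : Type) [CommRing R] [AddCommGroup Y] [Module R Y] :
    ℕ → (K : ModuleCat.{0} R) × (Q : ModuleCat.{0} R) × (K →ₗ[R] Q)
  | 0 => ⟨ModuleCat.of R Y, ModuleCat.of R PUnit, 0⟩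
  | (n+1) => stepRes R (recRes R Y n).1

lemma stepRes_v (R : Type) [CommRing R] (Y : ModuleCat.{0} R) :
    ∃ v : (stepRes R Y).2.1 →ₗ[R] Y, Injective (stepRes R Y).2.2 ∧ Surjective v ∧
      Exact (stepRes R Y).2.2 v ∧ Module.Flat R (stepRes R Y).2.1 := by
  refine ⟨Finsupp.linearCombination R (id : Y → Y), Subtype.val_injective,
    fun y => ⟨Finsupp.single y 1, (Finsupp.linearCombination_single R 1 y).trans (one_smul R y)⟩,
    LinearMap.exact_subtype_ker_map _, ?_⟩
  exact (inferInstance : Module.Flat R (Y →₀ R))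

lemma exists_flatRes (R Y : Type) [CommRing R] [AddCommGroup Y] [Module R Y] :
    Nonempty (FlatRes R Y) := by
  choose v h1 h2 h3 h4 using stepRes_v R
  exact ⟨{ K := fun n => (recRes R Y n).1
           Q := fun n => (recRes R Y n).2.1
           u := fun n => (recRes R Y n).2.2
           v := fun n => v (recRes R Y n).1
           e := LinearEquiv.refl R Y
           flat := by
            intro n
            cases n with
            | zero => exact (inferInstance : Module.Flat R PUnit)
            | succ n => exact h4 _
           sub := (inferInstance : Subsingleton PUnit)
           inj := fun n => h1 _
           surj := fun n => h2 _
           exact := fun n => h3 _ }⟩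

/-- chosen resolution -/
noncomputable def cRes (R Y : Type) [CommRing R] [AddCommGroup Y] [Module R Y] : FlatRes R Y :=
  (exists_flatRes R Y).some

instance (R Y : Type) [CommRing R] [AddCommGroup Y] [Module R Y] (n : ℕ) :
    Module.Flat R ((cRes R Y).Q n) := (cRes R Y).flat n

lemma exists_cover (R Y : Type) [CommRing R] [AddCommGroup Y] [Module R Y] :
    ∃ (K P : ModuleCat.{0} R) (u : K →ₗ[R] P) (v : P →ₗ[R] Y), Module.Flat R P ∧ Injective u ∧
      Exact u v ∧ Surjective v :=
  ⟨(cRes R Y).K 1, (cRes R Y).Q 1, (cRes R Y).u 1, (cRes R Y).e.toLinearMap ∘ₗ (cRes R Y).v 0,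
    (cRes R Y).flat 1, (cRes R Y).inj 0, fun x => by
      rw [← (cRes R Y).exact 0 x]; simp, (cRes R Y).e.surjective.comp ((cRes R Y).surj 0)⟩

/-- elementary Tor, defined by resolving the second variable -/
noncomputable abbrev T (R : Type) [CommRing R] (n : ℕ) (A Y : Type) [AddCommGroup A] [Module R A]
    [AddCommGroup Y] [Module R Y] : Type := LinearMap.ker (((cRes R Y).u n).lTensor A)

section
variable {R : Type} [CommRing R] {A B C Y : Type}
  [AddCommGroup A] [Module R A] [AddCommGroup B] [Module R B] [AddCommGroup C] [Module R C]
  [AddCommGroup Y] [Module R Y]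

lemma ltensor_rtensor_comm {K P : Type} [AddCommGroup K] [Module R K] [AddCommGroup P] [Module R P]
    (f : A →ₗ[R] B) (u : K →ₗ[R] P) :
    (f.rTensor P) ∘ₗ (u.lTensor A) = (u.lTensor B) ∘ₗ (f.rTensor K) := by
  ext; simp

/-- map induced on kernels -/
noncomputable def kerMap {K P : Type} [AddCommGroup K] [Module R K] [AddCommGroup P] [Module R P]
    (f : A →ₗ[R] B) (u : K →ₗ[R] P) :
    LinearMap.ker (u.lTensor A) →ₗ[R] LinearMap.ker (u.lTensor B) :=
  (f.rTensor K).restrict (fun x hx => by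
    have := LinearMap.congr_fun (ltensor_rtensor_comm f u) x
    simp only [LinearMap.mem_ker, LinearMap.comp_apply] at *
    rw [← this, hx, map_zero])

/-- functoriality in the first variable -/
noncomputable def Tmap (f : A →ₗ[R] B) (n : ℕ) (Y : Type) [AddCommGroup Y] [Module R Y] :
    T R n A Y →ₗ[R] T R n B Y := kerMap f ((cRes R Y).u n)

lemma Tmap_id (n : ℕ) (Y : Type) [AddCommGroup Y] [Module R Y] :
    Tmap (LinearMap.id : A →ₗ[R] A) n Y = LinearMap.id :=
  LinearMap.ext fun x => Subtype.ext (LinearMap.congr_fun (LinearMap.rTensor_id _ A) x.1)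

lemma Tmap_comp (g : B →ₗ[R] C) (f : A →ₗ[R] B) (n : ℕ)
    (Y : Type) [AddCommGroup Y] [Module R Y] :
    Tmap (g ∘ₗ f) n Y = Tmap g n Y ∘ₗ Tmap f n Y :=
  LinearMap.ext fun x => Subtype.ext (LinearMap.congr_fun (LinearMap.rTensor_comp _ g f) x.1)

lemma Tmap_smul (r : R) (f : A →ₗ[R] B) (n : ℕ)
    (Y : Type) [AddCommGroup Y] [Module R Y] :
    Tmap (r • f) n Y = r • Tmap f n Y :=
  LinearMap.ext fun x => Subtype.ext (LinearMap.congr_fun (LinearMap.rTensor_smul _ r f) x.1)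

lemma Tmap_zero (n : ℕ) (Y : Type) [AddCommGroup Y] [Module R Y] :
    Tmap (0 : A →ₗ[R] B) n Y = 0 := by
  have := Tmap_smul (0:R) (0 : A →ₗ[R] B) n Y
  simpa using this

/-- functoriality for isomorphisms, first variable -/
noncomputable def Tcongr (e : A ≃ₗ[R] B) (n : ℕ) (Y : Type) [AddCommGroup Y] [Module R Y] :
    T R n A Y ≃ₗ[R] T R n B Y :=
  LinearEquiv.ofLinearMap (Tmap e.toLinearMap n Y) (Tmap e.symm.toLinearMap n Y)
    (by rw [← Tmap_comp]; simp [Tmap_id]) (by rw [← Tmap_comp]; simp [Tmap_id])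

/-- The snake: six term exact sequence. -/
lemma snake_tensor {K P : Type} [AddCommGroup K] [Module R K] [AddCommGroup P] [Module R P]
    [Module.Flat R P] {f : A →ₗ[R] B} {g : B →ₗ[R] C} (hf : Injective f) (hfg : Exact f g)
    (hg : Surjective g) (u : K →ₗ[R] P) (v : P →ₗ[R] Y) (huv : Exact u v) (hv : Surjective v) :
    ∃ δ : LinearMap.ker (u.lTensor C) →ₗ[R] A ⊗[R] Y,
      Exact (kerMap g u) δ ∧ Exact δ (f.rTensor Y) := by
  have hσ := Function.rightInverse_surjInv (LinearMap.rTensor_surjective K hg)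
  have hinj : Injective (f.rTensor P) := Module.Flat.rTensor_preserves_injective_linearMap f hf
  have hρ := Function.leftInverse_invFun hinj
  refine ⟨SnakeLemma.δ (u.lTensor A) (u.lTensor B) (u.lTensor C) (f.rTensor K) (g.rTensor K)
    (rTensor_exact K hfg hg) (f.rTensor P) (g.rTensor P) (rTensor_exact P hfg hg)
    (ltensor_rtensor_comm f u) (ltensor_rtensor_comm g u) _ hσ.comp_eq_id _ hρ.comp_eq_id
    (LinearMap.ker (u.lTensor C)).subtype (LinearMap.exact_subtype_ker_map _)
    (v.lTensor A) (lTensor_exact A huv hv), ?_, ?_⟩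
  · exact SnakeLemma.exact_δ_right (u.lTensor A) (u.lTensor B) (u.lTensor C) (f.rTensor K)
      (g.rTensor K) (rTensor_exact K hfg hg) (f.rTensor P) (g.rTensor P) (rTensor_exact P hfg hg)
      (ltensor_rtensor_comm f u) (ltensor_rtensor_comm g u) _ hσ.comp_eq_id _ hρ.comp_eq_id
      (LinearMap.ker (u.lTensor B)).subtype (LinearMap.exact_subtype_ker_map _)
      (LinearMap.ker (u.lTensor C)).subtype (LinearMap.exact_subtype_ker_map _)
      (v.lTensor A) (lTensor_exact A huv hv) (kerMap g u) (by ext; rfl) (Subtype.val_injective)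
  · exact SnakeLemma.exact_δ_left (u.lTensor A) (u.lTensor B) (u.lTensor C) (f.rTensor K)
      (g.rTensor K) (rTensor_exact K hfg hg) (f.rTensor P) (g.rTensor P) (rTensor_exact P hfg hg)
      (ltensor_rtensor_comm f u) (ltensor_rtensor_comm g u) _ hσ.comp_eq_id _ hρ.comp_eq_id
      (LinearMap.ker (u.lTensor C)).subtype (LinearMap.exact_subtype_ker_map _)
      (v.lTensor A) (lTensor_exact A huv hv) (v.lTensor B) (lTensor_exact B huv hv)
      (f.rTensor Y) (ltensor_rtensor_comm f v) (LinearMap.lTensor_surjective A hv)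

/-- long exact sequence -/
lemma T_les {f : A →ₗ[R] B} {g : B →ₗ[R] C} (hf : Injective f) (hfg : Exact f g)
    (hg : Surjective g) (n : ℕ) :
    ∃ δ : T R (n+1) C Y →ₗ[R] T R n A Y,
      Exact (Tmap g (n+1) Y) δ ∧ Exact δ (Tmap f n Y) := by
  obtain ⟨δ, h1, h2⟩ := snake_tensor hf hfg hg ((cRes R Y).u (n+1)) ((cRes R Y).v n)
    ((cRes R Y).exact n) ((cRes R Y).surj n)
  have hinj : Injective (f.rTensor ((cRes R Y).Q n)) :=
    Module.Flat.rTensor_preserves_injective_linearMap f hf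
  refine ⟨δ.codRestrict _ fun c => ?_, ?_, ?_⟩
  · rw [LinearMap.mem_ker]
    apply hinj
    have := LinearMap.congr_fun (ltensor_rtensor_comm f ((cRes R Y).u n)) (δ c)
    simp only [LinearMap.comp_apply] at this
    rw [this, h2.apply_apply_eq_zero, map_zero, map_zero]
  · intro x
    refine Iff.trans ?_ (h1 x)
    exact ⟨fun h => congrArg Subtype.val h, fun h => Subtype.ext h⟩
  · intro x
    have := h2 x.1
    constructor
    · intro hx
      obtain ⟨y, hy⟩ := this.1 (congrArg Subtype.val hx)
      exact ⟨y, Subtype.ext hy⟩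
    · rintro ⟨y, hy⟩
      exact Subtype.ext (this.2 ⟨y, congrArg Subtype.val hy⟩)

lemma T_exact {f : A →ₗ[R] B} {g : B →ₗ[R] C} (hf : Injective f) (hfg : Exact f g)
    (hg : Surjective g) (n : ℕ) : Exact (Tmap f n Y) (Tmap g n Y) := by
  have hinj : Injective (f.rTensor ((cRes R Y).Q n)) :=
    Module.Flat.rTensor_preserves_injective_linearMap f hf
  have hex := rTensor_exact ((cRes R Y).K n) hfg hg
  intro x
  constructor
  · intro hx
    obtain ⟨y, hy⟩ := (hex x.1).1 (congrArg Subtype.val hx)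
    refine ⟨⟨y, ?_⟩, Subtype.ext hy⟩
    rw [LinearMap.mem_ker]
    apply hinj
    have := LinearMap.congr_fun (ltensor_rtensor_comm f ((cRes R Y).u n)) y
    simp only [LinearMap.comp_apply] at this
    rw [this, hy, x.2, map_zero]
  · rintro ⟨y, rfl⟩
    exact Subtype.ext (hex.apply_apply_eq_zero y.1)

/-- Tor zero is the tensor product -/
noncomputable def T0e (A Y : Type) [AddCommGroup A] [Module R A] [AddCommGroup Y] [Module R Y] :
    T R 0 A Y ≃ₗ[R] A ⊗[R] Y :=
  (LinearEquiv.ofTop _ (by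
    have : Subsingleton ((cRes R Y).Q 0) := (cRes R Y).sub
    have h : (cRes R Y).u 0 = 0 := LinearMap.ext fun x => Subsingleton.elim _ _
    rw [h, LinearMap.lTensor_zero, LinearMap.ker_zero])).trans
  (LinearEquiv.lTensor A (cRes R Y).e)

lemma T0e_nat (f : A →ₗ[R] B) (x : T R 0 A Y) :
    T0e B Y (Tmap f 0 Y x) = f.rTensor Y (T0e A Y x) :=
  (LinearMap.congr_fun (ltensor_rtensor_comm f (cRes R Y).e.toLinearMap) x.1).symm

lemma T0_surj {g : B →ₗ[R] C} (hg : Surjective g) : Surjective (Tmap g 0 Y) := by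
  intro x
  obtain ⟨y, hy⟩ := LinearMap.rTensor_surjective Y hg (T0e C Y x)
  refine ⟨(T0e B Y).symm y, (T0e C Y).injective ?_⟩
  rw [T0e_nat, LinearEquiv.apply_symm_apply, hy]

lemma T_flat [Module.Flat R A] (n : ℕ) : Subsingleton (T R (n+1) A Y) := by
  have : Injective (((cRes R Y).u (n+1)).lTensor A) :=
    Module.Flat.lTensor_preserves_injective_linearMap _ ((cRes R Y).inj n)
  rw [← LinearMap.ker_eq_bot] at this
  rw [Submodule.subsingleton_iff_eq_bot]
  exact this


/-- acyclicity -/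
def Acyc (R A Y : Type) [CommRing R] [AddCommGroup A] [Module R A] [AddCommGroup Y] [Module R Y] :
    Prop := ∀ n, Subsingleton (T R (n+1) A Y)

lemma Acyc_flat [Module.Flat R A] : Acyc R A Y := fun n => T_flat n

/-- higher dimension shift -/
lemma T_shift {f : A →ₗ[R] B} {g : B →ₗ[R] C} (hf : Injective f) (hfg : Exact f g)
    (hg : Surjective g) (hB : Acyc R B Y) (n : ℕ) :
    Nonempty (T R (n+2) C Y ≃ₗ[R] T R (n+1) A Y) := by
  obtain ⟨δ, h1, h2⟩ := T_les (Y := Y) hf hfg hg (n+1)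
  have := hB n
  have := hB (n+1)
  refine ⟨LinearEquiv.ofBijective δ ⟨?_, ?_⟩⟩
  · rw [← LinearMap.ker_eq_bot, LinearMap.ker_eq_bot']
    intro x hx
    obtain ⟨y, rfl⟩ := (h1 x).1 hx
    rw [Subsingleton.elim y 0, map_zero]
  · intro x
    exact (h2 x).1 (Subsingleton.elim _ _)

/-- first dimension shift -/
lemma T_shift_one {f : A →ₗ[R] B} {g : B →ₗ[R] C} (hf : Injective f) (hfg : Exact f g)
    (hg : Surjective g) (hB : Subsingleton (T R 1 B Y)) :
    Nonempty (T R 1 C Y ≃ₗ[R] LinearMap.ker (f.rTensor Y)) := by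
  obtain ⟨δ, h1, h2⟩ := T_les (Y := Y) hf hfg hg 0
  let γ : T R 1 C Y →ₗ[R] A ⊗[R] Y := (T0e A Y).toLinearMap ∘ₗ δ
  have hγ : Injective γ := by
    rw [← LinearMap.ker_eq_bot, LinearMap.ker_eq_bot']
    intro x hx
    obtain ⟨y, rfl⟩ := (h1 x).1 ((T0e A Y).map_eq_zero_iff.1 hx)
    rw [Subsingleton.elim y 0, map_zero]
  have hr : LinearMap.range γ = LinearMap.ker (f.rTensor Y) := by
    ext z
    rw [LinearMap.mem_ker]
    constructor
    · rintro ⟨x, rfl⟩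
      change f.rTensor Y (T0e A Y (δ x)) = 0
      rw [← T0e_nat, h2.apply_apply_eq_zero, map_zero]
    · intro hz
      obtain ⟨x, hx⟩ := (h2 ((T0e A Y).symm z)).1 (by
        apply (T0e B Y).injective
        rw [T0e_nat, LinearEquiv.apply_symm_apply, hz, map_zero])
      exact ⟨x, by change T0e A Y (δ x) = z; rw [hx, LinearEquiv.apply_symm_apply]⟩
  exact ⟨(LinearEquiv.ofInjective γ hγ).trans (LinearEquiv.ofEq _ _ hr)⟩

/-- `T 1` via any flat cover of the second variable -/
lemma T_one_of_flat {K P : Type} [AddCommGroup K] [Module R K] [AddCommGroup P] [Module R P]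
    [Module.Flat R P] (u : K →ₗ[R] P) (v : P →ₗ[R] Y) (hu : Injective u) (huv : Exact u v)
    (hv : Surjective v) : Nonempty (T R 1 A Y ≃ₗ[R] LinearMap.ker (u.lTensor A)) := by
  obtain ⟨L, F, f, g, hF, hf, hfg, hg⟩ := exists_cover R A
  obtain ⟨e1⟩ := T_shift_one (Y := Y) hf hfg hg (T_flat 0)
  obtain ⟨δ, h1, h2⟩ := snake_tensor hf hfg hg u v huv hv
  have hδ : Injective δ := by
    rw [← LinearMap.ker_eq_bot, LinearMap.ker_eq_bot']
    intro x hx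
    obtain ⟨y, rfl⟩ := (h1 x).1 hx
    have hi : Injective (u.lTensor F) :=
      Module.Flat.lTensor_preserves_injective_linearMap _ hu
    have : y = 0 := Subtype.ext (hi (y.2.trans (map_zero _).symm))
    rw [this, map_zero]
  have hr : LinearMap.range δ = LinearMap.ker (f.rTensor Y) :=
    h2.linearMap_ker_eq.symm
  exact ⟨e1.trans ((LinearEquiv.ofInjective δ hδ).trans (LinearEquiv.ofEq _ _ hr)).symm⟩

/-- kernels under the symmetry of the tensor product -/
noncomputable def kerComm {K P : Type} [AddCommGroup K] [Module R K] [AddCommGroup P] [Module R P]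
    (u : K →ₗ[R] P) : LinearMap.ker (u.lTensor A) ≃ₗ[R] LinearMap.ker (u.rTensor A) :=
  LinearEquiv.ofSubmodules (TensorProduct.comm R A K) _ _ (by
    rw [← LinearMap.comm_comp_rTensor_comp_comm_eq, ← LinearMap.comp_assoc]
    ext x
    constructor
    · rintro ⟨y, hy, rfl⟩
      simpa using hy
    · intro hx
      refine ⟨(TensorProduct.comm R A K).symm x, ?_, by simp⟩
      simpa using hx)

lemma T_comm_one : Nonempty (T R 1 A Y ≃ₗ[R] T R 1 Y A) := by
  obtain ⟨L, F, f, g, hF, hf, hfg, hg⟩ := exists_cover R Y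
  obtain ⟨e1⟩ := T_shift_one (Y := A) hf hfg hg (T_flat 0)
  obtain ⟨e2⟩ := T_one_of_flat (A := A) f g hf hfg hg
  exact ⟨(e2.trans (kerComm f)).trans e1.symm⟩

end

section
variable {R : Type} [CommRing R]

/-- `T (n+1) A Y` is `T 1 A` of the `n`-th syzygy of the resolution -/
lemma T_succ_eq (A Y : Type) [AddCommGroup A] [Module R A] [AddCommGroup Y] [Module R Y] (n : ℕ) :
    Nonempty (T R 1 A ((cRes R Y).K n) ≃ₗ[R] T R (n+1) A Y) :=
  T_one_of_flat ((cRes R Y).u (n+1)) ((cRes R Y).v n) ((cRes R Y).inj n) ((cRes R Y).exact n)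
    ((cRes R Y).surj n)

/-- going down all the syzygies of the first variable -/
lemma T_down (A Y : Type) [AddCommGroup A] [Module R A] [AddCommGroup Y] [Module R Y]
    (r : FlatRes R A) (n : ℕ) : ∀ m, Nonempty (T R (m+1+n) A Y ≃ₗ[R] T R (m+1) (r.K n) Y) := by
  induction n with
  | zero => exact fun m => ⟨Tcongr r.e.symm _ Y⟩
  | succ n ih =>
    intro m
    obtain ⟨e1⟩ := ih (m+1)
    have := r.flat (n+1)
    obtain ⟨e2⟩ := T_shift (Y := Y) (r.inj n) (r.exact n) (r.surj n) Acyc_flat m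
    have h : m + 1 + (n + 1) = m + 1 + 1 + n := by omega
    rw [h]
    exact ⟨e1.trans e2⟩

lemma T_comm (A Y : Type) [AddCommGroup A] [Module R A] [AddCommGroup Y] [Module R Y] (n : ℕ) :
    Nonempty (T R n A Y ≃ₗ[R] T R n Y A) := by
  cases n with
  | zero =>
    have e1 : T R 0 A Y ≃ₗ[R] A ⊗[R] Y := T0e A Y
    have e2 : T R 0 Y A ≃ₗ[R] Y ⊗[R] A := T0e Y A
    exact ⟨(e1.trans (TensorProduct.comm R A Y)).trans e2.symm⟩
  | succ n =>
    obtain ⟨e1⟩ := T_down (R := R) A Y (cRes R A) n 0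
    obtain ⟨e2⟩ := T_comm_one (R := R) (A := (cRes R A).K n) (Y := Y)
    obtain ⟨e3⟩ := T_succ_eq (R := R) Y A n
    have h : n + 1 = 0 + 1 + n := by omega
    have e4 := (e1.trans e2).trans e3
    rw [h]
    rw [h] at e4
    exact ⟨e4⟩

lemma T_congr_left {A B : Type} (Y : Type) [AddCommGroup A] [Module R A] [AddCommGroup B]
    [Module R B] [AddCommGroup Y] [Module R Y] (e : A ≃ₗ[R] B) (n : ℕ) :
    Nonempty (T R n A Y ≃ₗ[R] T R n B Y) := ⟨Tcongr e n Y⟩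

lemma T_congr_right {A B : Type} (Y : Type) [AddCommGroup A] [Module R A] [AddCommGroup B]
    [Module R B] [AddCommGroup Y] [Module R Y] (e : A ≃ₗ[R] B) (n : ℕ) :
    Nonempty (T R n Y A ≃ₗ[R] T R n Y B) := by
  obtain ⟨e1⟩ := T_comm (R := R) Y A n
  obtain ⟨e2⟩ := T_comm (R := R) B Y n
  exact ⟨(e1.trans (Tcongr e n Y)).trans e2⟩

lemma Acyc_comm {A Y : Type} [AddCommGroup A] [Module R A] [AddCommGroup Y] [Module R Y]
    (h : Acyc R A Y) : Acyc R Y A := fun n => by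
  obtain ⟨e⟩ := T_comm (R := R) Y A (n+1)
  have := h n
  exact e.toEquiv.subsingleton

lemma Acyc_flat_right {A Y : Type} [AddCommGroup A] [Module R A] [AddCommGroup Y] [Module R Y]
    [Module.Flat R Y] : Acyc R A Y := Acyc_comm Acyc_flat

lemma T_smul_left {A Y : Type} [AddCommGroup A] [Module R A] [AddCommGroup Y] [Module R Y]
    (r : R) (h : ∀ a : A, r • a = 0) (n : ℕ) (t : T R n A Y) : r • t = 0 := by
  have h1 : r • (LinearMap.id : A →ₗ[R] A) = 0 := LinearMap.ext fun a => h a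
  have := Tmap_smul r (LinearMap.id : A →ₗ[R] A) n Y
  rw [h1, Tmap_zero, Tmap_id] at this
  exact (LinearMap.congr_fun this t).symm

lemma T_smul_right {A Y : Type} [AddCommGroup A] [Module R A] [AddCommGroup Y] [Module R Y]
    (r : R) (h : ∀ a : Y, r • a = 0) (n : ℕ) (t : T R n A Y) : r • t = 0 := by
  obtain ⟨e⟩ := T_comm (R := R) A Y n
  apply e.injective
  rw [map_smul, T_smul_left r h, map_zero]

/-- finite free cover -/
lemma exists_fcover [IsNoetherianRing R] (A : Type) [AddCommGroup A] [Module R A]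
    [Module.Finite R A] :
    ∃ (k : ℕ) (K : ModuleCat.{0} R) (u : K →ₗ[R] (Fin k → R)) (v : (Fin k → R) →ₗ[R] A),
      Module.Finite R K ∧ Injective u ∧ Exact u v ∧ Surjective v := by
  obtain ⟨k, v, hv⟩ := Module.Finite.exists_fin' R A
  exact ⟨k, ModuleCat.of R (LinearMap.ker v), (LinearMap.ker v).subtype, v,
    (inferInstance : Module.Finite R (LinearMap.ker v)), Subtype.val_injective,
    LinearMap.exact_subtype_ker_map v, hv⟩

lemma T_finite [IsNoetherianRing R] (Y : Type) [AddCommGroup Y] [Module R Y] [Module.Finite R Y]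
    (n : ℕ) : ∀ (A : Type) [AddCommGroup A] [Module R A] [Module.Finite R A],
      Module.Finite R (T R n A Y) := by
  induction n with
  | zero =>
    intro A _ _ _
    exact Module.Finite.equiv (T0e (R := R) A Y).symm
  | succ n ih =>
    intro A _ _ _
    obtain ⟨k, K, u, v, hK, hu, huv, hv⟩ := exists_fcover (R := R) A
    cases n with
    | zero =>
      obtain ⟨e⟩ := T_shift_one (Y := Y) hu huv hv (T_flat 0)
      exact Module.Finite.equiv e.symm
    | succ n =>
      obtain ⟨e⟩ := T_shift (Y := Y) hu huv hv Acyc_flat n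
      have := ih K
      exact Module.Finite.equiv e.symm

end
end TorKit

section TorLink
open TensorProduct Function

lemma T_shift_right {R : Type} [CommRing R] {A B C Y : Type}
    [AddCommGroup A] [Module R A] [AddCommGroup B] [Module R B] [AddCommGroup C] [Module R C]
    [AddCommGroup Y] [Module R Y]
    {f : A →ₗ[R] B} {g : B →ₗ[R] C} (hf : Injective f) (hfg : Exact f g)
    (hg : Surjective g) (hB : Acyc R Y B) (n : ℕ) :
    Nonempty (T R (n+2) Y C ≃ₗ[R] T R (n+1) Y A) := by
  obtain ⟨e⟩ := T_shift hf hfg hg (Acyc_comm hB) n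
  obtain ⟨e1⟩ := T_comm (R := R) Y C (n+2)
  obtain ⟨e2⟩ := T_comm (R := R) A Y (n+1)
  exact ⟨(e1.trans e).trans e2⟩

lemma T_res_iff {R : Type} [CommRing R] (M : Type) [AddCommGroup M] [Module R M] (m : ℕ) :
    ∀ (Y : Type) [AddCommGroup Y] [Module R Y] (P : ℕ → ModuleCat.{0} R)
      (d : ∀ n, P (n+1) →ₗ[R] P n) (ε : P 0 →ₗ[R] Y), (∀ n, Module.Flat R (P n)) →
      Surjective ε → Exact (d 0) ε → (∀ n, Exact (d (n+1)) (d n)) →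
      (Subsingleton (T R (m+1) M Y) ↔ Exact ((d (m+1)).lTensor M) ((d m).lTensor M)) := by
  induction m with
  | zero =>
    intro Y _ _ P d ε hP hε h0 h
    have := hP 0
    obtain ⟨K, hK⟩ : ∃ K : ModuleCat.{0} R, K = ModuleCat.of R (LinearMap.ker ε) := ⟨_, rfl⟩
    obtain ⟨u, π, hu, huε, hπ, hdu⟩ : ∃ (u : K →ₗ[R] P 0) (π : P 1 →ₗ[R] K), Injective u ∧
        Exact u ε ∧ Surjective π ∧ d 0 = u ∘ₗ π := by
      subst hK
      refine ⟨(LinearMap.ker ε).subtype, (d 0).codRestrict _ fun x => ?_, Subtype.val_injective,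
        LinearMap.exact_subtype_ker_map ε, ?_, ?_⟩
      · exact h0.apply_apply_eq_zero x
      · rintro ⟨x, hx⟩
        obtain ⟨y, rfl⟩ := (h0 x).1 hx
        exact ⟨y, rfl⟩
      · rfl
    obtain ⟨e⟩ := T_one_of_flat (A := M) u ε hu huε hε
    have hex : Exact (d 1) π := fun x => by
      rw [← h 0 x, hdu, LinearMap.comp_apply, map_eq_zero_iff _ hu]
    have hex' := lTensor_exact M hex hπ
    rw [e.toEquiv.subsingleton_congr, Submodule.subsingleton_iff_eq_bot, LinearMap.ker_eq_bot]
    rw [hdu, LinearMap.lTensor_comp]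
    constructor
    · intro hi x
      rw [LinearMap.comp_apply, map_eq_zero_iff _ hi, hex' x]
    · intro hE
      rw [← LinearMap.ker_eq_bot, LinearMap.ker_eq_bot']
      intro x hx
      obtain ⟨y, rfl⟩ := LinearMap.lTensor_surjective M hπ x
      exact (hex' y).2 ((hE y).1 hx)
  | succ m ih =>
    intro Y _ _ P d ε hP hε h0 h
    have := hP 0
    obtain ⟨K, hK⟩ : ∃ K : ModuleCat.{0} R, K = ModuleCat.of R (LinearMap.ker ε) := ⟨_, rfl⟩
    obtain ⟨u, π, hu, huε, hπ, hdu⟩ : ∃ (u : K →ₗ[R] P 0) (π : P 1 →ₗ[R] K), Injective u ∧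
        Exact u ε ∧ Surjective π ∧ d 0 = u ∘ₗ π := by
      subst hK
      refine ⟨(LinearMap.ker ε).subtype, (d 0).codRestrict _ fun x => ?_, Subtype.val_injective,
        LinearMap.exact_subtype_ker_map ε, ?_, ?_⟩
      · exact h0.apply_apply_eq_zero x
      · rintro ⟨x, hx⟩
        obtain ⟨y, rfl⟩ := (h0 x).1 hx
        exact ⟨y, rfl⟩
      · rfl
    have hex : Exact (d 1) π := fun x => by
      rw [← h 0 x, hdu, LinearMap.comp_apply, map_eq_zero_iff _ hu]
    obtain ⟨e⟩ := T_shift_right (Y := M) hu huε hε Acyc_flat_right m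
    rw [e.toEquiv.subsingleton_congr]
    exact ih K (fun n => P (n+1)) (fun n => d (n+1)) π (fun n => hP _) hπ hex (fun n => h _)

lemma torZero_iff {R : Type} [CommRing R] (M N : ModuleCat.{0} R) (m : ℕ) :
    Subsingleton (((Tor (ModuleCat.{0} R) (m+1)).obj M).obj N) ↔ Subsingleton (T R (m+1) M N) := by
  let P := projectiveResolution N
  let e := P.isoLeftDerivedObj ((MonoidalCategory.tensoringLeft (ModuleCat.{0} R)).obj M) (m+1)
  have h1 : Subsingleton (((Tor (ModuleCat.{0} R) (m+1)).obj M).obj N) ↔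
      Limits.IsZero (((((MonoidalCategory.tensoringLeft (ModuleCat.{0} R)).obj M).mapHomologicalComplex
        (ComplexShape.down ℕ)).obj P.complex).homology (m+1)) := by
    refine Iff.trans ?_ e.isZero_iff
    constructor
    · intro h
      exact @ModuleCat.isZero_of_subsingleton _ _ _ h
    · intro h
      exact ModuleCat.subsingleton_of_isZero h
  rw [h1, ← HomologicalComplex.exactAt_iff_isZero_homology,
    HomologicalComplex.exactAt_iff' _ (m+2) (m+1) m (by simp) (by simp),
    ShortComplex.ShortExact.moduleCat_exact_iff_function_exact]
  refine Iff.trans ?_ (T_res_iff (R := R) M m N (fun n => P.complex.X n)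
    (fun n => (P.complex.d (n+1) n).hom) (P.π.f 0).hom ?_ ?_ ?_ ?_).symm
  · exact Iff.rfl
  · intro n
    have := P.projective n
    have : Module.Projective R (P.complex.X n) := by
      rw [IsProjective.iff_projective]; exact this
    infer_instance
  · exact (ModuleCat.epi_iff_surjective (P.π.f 0)).1 inferInstance
  · have := P.exact₀
    rw [ShortComplex.ShortExact.moduleCat_exact_iff_function_exact] at this
    exact this
  · intro n
    have := P.exact_succ n
    rw [ShortComplex.ShortExact.moduleCat_exact_iff_function_exact] at this
    exact this
end TorLink

section ChangeOfRings
open TensorProduct Function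

lemma Tmap_add {R : Type} [CommRing R] {A B : Type} [AddCommGroup A] [Module R A] [AddCommGroup B]
    [Module R B] (f g : A →ₗ[R] B) (n : ℕ) (Y : Type) [AddCommGroup Y] [Module R Y] :
    Tmap (f + g) n Y = Tmap f n Y + Tmap g n Y :=
  LinearMap.ext fun x => Subtype.ext (LinearMap.congr_fun (LinearMap.rTensor_add _ f g) x.1)

lemma Tmap_sum {R : Type} [CommRing R] {A B : Type} [AddCommGroup A] [Module R A] [AddCommGroup B]
    [Module R B] {ι : Type} (s : Finset ι) (f : ι → (A →ₗ[R] B)) (n : ℕ) (Y : Type)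
    [AddCommGroup Y] [Module R Y] :
    Tmap (∑ i ∈ s, f i) n Y = ∑ i ∈ s, Tmap (f i) n Y := by
  classical
  induction s using Finset.induction_on with
  | empty => simp [Tmap_zero]
  | insert i s hi ih => rw [Finset.sum_insert hi, Finset.sum_insert hi, Tmap_add, ih]

lemma Acyc_pi {R : Type} [CommRing R] {C Y : Type} [AddCommGroup C] [Module R C] [AddCommGroup Y]
    [Module R Y] (h : Acyc R C Y) (k : ℕ) : Acyc R (Fin k → C) Y := by
  intro n
  have := h n
  have h1 : (LinearMap.id : (Fin k → C) →ₗ[R] (Fin k → C)) =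
      ∑ i, (LinearMap.single R (fun _ : Fin k => C) i) ∘ₗ LinearMap.proj i := by
    ext i x j
    simp [Pi.single_apply]
  have h2 := Tmap_sum (R := R) Finset.univ
    (fun i : Fin k => (LinearMap.single R (fun _ : Fin k => C) i) ∘ₗ LinearMap.proj i) (n+1) Y
  rw [← h1, Tmap_id] at h2
  refine ⟨fun x y => ?_⟩
  have h3 : ∀ x : T R (n+1) (Fin k → C) Y, x = 0 := by
    intro x
    have := LinearMap.congr_fun h2 x
    rw [LinearMap.id_apply] at this
    rw [this, LinearMap.sum_apply]
    refine Finset.sum_eq_zero fun i _ => ?_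
    rw [Tmap_comp, LinearMap.comp_apply, Subsingleton.elim (Tmap (LinearMap.proj i) (n+1) Y x) 0,
      map_zero]
  rw [h3 x, h3 y]

lemma Acyc_congr_left {R : Type} [CommRing R] {C C' Y : Type} [AddCommGroup C] [Module R C]
    [AddCommGroup C'] [Module R C'] [AddCommGroup Y]
    [Module R Y] (e : C ≃ₗ[R] C') (h : Acyc R C Y) : Acyc R C' Y := by
  intro n
  have := h n
  obtain ⟨e'⟩ := T_congr_left (R := R) Y e (n+1)
  exact e'.symm.toEquiv.subsingleton

lemma Acyc_congr_right {R : Type} [CommRing R] {C C' Y : Type} [AddCommGroup C] [Module R C]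
    [AddCommGroup C'] [Module R C'] [AddCommGroup Y]
    [Module R Y] (e : C ≃ₗ[R] C') (h : Acyc R Y C) : Acyc R Y C' :=
  Acyc_comm (Acyc_congr_left e (Acyc_comm h))

/-- transport of kernels along a commutative square -/
noncomputable def kerEquiv {R A B A' B' : Type} [CommRing R] [AddCommGroup A] [Module R A]
    [AddCommGroup B] [Module R B] [AddCommGroup A'] [Module R A'] [AddCommGroup B'] [Module R B']
    (f : A →ₗ[R] B) (f' : A' →ₗ[R] B') (a : A ≃ₗ[R] A') (b : B ≃ₗ[R] B')
    (h : ∀ x, f' (a x) = b (f x)) : LinearMap.ker f ≃ₗ[R] LinearMap.ker f' :=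
  LinearEquiv.ofSubmodules a _ _ (by
    ext x
    constructor
    · rintro ⟨y, hy, rfl⟩
      have : f y = 0 := hy
      simp [h, this]
    · intro hx
      refine ⟨a.symm x, ?_, by simp⟩
      have : f' x = 0 := hx
      apply b.injective
      simp [← h, this])

lemma T_change {R Λ : Type} [CommRing R] [IsNoetherianRing R] [CommRing Λ] [Algebra R Λ]
    (C Y : Type) [AddCommGroup C] [Module Λ C] [Module R C] [IsScalarTower R Λ C]
    [AddCommGroup Y] [Module Λ Y] (hCY : Acyc Λ C Y) (n : ℕ) :
    ∀ (A : Type) [AddCommGroup A] [Module R A] [Module.Finite R A], Acyc R A C →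
    ∃ (k : ℕ) (K : ModuleCat.{0} R) (u : K →ₗ[R] (Fin k → R)), Module.Finite R K ∧
      (∀ (Z : Type) [AddCommGroup Z] [Module R Z],
        Nonempty (T R (n+1) A Z ≃ₗ[R] LinearMap.ker (u.lTensor Z))) ∧
      Nonempty (T Λ (n+1) (C ⊗[R] A) Y ≃ₗ[Λ]
        LinearMap.ker (AlgebraTensorModule.lTensor Λ (C ⊗[Λ] Y) u)) := by
  induction n with
  | zero =>
    intro A _ _ _ hA
    obtain ⟨k, K, u, v, hK, hu, huv, hv⟩ := exists_fcover (R := R) A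
    refine ⟨k, K, u, hK, fun Z _ _ => ?_, ?_⟩
    · obtain ⟨e⟩ := T_shift_one (Y := Z) hu huv hv (T_flat 0)
      exact ⟨e.trans (kerComm u).symm⟩
    · obtain ⟨e1⟩ := T_one_of_flat (A := C) u v hu huv hv
      have h0 := (Acyc_comm hA) 0
      have hinj : Injective (u.lTensor C) := by
        rw [← LinearMap.ker_eq_bot, ← Submodule.subsingleton_iff_eq_bot]
        exact e1.symm.toEquiv.subsingleton
      have hex : Exact (u.lTensor C) (v.lTensor C) := lTensor_exact C huv hv
      have hsur := LinearMap.lTensor_surjective C hv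
      have hac : Acyc Λ (C ⊗[R] (Fin k → R)) Y :=
        Acyc_congr_left (TensorProduct.piScalarRight R Λ C (Fin k)).symm (Acyc_pi hCY k)
      obtain ⟨e2⟩ := T_shift_one (R := Λ) (Y := Y)
        (f := AlgebraTensorModule.lTensor Λ C u) (g := AlgebraTensorModule.lTensor Λ C v)
        hinj hex hsur (hac 0)
      refine ⟨e2.trans (kerEquiv _ _ (AlgebraTensorModule.rightComm R Λ Λ C Y K).symm
        (AlgebraTensorModule.rightComm R Λ Λ C Y (Fin k → R)).symm ?_)⟩
      intro x
      rw [LinearEquiv.eq_symm_apply]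
      have : ((AlgebraTensorModule.rightComm R Λ Λ C Y (Fin k → R)).toLinearMap ∘ₗ
        (AlgebraTensorModule.lTensor Λ (C ⊗[Λ] Y) u)) =
        ((AlgebraTensorModule.lTensor Λ C u).rTensor Y) ∘ₗ
          (AlgebraTensorModule.rightComm R Λ Λ C Y K).toLinearMap := by
        ext; simp
      have := LinearMap.congr_fun this ((AlgebraTensorModule.rightComm R Λ Λ C Y K).symm x)
      rw [LinearMap.comp_apply, LinearMap.comp_apply, LinearEquiv.coe_coe, LinearEquiv.coe_coe,
        LinearEquiv.apply_symm_apply] at this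
      exact this
  | succ n ih =>
    intro A _ _ _ hA
    obtain ⟨k, K, u, v, hK, hu, huv, hv⟩ := exists_fcover (R := R) A
    have hKC : Acyc R K C := fun m => by
      obtain ⟨e⟩ := T_shift (Y := C) hu huv hv Acyc_flat m
      have := hA (m+1)
      exact e.symm.toEquiv.subsingleton
    obtain ⟨k', K', u', hK', h1, ⟨e2⟩⟩ := ih K hKC
    refine ⟨k', K', u', hK', fun Z _ _ => ?_, ?_⟩
    · obtain ⟨e⟩ := T_shift (Y := Z) hu huv hv Acyc_flat n
      obtain ⟨e'⟩ := h1 Z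
      exact ⟨e.trans e'⟩
    · obtain ⟨e1⟩ := T_one_of_flat (A := C) u v hu huv hv
      have h0 := (Acyc_comm hA) 0
      have hinj : Injective (u.lTensor C) := by
        rw [← LinearMap.ker_eq_bot, ← Submodule.subsingleton_iff_eq_bot]
        exact e1.symm.toEquiv.subsingleton
      have hex : Exact (u.lTensor C) (v.lTensor C) := lTensor_exact C huv hv
      have hsur := LinearMap.lTensor_surjective C hv
      have hac : Acyc Λ (C ⊗[R] (Fin k → R)) Y :=
        Acyc_congr_left (TensorProduct.piScalarRight R Λ C (Fin k)).symm (Acyc_pi hCY k)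
      obtain ⟨e3⟩ := T_shift (R := Λ) (Y := Y)
        (f := AlgebraTensorModule.lTensor Λ C u) (g := AlgebraTensorModule.lTensor Λ C v)
        hinj hex hsur hac n
      exact ⟨e3.trans e2⟩

/-- flat version: `T^Λ(C ⊗ A, Y) = B ⊗ T^S(A,X)` if `C ⊗ Y = B ⊗ X`, `B` flat -/
lemma T_change_flat {R Λ : Type} [CommRing R] [IsNoetherianRing R] [CommRing Λ] [Algebra R Λ]
    (C Y : Type) [AddCommGroup C] [Module Λ C] [Module R C] [IsScalarTower R Λ C]
    [AddCommGroup Y] [Module Λ Y] (hCY : Acyc Λ C Y)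
    (B X : Type) [AddCommGroup B] [Module Λ B] [Module R B] [IsScalarTower R Λ B]
    [AddCommGroup X] [Module R X] [Module.Flat R B]
    (e : (C ⊗[Λ] Y) ≃ₗ[Λ] (B ⊗[R] X))
    (A : Type) [AddCommGroup A] [Module R A] [Module.Finite R A] (hA : Acyc R A C) (n : ℕ) :
    Nonempty (T Λ (n+1) (C ⊗[R] A) Y ≃ₗ[Λ] B ⊗[R] (T R (n+1) A X)) := by
  obtain ⟨k, K, u, hK, h1, ⟨e2⟩⟩ := T_change C Y hCY n A hA
  obtain ⟨e3⟩ := h1 X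
  let w : (B ⊗[R] (X ⊗[R] K)) →ₗ[Λ] (B ⊗[R] (X ⊗[R] (Fin k → R))) :=
    AlgebraTensorModule.lTensor Λ B (u.lTensor X)
  have e4 : LinearMap.ker (AlgebraTensorModule.lTensor Λ (C ⊗[Λ] Y) u) ≃ₗ[Λ] LinearMap.ker w := by
    have eK := (AlgebraTensorModule.congr e (LinearEquiv.refl R K)).trans
        (AlgebraTensorModule.assoc R R Λ B X K)
    refine kerEquiv _ _ ((AlgebraTensorModule.congr e (LinearEquiv.refl R K)).trans
        (AlgebraTensorModule.assoc R R Λ B X K))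
        ((AlgebraTensorModule.congr e (LinearEquiv.refl R (Fin k → R))).trans
        (AlgebraTensorModule.assoc R R Λ B X (Fin k → R))) ?_
    have hh : w ∘ₗ (AlgebraTensorModule.assoc R R Λ B X K).toLinearMap =
      (AlgebraTensorModule.assoc R R Λ B X (Fin k → R)).toLinearMap ∘ₗ
        AlgebraTensorModule.lTensor Λ (B ⊗[R] X) u := by
      ext; simp [w]
    intro x
    induction x using TensorProduct.induction_on with
    | zero => simp
    | add x y hx hy => rw [map_add, map_add, hx, hy, map_add, map_add]
    | tmul a b =>
      have := LinearMap.congr_fun hh (e a ⊗ₜ b)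
      simpa using this
  have e5 : LinearMap.ker w ≃ₗ[Λ] B ⊗[R] (LinearMap.ker (u.lTensor X)) := by
    let i : B ⊗[R] (LinearMap.ker (u.lTensor X)) →ₗ[Λ] (B ⊗[R] (X ⊗[R] K)) :=
      AlgebraTensorModule.lTensor Λ B (LinearMap.ker (u.lTensor X)).subtype
    have hi : Injective i :=
      Module.Flat.lTensor_preserves_injective_linearMap (M := B) _ (Subtype.val_injective)
    have hr : LinearMap.range i = LinearMap.ker w := by
      have := Module.Flat.lTensor_exact (R := R) B (LinearMap.exact_subtype_ker_map (u.lTensor X))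
      ext x
      exact (this x).symm
    exact ((LinearEquiv.ofInjective i hi).trans (LinearEquiv.ofEq _ _ hr)).symm
  exact ⟨e2.trans (e4.trans (e5.trans (AlgebraTensorModule.congr (LinearEquiv.refl Λ B) e3.symm)))⟩

end ChangeOfRings

section ChangeLES
open TensorProduct Function

/-- base change -/
lemma T_base_change {R Λ : Type} [CommRing R] [IsNoetherianRing R] [CommRing Λ] [Algebra R Λ]
    (Y : Type) [AddCommGroup Y] [Module Λ Y] [Module R Y] [IsScalarTower R Λ Y]
    (A : Type) [AddCommGroup A] [Module R A] [Module.Finite R A] (hA : Acyc R A Λ) (n : ℕ) :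
    Nonempty (T Λ (n+1) (Λ ⊗[R] A) Y ≃ₗ[R] T R (n+1) A Y) := by
  obtain ⟨k, K, u, hK, h1, ⟨e2⟩⟩ := T_change Λ Y (Acyc_flat (R := Λ) (A := Λ)) n A hA
  obtain ⟨e3⟩ := h1 Y
  let e4 : (Λ ⊗[Λ] Y) ≃ₗ[R] Y := (TensorProduct.lid Λ Y).restrictScalars R
  have e5 : LinearMap.ker (AlgebraTensorModule.lTensor Λ (Λ ⊗[Λ] Y) u) ≃ₗ[R]
      LinearMap.ker (u.lTensor (Λ ⊗[Λ] Y)) :=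
    { toFun := fun x => ⟨x.1, x.2⟩
      invFun := fun x => ⟨x.1, x.2⟩
      map_add' := fun _ _ => rfl
      map_smul' := fun _ _ => rfl
      left_inv := fun _ => rfl
      right_inv := fun _ => rfl }
  have e6 : LinearMap.ker (u.lTensor (Λ ⊗[Λ] Y)) ≃ₗ[R] LinearMap.ker (u.lTensor Y) := by
    refine kerEquiv (A := (Λ ⊗[Λ] Y) ⊗[R] K) (B := (Λ ⊗[Λ] Y) ⊗[R] (Fin k → R))
      (u.lTensor (Λ ⊗[Λ] Y)) (u.lTensor Y) (TensorProduct.congr e4 (LinearEquiv.refl R K))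
      (TensorProduct.congr e4 (LinearEquiv.refl R (Fin k → R))) ?_
    have : (u.lTensor Y) ∘ₗ (TensorProduct.congr e4 (LinearEquiv.refl R K)).toLinearMap =
      (TensorProduct.congr e4 (LinearEquiv.refl R (Fin k → R))).toLinearMap ∘ₗ
        (u.lTensor (Λ ⊗[Λ] Y)) := by
      ext; simp
    exact fun x => LinearMap.congr_fun this x
  exact ⟨(e2.restrictScalars R).trans (e5.trans (e6.trans e3.symm))⟩

/-- exactness of multiplication by a regular element -/
lemma exact_mul {R' R : Type} [CommRing R'] [CommRing R] [Algebra R' R] (f : R')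
    (hf : IsSMulRegular R' f) (hker : RingHom.ker (algebraMap R' R) = Ideal.span {f}) :
    Injective (LinearMap.lsmul R' R' f) ∧
    Exact (LinearMap.lsmul R' R' f) (Algebra.linearMap R' R) := by
  refine ⟨hf, fun y => ?_⟩
  have h1 : Algebra.linearMap R' R y = 0 ↔ y ∈ RingHom.ker (algebraMap R' R) := Iff.rfl
  rw [h1, hker, Ideal.mem_span_singleton]
  constructor
  · rintro ⟨z, rfl⟩
    exact ⟨z, rfl⟩
  · rintro ⟨z, rfl⟩
    exact ⟨z, rfl⟩

lemma ker_lsmul_rTensor {R' M : Type} [CommRing R'] [AddCommGroup M] [Module R' M] (f : R') :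
    Nonempty (LinearMap.ker ((LinearMap.lsmul R' R' f).rTensor M) ≃ₗ[R']
      LinearMap.ker (LinearMap.lsmul R' M f)) := by
  refine ⟨kerEquiv _ _ (TensorProduct.lid R' M) (TensorProduct.lid R' M) ?_⟩
  have : (LinearMap.lsmul R' M f) ∘ₗ (TensorProduct.lid R' M).toLinearMap =
      (TensorProduct.lid R' M).toLinearMap ∘ₗ ((LinearMap.lsmul R' R' f).rTensor M) := by
    ext; simp
  exact fun x => LinearMap.congr_fun this x

/-- `T` of a hypersurface -/
lemma T_hyper_one {R' R M : Type} [CommRing R'] [CommRing R] [Algebra R' R] (f : R')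
    (hf : IsSMulRegular R' f) (hsurj : Surjective (algebraMap R' R))
    (hker : RingHom.ker (algebraMap R' R) = Ideal.span {f}) [AddCommGroup M] [Module R' M] :
    Nonempty (T R' 1 R M ≃ₗ[R'] LinearMap.ker (LinearMap.lsmul R' M f)) := by
  obtain ⟨h1, h2⟩ := exact_mul f hf hker
  obtain ⟨e⟩ := T_shift_one (R := R') (Y := M) h1 h2 hsurj (T_flat 0)
  obtain ⟨e'⟩ := ker_lsmul_rTensor (M := M) f
  exact ⟨e.trans e'⟩

lemma Acyc_hyper {R' R M : Type} [CommRing R'] [CommRing R] [Algebra R' R] (f : R')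
    (hf : IsSMulRegular R' f) (hsurj : Surjective (algebraMap R' R))
    (hker : RingHom.ker (algebraMap R' R) = Ideal.span {f}) [AddCommGroup M] [Module R' M]
    (hM : IsSMulRegular M f) : Acyc R' M R := by
  refine Acyc_comm fun n => ?_
  cases n with
  | zero =>
    obtain ⟨e⟩ := T_hyper_one (M := M) f hf hsurj hker
    have : Subsingleton (LinearMap.ker (LinearMap.lsmul R' M f)) := by
      rw [Submodule.subsingleton_iff_eq_bot, LinearMap.ker_eq_bot]
      exact hM
    exact e.toEquiv.subsingleton
  | succ n =>
    obtain ⟨h1, h2⟩ := exact_mul f hf hker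
    obtain ⟨e⟩ := T_shift (R := R') (Y := M) h1 h2 hsurj Acyc_flat n
    have := T_flat (R := R') (A := R') (Y := M) n
    exact e.toEquiv.subsingleton

/-- the change of rings long exact sequence -/
lemma les_change {R' R : Type} [CommRing R'] [IsNoetherianRing R'] [CommRing R] [Algebra R' R]
    (f : R')
    (hf : IsSMulRegular R' f) (hsurj : Surjective (algebraMap R' R))
    (hker : RingHom.ker (algebraMap R' R) = Ideal.span {f})
    (N X : Type) [AddCommGroup N] [Module R N] [Module R' N] [IsScalarTower R' R N]
    [Module.Finite R' N] [AddCommGroup X] [Module R X] [Module R' X] [IsScalarTower R' R X] :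
    ∃ (α : ∀ m, T R (m+2) N X →ₗ[R'] T R m N X) (β : ∀ m, T R (m+1) N X →ₗ[R'] T R' (m+2) N X)
      (γ : ∀ m, T R' (m+2) N X →ₗ[R'] T R (m+2) N X),
      (∀ m, Exact (α (m+1)) (β m)) ∧ (∀ m, Exact (β m) (γ m)) ∧ (∀ m, Exact (γ m) (α m)) := by
  obtain ⟨k, K, u, v, hK, hu, huv, hv⟩ := exists_fcover (R := R') N
  -- f regular on K
  have hFreg : IsSMulRegular (Fin k → R') f := by
    intro x y h
    funext i
    exact hf (congrFun h i)
  have hKreg : IsSMulRegular K f := by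
    intro x y h
    apply hu
    apply hFreg
    change f • u x = f • u y
    rw [← map_smul, ← map_smul]
    exact congrArg u h
  have hAK : Acyc R' K R := Acyc_hyper f hf hsurj hker hKreg
  -- f kills N
  have hfN : ∀ n : N, f • n = 0 := by
    intro n
    rw [← algebraMap_smul R f n]
    have : f ∈ RingHom.ker (algebraMap R' R) := by
      rw [hker]; exact Ideal.mem_span_singleton_self f
    rw [RingHom.mem_ker.1 this, zero_smul]
  -- kernel of R ⊗ K → R ⊗ F
  obtain ⟨e1⟩ := T_one_of_flat (R := R') (A := R) u v hu huv hv
  obtain ⟨e2⟩ := T_hyper_one (M := N) f hf hsurj hker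
  have e3 : LinearMap.ker (LinearMap.lsmul R' N f) ≃ₗ[R'] N :=
    (LinearEquiv.ofEq _ ⊤ (by
      ext x; simpa using hfN x)).trans Submodule.topEquiv
  let e4 : N ≃ₗ[R'] LinearMap.ker (u.lTensor R) := (e3.symm.trans e2.symm).trans e1
  let w : (R ⊗[R'] K) →ₗ[R] (R ⊗[R'] (Fin k → R')) := AlgebraTensorModule.lTensor R R u
  let g : (R ⊗[R'] (Fin k → R')) →ₗ[R] N := AlgebraTensorModule.lift
    (LinearMap.toSpanSingleton R ((Fin k → R') →ₗ[R'] N) v)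
  have hg : ∀ r x, g (r ⊗ₜ x) = r • v x := fun r x => rfl
  have hgs : Surjective g := fun n => by
    obtain ⟨x, rfl⟩ := hv n
    exact ⟨1 ⊗ₜ x, by rw [hg, one_smul]⟩
  have hwg : Exact w g := by
    intro y
    obtain ⟨x, rfl⟩ := TensorProduct.mk_surjective R' (Fin k → R') R hsurj y
    change g (1 ⊗ₜ x) = 0 ↔ _
    rw [hg, one_smul]
    constructor
    · intro h
      obtain ⟨z, rfl⟩ := (huv x).1 h
      exact ⟨1 ⊗ₜ z, rfl⟩
    · rintro ⟨z, hz⟩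
      obtain ⟨z', rfl⟩ := TensorProduct.mk_surjective R' K R hsurj z
      have h2 : g (w (1 ⊗ₜ z')) = 0 := by
        change g (1 ⊗ₜ u z') = 0
        rw [hg, huv.apply_apply_eq_zero, smul_zero]
      have h3 : w (1 ⊗ₜ z') = 1 ⊗ₜ x := hz
      rw [h3, hg, one_smul] at h2
      exact h2
  obtain ⟨N1, j, hj, hjg⟩ : ∃ (N1 : ModuleCat.{0} R) (j : N1 →ₗ[R] (R ⊗[R'] (Fin k → R'))),
      Injective j ∧ Exact j g :=
    ⟨ModuleCat.of R (LinearMap.ker g), (LinearMap.ker g).subtype, Subtype.val_injective,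
      LinearMap.exact_subtype_ker_map g⟩
  -- q : R ⊗ K → N1
  obtain ⟨q, hq⟩ : ∃ q : (R ⊗[R'] K) →ₗ[R] N1, ∀ x, j (q x) = w x := by
    have hr : ∀ x, w x ∈ LinearMap.range j := fun x =>
      (hjg _).1 (hwg.apply_apply_eq_zero x)
    refine ⟨(LinearEquiv.ofInjective j hj).symm.toLinearMap ∘ₗ w.codRestrict _ hr, fun x => ?_⟩
    have := LinearEquiv.apply_symm_apply (LinearEquiv.ofInjective j hj) (w.codRestrict _ hr x)
    exact congrArg Subtype.val this
  have hqs : Surjective q := fun y => by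
    obtain ⟨x, hx⟩ := (hwg (j y)).1 (hjg.apply_apply_eq_zero y)
    exact ⟨x, hj ((hq x).trans hx)⟩
  let i0 : N →ₗ[R'] (R ⊗[R'] K) := (LinearMap.ker (u.lTensor R)).subtype ∘ₗ e4.toLinearMap
  obtain ⟨i, hi⟩ : ∃ i : N →ₗ[R] (R ⊗[R'] K), ∀ x, i x = i0 x :=
    ⟨LinearMap.extendScalarsOfSurjective hsurj i0, fun x => rfl⟩
  have hii : Injective i := fun x y h => by
    rw [hi, hi] at h
    exact e4.injective (Subtype.ext h)
  have hiq : Exact i q := by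
    intro y
    rw [← hj.eq_iff, map_zero, hq]
    constructor
    · intro h
      exact ⟨e4.symm ⟨y, h⟩, by rw [hi]; simp [i0]⟩
    · rintro ⟨x, rfl⟩
      rw [hi]
      exact (e4 x).2
  have hac : Acyc R (R ⊗[R'] (Fin k → R')) X :=
    Acyc_congr_left (TensorProduct.piScalarRight R' R R (Fin k)).symm (Acyc_pi Acyc_flat k)
  have s1 : ∀ m, Nonempty (T R (m+2) N X ≃ₗ[R] T R (m+1) N1 X) := fun m =>
    T_shift (Y := X) hj hjg hgs hac m
  have s2 : ∀ m, Nonempty (T R (m+1) (R ⊗[R'] K) X ≃ₗ[R'] T R' (m+1) K X) := fun m =>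
    T_base_change X K hAK m
  have s3 : ∀ m, Nonempty (T R' (m+2) N X ≃ₗ[R'] T R' (m+1) K X) := fun m =>
    T_shift (Y := X) hu huv hv Acyc_flat m
  have s4 := fun m => T_les (Y := X) hii hiq hqs m
  choose δ hδ1 hδ2 using s4
  let E1 := fun m => (s1 m).some
  let E2 := fun m => (s3 m).some.trans (s2 m).some.symm
  refine ⟨fun m => ((δ m) ∘ₗ (E1 m).toLinearMap).restrictScalars R',
    fun m => (E2 m).symm.toLinearMap ∘ₗ (Tmap i (m+1) X).restrictScalars R',
    fun m => ((E1 m).symm.toLinearMap ∘ₗ Tmap q (m+1) X).restrictScalars R' ∘ₗ (E2 m).toLinearMap,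
    fun m => ?_, fun m => ?_, fun m => ?_⟩
  · intro y
    change (E2 m).symm (Tmap i (m+1) X y) = 0 ↔ ∃ x, δ (m+1) (E1 (m+1) x) = y
    rw [LinearEquiv.map_eq_zero_iff, show _ ↔ _ from hδ2 (m+1) y]
    exact ⟨fun ⟨x, hx⟩ => ⟨(E1 (m+1)).symm x, by rw [LinearEquiv.apply_symm_apply, hx]⟩,
      fun ⟨x, hx⟩ => ⟨_, hx⟩⟩
  · intro y
    change (E1 m).symm (Tmap q (m+1) X (E2 m y)) = 0 ↔ ∃ x, (E2 m).symm (Tmap i (m+1) X x) = y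
    rw [LinearEquiv.map_eq_zero_iff, show _ ↔ _ from T_exact hii hiq hqs (m+1) (E2 m y)]
    exact ⟨fun ⟨x, hx⟩ => ⟨x, by rw [hx, LinearEquiv.symm_apply_apply]⟩,
      fun ⟨x, hx⟩ => ⟨x, by rw [← hx, LinearEquiv.apply_symm_apply]⟩⟩
  · intro y
    change δ m (E1 m y) = 0 ↔ ∃ x, (E1 m).symm (Tmap q (m+1) X (E2 m x)) = y
    rw [show _ ↔ _ from hδ1 m (E1 m y)]
    exact ⟨fun ⟨x, hx⟩ => ⟨(E2 m).symm x, by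
        rw [LinearEquiv.apply_symm_apply, hx, LinearEquiv.symm_apply_apply]⟩,
      fun ⟨x, hx⟩ => ⟨_, by rw [← hx, LinearEquiv.apply_symm_apply]⟩⟩
end ChangeLES

section Lengths
open TensorProduct Function

/-- finite length -/
def FL (R M : Type) [CommRing R] [AddCommGroup M] [Module R M] : Prop := Module.length R M ≠ ⊤

/-- integer valued length -/
noncomputable def ell (R M : Type) [CommRing R] [AddCommGroup M] [Module R M] : ℤ :=
  ((Module.length R M).toNat : ℤ)

/-- length of the image -/
noncomputable def rk {R M N : Type} [CommRing R] [AddCommGroup M] [Module R M] [AddCommGroup N]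
    [Module R N] (f : M →ₗ[R] N) : ℤ := ell R (LinearMap.range f)

variable {R A B C : Type} [CommRing R] [AddCommGroup A] [Module R A] [AddCommGroup B] [Module R B]
  [AddCommGroup C] [Module R C]

lemma ell_nonneg : 0 ≤ ell R A := Int.natCast_nonneg _

lemma rk_nonneg (f : A →ₗ[R] B) : 0 ≤ rk f := ell_nonneg

lemma FL_inj (f : A →ₗ[R] B) (hf : Injective f) (h : FL R B) : FL R A :=
  ne_top_of_le_ne_top h (Module.length_le_of_injective f hf)

lemma FL_surj (f : A →ₗ[R] B) (hf : Surjective f) (h : FL R A) : FL R B :=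
  ne_top_of_le_ne_top h (Module.length_le_of_surjective f hf)

lemma FL_congr (e : A ≃ₗ[R] B) (h : FL R A) : FL R B := by
  unfold FL at *; rwa [← e.length_eq]

lemma ell_congr (e : A ≃ₗ[R] B) : ell R A = ell R B := by
  unfold ell; rw [e.length_eq]

lemma FL_sub [Subsingleton A] : FL R A := by
  unfold FL; rw [Module.length_eq_zero_iff.2 inferInstance]; simp

lemma ell_sub [Subsingleton A] : ell R A = 0 := by
  unfold ell; rw [Module.length_eq_zero_iff.2 inferInstance]; simp

lemma ell_eq_zero (h : FL R A) (h0 : ell R A = 0) : Subsingleton A := by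
  unfold ell at h0
  rw [Int.natCast_eq_zero, ENat.toNat_eq_zero] at h0
  exact Module.length_eq_zero_iff.1 (h0.resolve_right h)

lemma FL_exact (f : A →ₗ[R] B) (g : B →ₗ[R] C) (h : Exact f g) (hA : FL R A) (hC : FL R C) :
    FL R B := by
  have h1 := Module.length_eq_add_of_exact (LinearMap.range f).subtype g.rangeRestrict
    Subtype.val_injective (LinearMap.surjective_rangeRestrict g) (by
      intro y
      rw [← LinearMap.mem_ker, LinearMap.ker_rangeRestrict, LinearMap.mem_ker]
      rw [show _ ↔ _ from h y]
      simp)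
  unfold FL
  rw [h1]
  have h2 : FL R (LinearMap.range f) := FL_surj _ (LinearMap.surjective_rangeRestrict f) hA
  have h3 : FL R (LinearMap.range g) := FL_inj (LinearMap.range g).subtype Subtype.val_injective hC
  exact WithTop.add_ne_top.2 ⟨h2, h3⟩

lemma ell_exact (f : A →ₗ[R] B) (g : B →ₗ[R] C) (h : Exact f g) (hB : FL R B) :
    ell R B = rk f + rk g := by
  have h1 := Module.length_eq_add_of_exact (LinearMap.range f).subtype g.rangeRestrict
    Subtype.val_injective (LinearMap.surjective_rangeRestrict g) (by
      intro y
      rw [← LinearMap.mem_ker, LinearMap.ker_rangeRestrict, LinearMap.mem_ker]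
      rw [show _ ↔ _ from h y]
      simp)
  unfold rk ell
  have h2 : FL R (LinearMap.range f) := FL_inj (LinearMap.range f).subtype Subtype.val_injective hB
  have h3 : FL R (LinearMap.range g) := FL_surj _ (LinearMap.surjective_rangeRestrict g) hB
  rw [h1, ENat.toNat_add h2 h3]
  push_cast; rfl

lemma rk_surj (f : A →ₗ[R] B) (h : Surjective f) : rk f = ell R B := by
  unfold rk
  exact ell_congr ((LinearEquiv.ofEq _ _ (LinearMap.range_eq_top.2 h)).trans Submodule.topEquiv)

lemma rk_inj (f : A →ₗ[R] B) (h : Injective f) : rk f = ell R A :=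
  (ell_congr (LinearEquiv.ofInjective f h)).symm

lemma rk_eq_zero (f : A →ₗ[R] B) (hB : FL R (LinearMap.range f)) (h : rk f = 0) : f = 0 := by
  have := ell_eq_zero hB h
  rw [Submodule.subsingleton_iff_eq_bot, LinearMap.range_eq_bot] at this
  exact this

lemma rk_dom [Subsingleton A] (f : A →ₗ[R] B) : rk f = 0 := by
  have : f = 0 := by ext x; rw [Subsingleton.elim x 0]; simp
  rw [this]; unfold rk; rw [LinearMap.range_zero]; exact ell_sub

lemma rk_cod [Subsingleton B] (f : A →ₗ[R] B) : rk f = 0 := by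
  unfold rk; exact ell_sub

lemma rk_zero_map : rk (0 : A →ₗ[R] B) = 0 := by
  unfold rk; rw [LinearMap.range_zero]; exact ell_sub

lemma rk_le_dom (f : A →ₗ[R] B) (h : FL R A) : rk f ≤ ell R A := by
  have := Module.length_le_of_surjective _ (LinearMap.surjective_rangeRestrict f)
  unfold rk ell
  exact_mod_cast ENat.toNat_le_toNat this h

lemma rk_le_cod (f : A →ₗ[R] B) (h : FL R B) : rk f ≤ ell R B := by
  have := Module.length_le_of_injective (LinearMap.range f).subtype Subtype.val_injective
  unfold rk ell
  exact_mod_cast ENat.toNat_le_toNat this h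

end Lengths

section RegFacts
open TensorProduct Function RingTheory.Sequence

lemma T_les_num {R A B C Y : Type} [CommRing R] [AddCommGroup A] [Module R A] [AddCommGroup B]
    [Module R B] [AddCommGroup C] [Module R C] [AddCommGroup Y] [Module R Y]
    {f : A →ₗ[R] B} {g : B →ₗ[R] C} (hf : Injective f) (hfg : Exact f g) (hg : Surjective g) :
    ∃ δ : ℕ → ℤ, (∀ n, 0 ≤ δ n) ∧
      (∀ n, FL R (T R n A Y) → ell R (T R n A Y) = δ n + rk (Tmap f n Y)) ∧
      (∀ n, FL R (T R n B Y) → ell R (T R n B Y) = rk (Tmap f n Y) + rk (Tmap g n Y)) ∧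
      (∀ n, FL R (T R (n+1) C Y) → ell R (T R (n+1) C Y) = rk (Tmap g (n+1) Y) + δ n) ∧
      ell R (T R 0 C Y) = rk (Tmap g 0 Y) ∧
      (∀ n, Subsingleton (T R n A Y) → δ n = 0) := by
  have h := fun n => T_les (Y := Y) hf hfg hg n
  choose δ h1 h2 using h
  refine ⟨fun n => rk (δ n), fun n => rk_nonneg _, fun n h => ell_exact _ _ (h2 n) h,
    fun n h => ell_exact _ _ (T_exact hf hfg hg n) h, fun n h => ell_exact _ _ (h1 n) h,
    (rk_surj _ (T0_surj hg)).symm, fun n h => ?_⟩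
  exact rk_cod _

/-- alternating partial sums -/
lemma alt_telescope (δ : ℕ → ℤ) (n : ℕ) :
    ∑ i ∈ Finset.range n, (-1:ℤ)^i * (δ (i+1) + δ i) = δ 0 - (-1:ℤ)^n * δ n := by
  induction n with
  | zero => simp
  | succ n ih => rw [Finset.sum_range_succ, ih, pow_succ]; ring

open Pointwise in
lemma quot_ses {R M : Type} [CommRing R] [AddCommGroup M] [Module R M] (t : R) :
    ∃ g : M →ₗ[R] QuotSMulTop t M, Surjective g ∧ Exact (LinearMap.lsmul R M t) g := by
  refine ⟨Submodule.mkQ _, Submodule.mkQ_surjective _, ?_⟩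
  intro y
  rw [Submodule.mkQ_apply, Submodule.Quotient.mk_eq_zero, Submodule.mem_smul_pointwise_iff_exists]
  constructor
  · rintro ⟨x, -, rfl⟩; exact ⟨x, rfl⟩
  · rintro ⟨x, rfl⟩; exact ⟨x, trivial, rfl⟩

lemma ell_T_left {R A B D : Type} [CommRing R] [AddCommGroup A] [Module R A] [AddCommGroup B]
    [Module R B] [AddCommGroup D] [Module R D] (e : A ≃ₗ[R] B) (i : ℕ) :
    ell R (T R i A D) = ell R (T R i B D) := ell_congr (Tcongr e i D)

lemma FL_T_left {R A B D : Type} [CommRing R] [AddCommGroup A] [Module R A] [AddCommGroup B]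
    [Module R B] [AddCommGroup D] [Module R D] (e : A ≃ₗ[R] B) (i : ℕ) :
    FL R (T R i A D) → FL R (T R i B D) := FL_congr (Tcongr e i D)

lemma ell_T_comm {R A D : Type} [CommRing R] [AddCommGroup A] [Module R A]
    [AddCommGroup D] [Module R D] (i : ℕ) :
    ell R (T R i A D) = ell R (T R i D A) := ell_congr (T_comm (R := R) A D i).some

lemma FL_T_comm {R A D : Type} [CommRing R] [AddCommGroup A] [Module R A]
    [AddCommGroup D] [Module R D] (i : ℕ) :
    FL R (T R i A D) → FL R (T R i D A) := FL_congr (T_comm (R := R) A D i).some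

lemma sub_T_left {R A B D : Type} [CommRing R] [AddCommGroup A] [Module R A] [AddCommGroup B]
    [Module R B] [AddCommGroup D] [Module R D] (e : A ≃ₗ[R] B) (i : ℕ)
    (h : Subsingleton (T R i A D)) : Subsingleton (T R i B D) :=
  (Tcongr e i D).symm.toEquiv.subsingleton

lemma sub_T_comm {R A D : Type} [CommRing R] [AddCommGroup A] [Module R A]
    [AddCommGroup D] [Module R D] (i : ℕ)
    (h : Subsingleton (T R i A D)) : Subsingleton (T R i D A) :=
  (T_comm (R := R) A D i).some.symm.toEquiv.subsingleton

lemma Tmap_lsmul {R M : Type} [CommRing R] [AddCommGroup M] [Module R M] (t : R) (n : ℕ) (D : Type)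
    [AddCommGroup D] [Module R D] (x : T R n M D) : Tmap (LinearMap.lsmul R M t) n D x = t • x := by
  have : LinearMap.lsmul R M t = t • (LinearMap.id : M →ₗ[R] M) := by ext; simp
  rw [this, Tmap_smul, Tmap_id]; rfl

section step
variable {R M D Q : Type} [CommRing R] [AddCommGroup M] [Module R M] [AddCommGroup D] [Module R D]
  [AddCommGroup Q] [Module R Q]

lemma reg_step1 (t : R) (h1 : IsSMulRegular M t) {g : M →ₗ[R] Q}
    (h2 : Exact (LinearMap.lsmul R M t) g) (hs : Surjective g) (s : ℕ)
    (h : ∀ i, s < i → Subsingleton (T R i M D)) (i : ℕ) (hi : s + 1 < i) :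
    Subsingleton (T R i Q D) := by
  obtain ⟨i, rfl⟩ : ∃ j, i = j + 1 := ⟨i - 1, by omega⟩
  obtain ⟨δ, h3, h4⟩ := T_les (R := R) (Y := D) (f := LinearMap.lsmul R M t) h1 h2 hs i
  have a1 := h i (by omega)
  have a2 := h (i+1) (by omega)
  refine ⟨fun x y => ?_⟩
  have : ∀ x : T R (i+1) Q D, x = 0 := fun x => by
    obtain ⟨z, rfl⟩ := (h3 x).1 (Subsingleton.elim _ _)
    rw [Subsingleton.elim z 0, map_zero]
  rw [this x, this y]

lemma reg_step2 (t : R) (h1 : IsSMulRegular M t) {g : M →ₗ[R] Q}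
    (h2 : Exact (LinearMap.lsmul R M t) g) (hs : Surjective g) (s : ℕ)
    (h : ∀ i, s < i → Subsingleton (T R i M D)) (hD : ∀ d : D, t • d = 0) :
    Nonempty (T R (s+1) Q D ≃ₗ[R] T R s M D) := by
  obtain ⟨δ, h3, h4⟩ := T_les (R := R) (Y := D) (f := LinearMap.lsmul R M t) h1 h2 hs s
  have a2 := h (s+1) (by omega)
  refine ⟨LinearEquiv.ofBijective δ ⟨?_, ?_⟩⟩
  · rw [← LinearMap.ker_eq_bot, LinearMap.ker_eq_bot']
    intro x hx
    obtain ⟨y, rfl⟩ := (h3 x).1 hx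
    rw [Subsingleton.elim y 0, map_zero]
  · intro x
    exact (h4 x).1 (by rw [Tmap_lsmul]; exact T_smul_right t hD s x)

lemma reg_step3 (t : R) (h1 : IsSMulRegular M t) {g : M →ₗ[R] Q}
    (h2 : Exact (LinearMap.lsmul R M t) g) (hs : Surjective g) (s : ℕ)
    (h : ∀ i, s < i → Subsingleton (T R i M D)) (hFL : ∀ i, FL R (T R i M D)) :
    (∀ i, FL R (T R i Q D)) ∧ ∀ n, s + 1 < n →
      ∑ i ∈ Finset.range n, (-1:ℤ)^i * ell R (T R i Q D) = 0 := by
  have hF : ∀ i, FL R (T R i Q D) := by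
    intro i
    cases i with
    | zero => exact FL_surj _ (T0_surj hs) (hFL 0)
    | succ i =>
      obtain ⟨δ, h3, h4⟩ := T_les (R := R) (Y := D) (f := LinearMap.lsmul R M t) h1 h2 hs i
      exact FL_exact _ _ h3 (hFL _) (hFL _)
  refine ⟨hF, fun n hn => ?_⟩
  obtain ⟨δ, -, a1, a2, a3, a4, a5⟩ := T_les_num (R := R) (Y := D) (f := LinearMap.lsmul R M t) h1 h2 hs
  obtain ⟨n, rfl⟩ : ∃ j, n = j + 1 := ⟨n - 1, by omega⟩
  rw [Finset.sum_range_succ', a4]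
  have key : ∀ i, ell R (T R (i+1) Q D) = δ (i+1) + δ i := fun i => by
    have b1 := a1 (i+1) (hFL _)
    have b2 := a2 (i+1) (hFL _)
    have b3 := a3 i (hF _)
    linarith
  have k0 : rk (Tmap g 0 D) = δ 0 := by
    have b1 := a1 0 (hFL _)
    have b2 := a2 0 (hFL _)
    linarith
  have : ∑ i ∈ Finset.range n, (-1:ℤ)^(i+1) * ell R (T R (i+1) Q D)
    = - ∑ i ∈ Finset.range n, (-1:ℤ)^i * (δ (i+1) + δ i) := by
    rw [← Finset.sum_neg_distrib]
    refine Finset.sum_congr rfl fun i _ => ?_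
    rw [key, pow_succ]; ring
  rw [this, alt_telescope, k0, a5 n (h n (by omega))]
  ring
end step

lemma reg_facts {R D : Type} [CommRing R] [AddCommGroup D] [Module R D] (ts : List R) :
    ∀ (M : Type) [AddCommGroup M] [Module R M] (s : ℕ), IsWeaklyRegular M ts →
    (∀ i, s < i → Subsingleton (T R i M D)) →
    (∀ i, s + ts.length < i →
      Subsingleton (T R i (M ⧸ (Ideal.ofList ts • ⊤ : Submodule R M)) D)) ∧
    ((∀ t ∈ ts, ∀ d : D, t • d = 0) →
      Nonempty (T R (s + ts.length) (M ⧸ (Ideal.ofList ts • ⊤ : Submodule R M)) D ≃ₗ[R]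
        T R s M D)) ∧
    ((∀ i, FL R (T R i M D)) →
      (∀ i, FL R (T R i (M ⧸ (Ideal.ofList ts • ⊤ : Submodule R M)) D)) ∧
      (ts ≠ [] → ∀ n, s + ts.length < n → ∑ i ∈ Finset.range n, (-1:ℤ)^i *
        ell R (T R i (M ⧸ (Ideal.ofList ts • ⊤ : Submodule R M)) D) = 0)) := by
  induction ts with
  | nil =>
    intro M _ _ s _ h
    have e : (M ⧸ (Ideal.ofList ([] : List R) • ⊤ : Submodule R M)) ≃ₗ[R] M :=
      Submodule.quotEquivOfEqBot _ (by rw [Ideal.ofList_nil]; exact Submodule.bot_smul _)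
    refine ⟨fun i hi => ?_, fun _ => ?_, fun hF => ⟨fun i => ?_, fun h => absurd rfl h⟩⟩
    · have := h i (by simpa using hi)
      obtain ⟨e'⟩ := T_congr_left (R := R) D e i
      exact e'.toEquiv.subsingleton
    · exact T_congr_left D e s
    · obtain ⟨e'⟩ := T_congr_left (R := R) D e i
      exact FL_congr e'.symm (hF i)
  | cons t ts ih =>
    intro M _ _ s hreg h
    obtain ⟨h1, h2⟩ := (isWeaklyRegular_cons_iff M t ts).1 hreg
    have e : (M ⧸ (Ideal.ofList (t::ts) • ⊤ : Submodule R M)) ≃ₗ[R]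
        (QuotSMulTop t M ⧸ (Ideal.ofList ts • ⊤ : Submodule R (QuotSMulTop t M))) :=
      Submodule.quotOfListConsSMulTopEquivQuotSMulTopInner M t ts
    obtain ⟨g, hg, hg2⟩ := quot_ses (M := M) t
    have e' := fun i => Tcongr e i D
    obtain ⟨a1, a2, a3⟩ := ih (QuotSMulTop t M) (s+1) h2 (reg_step1 t h1 hg2 hg s h)
    have hl : s + (t :: ts).length = s + 1 + ts.length := by simp; omega
    rw [hl]
    refine ⟨fun i hi => ?_, fun hD => ?_, fun hF => ?_⟩
    · have := a1 i hi
      exact (e' i).toEquiv.subsingleton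
    · obtain ⟨b1⟩ := a2 fun x hx => hD x (List.mem_cons_of_mem _ hx)
      obtain ⟨b2⟩ := reg_step2 t h1 hg2 hg s h (hD t List.mem_cons_self)
      exact ⟨((e' _).trans b1).trans b2⟩
    · obtain ⟨b1, b2⟩ := reg_step3 t h1 hg2 hg s h hF
      obtain ⟨b3, b4⟩ := a3 b1
      refine ⟨fun i => FL_T_left e.symm i (b3 i), fun _ n hn => ?_⟩
      simp only [ell_T_left e]
      by_cases hts : ts = []
      · subst hts
        have e2 : (QuotSMulTop t M ⧸ (Ideal.ofList ([] : List R) • ⊤ : Submodule R (QuotSMulTop t M))) ≃ₗ[R]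
          QuotSMulTop t M :=
            Submodule.quotEquivOfEqBot _ (by rw [Ideal.ofList_nil, Submodule.bot_smul])
        simp only [ell_T_left e2]
        exact b2 n (by simpa using hn)
      · exact b4 hts n hn

/-- versions for the ring and in the order needed -/
lemma reg_ring {R D : Type} [CommRing R] [AddCommGroup D] [Module R D] (ts : List R)
    (hts : IsWeaklyRegular R ts) :
    (∀ i, ts.length < i → Subsingleton (T R i D (R ⧸ Ideal.ofList ts))) ∧
    ((∀ t ∈ ts, ∀ d : D, t • d = 0) →
      Nonempty (T R ts.length D (R ⧸ Ideal.ofList ts) ≃ₗ[R] D)) ∧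
    (FL R D →
      (∀ i, FL R (T R i D (R ⧸ Ideal.ofList ts))) ∧
      (ts ≠ [] → ∀ n, ts.length < n → ∑ i ∈ Finset.range n, (-1:ℤ)^i *
        ell R (T R i D (R ⧸ Ideal.ofList ts)) = 0)) := by
  have e : (R ⧸ (Ideal.ofList ts • ⊤ : Submodule R R)) ≃ₗ[R] (R ⧸ Ideal.ofList ts) :=
    Submodule.quotEquivOfEq _ _ (by simp)
  have e1 : ∀ i, T R i (R ⧸ (Ideal.ofList ts • ⊤ : Submodule R R)) D ≃ₗ[R]
      T R i D (R ⧸ Ideal.ofList ts) := fun i =>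
    ((T_congr_left (R := R) D e i).some).trans (T_comm (R := R) _ _ i).some
  have e0 : T R 0 R D ≃ₗ[R] D := (T0e (R := R) R D).trans (TensorProduct.lid R D)
  have hflat : ∀ i, 0 < i → Subsingleton (T R i R D) := fun i hi => by
    obtain ⟨j, rfl⟩ : ∃ j, i = j + 1 := ⟨i - 1, by omega⟩
    exact T_flat j
  obtain ⟨a1, a2, a3⟩ := reg_facts (D := D) ts R 0 hts hflat
  rw [zero_add] at a1 a2 a3
  refine ⟨fun i hi => ?_, fun hD => ?_, fun hF => ?_⟩
  · have := a1 i hi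
    exact (e1 i).symm.toEquiv.subsingleton
  · obtain ⟨b⟩ := a2 hD
    exact ⟨(e1 _).symm.trans (b.trans e0)⟩
  · obtain ⟨b1, b2⟩ := a3 fun i => by
      cases i with
      | zero => exact FL_congr e0.symm hF
      | succ i => exact @FL_sub _ _ _ _ _ (T_flat i)
    refine ⟨fun i => FL_T_comm i (FL_T_left e i (b1 i)), fun h n hn => ?_⟩
    rw [← b2 h n hn]
    exact Finset.sum_congr rfl fun i _ => by rw [ell_T_comm, ell_T_left e]

end RegFacts

section LemX
open TensorProduct Function RingTheory.Sequence

lemma reg_swap_aux {Λ : Type} [CommRing Λ] [IsLocalRing Λ] (ts : List Λ) :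
    ∀ z ∈ Ideal.ofList ts, z ∈ maximalIdeal Λ * Ideal.ofList ts ∨
      ∃ (t : Λ) (l : List Λ) (y a : Λ), ts.Perm (t :: l) ∧ y ∈ Ideal.ofList l ∧ IsUnit a ∧
        z = y + a * t := by
  induction ts with
  | nil =>
    intro z hz
    left
    rw [Ideal.ofList_nil] at hz ⊢
    rw [Ideal.mem_bot.1 hz]; exact zero_mem _
  | cons t l ih =>
    intro z hz
    rw [Ideal.ofList_cons, Submodule.mem_sup] at hz
    obtain ⟨w, hw, y, hy, rfl⟩ := hz
    obtain ⟨a, rfl⟩ := Ideal.mem_span_singleton'.1 hw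
    by_cases ha : IsUnit a
    · right
      exact ⟨t, l, y, a, List.Perm.refl _, hy, ha, by ring⟩
    · have ha' : a ∈ maximalIdeal Λ := (mem_maximalIdeal a).2 ha
      rcases ih y hy with h | ⟨t', l', y', a', h1, h2, h3, rfl⟩
      · left
        rw [Ideal.ofList_cons, Ideal.mul_sup]
        exact Submodule.add_mem_sup (Ideal.mul_mem_mul ha' (Ideal.mem_span_singleton_self t)) h
      · right
        refine ⟨t', t :: l', y' + a * t, a', (h1.cons t).trans (List.Perm.swap _ _ _), ?_, h3,
          by ring⟩
        rw [Ideal.ofList_cons, add_comm]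
        exact Submodule.add_mem_sup hw h2

lemma ofList_perm {Λ : Type} [CommRing Λ] {l l' : List Λ} (h : l.Perm l') :
    Ideal.ofList l = Ideal.ofList l' := by
  unfold Ideal.ofList
  congr 1
  ext x
  exact h.mem_iff

lemma reg_swap {Λ : Type} [CommRing Λ] [IsLocalRing Λ] [IsNoetherianRing Λ] (ts : List Λ)
    (hts : IsWeaklyRegular Λ ts) (hm : ∀ t ∈ ts, t ∈ maximalIdeal Λ) (z : Λ)
    (hz : z ∈ Ideal.ofList ts) (hz' : z ∉ maximalIdeal Λ * Ideal.ofList ts) :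
    ∃ l : List Λ, l.length + 1 = ts.length ∧ (∀ t ∈ l, t ∈ maximalIdeal Λ) ∧
      IsWeaklyRegular Λ (z :: l) ∧ Ideal.ofList (z :: l) = Ideal.ofList ts := by
  obtain ⟨t, l, y, a, h1, h2, h3, rfl⟩ := (reg_swap_aux ts z hz).resolve_left hz'
  have hl : ∀ t ∈ l, t ∈ maximalIdeal Λ :=
    fun x hx => hm x (h1.mem_iff.2 (List.mem_cons_of_mem _ hx))
  have h4 : ts.Perm (l ++ [t]) := h1.trans (List.perm_append_singleton t l).symm
  have h5 := IsLocalRing.isWeaklyRegular_of_perm_of_subset_maximalIdeal hts h4 hm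
  rw [isWeaklyRegular_append_iff, isWeaklyRegular_singleton_iff] at h5
  have hzm : y + a * t ∈ maximalIdeal Λ := by
    have : Ideal.ofList ts ≤ maximalIdeal Λ := Ideal.span_le.2 fun x hx => hm x hx
    exact this hz
  refine ⟨l, by simpa using h1.length_eq.symm, hl, ?_, ?_⟩
  · refine IsLocalRing.isWeaklyRegular_of_perm_of_subset_maximalIdeal (rs := l ++ [y + a * t])
      ?_ (List.perm_append_singleton _ _) ?_
    · rw [isWeaklyRegular_append_iff, isWeaklyRegular_singleton_iff]
      refine ⟨h5.1, ?_⟩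
      have hk : ∀ w : Λ ⧸ (Ideal.ofList l • ⊤ : Submodule Λ Λ), (y + a * t) • w = a • t • w := by
        intro w
        obtain ⟨w, rfl⟩ := Submodule.Quotient.mk_surjective _ w
        rw [← Submodule.Quotient.mk_smul, ← Submodule.Quotient.mk_smul, ← Submodule.Quotient.mk_smul,
          Submodule.Quotient.eq]
        have : (y + a * t) • w - a • t • w = y • w := by simp only [smul_eq_mul]; ring
        rw [this]
        exact Submodule.smul_mem_smul h2 trivial
      intro w w' hw
      simp only [hk] at hw
      exact h5.2 ((h3.isSMulRegular _) hw)
    · intro r hr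
      rcases List.mem_append.1 hr with h | h
      · exact hl r h
      · rw [List.mem_singleton.1 h]; exact hzm
  · rw [ofList_perm h1, Ideal.ofList_cons, Ideal.ofList_cons]
    apply le_antisymm
    · refine sup_le ?_ le_sup_right
      rw [Ideal.span_singleton_le_iff_mem, add_comm]
      exact Submodule.add_mem_sup (Ideal.mem_span_singleton'.2 ⟨a, rfl⟩) h2
    · refine sup_le ?_ le_sup_right
      rw [Ideal.span_singleton_le_iff_mem]
      obtain ⟨b, hb⟩ := h3.exists_left_inv
      have h6 := Submodule.add_mem_sup (S := Ideal.span {y + a * t}) (T := Ideal.ofList l)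
        (Ideal.mem_span_singleton'.2 ⟨b, rfl⟩) (neg_mem (Ideal.mul_mem_left _ b h2))
      have h7 : b * (y + a * t) + (- (b * y)) = t := by linear_combination t * hb
      rwa [h7] at h6

/-- existence of the finite length part -/
lemma exists_gamma {Λ W : Type} [CommRing Λ] [IsNoetherianRing Λ] [IsLocalRing Λ]
    [AddCommGroup W] [Module Λ W] [Module.Finite Λ W] :
    ∃ Γ : Submodule Λ W, FL Λ Γ ∧ maximalIdeal Λ ∉ associatedPrimes Λ (W ⧸ Γ) := by
  obtain ⟨Γ, h1, h2⟩ := set_has_maximal_iff_noetherian.2 (inferInstance : IsNoetherian Λ W)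
    {Γ : Submodule Λ W | FL Λ Γ} ⟨⊥, FL_sub⟩
  refine ⟨Γ, h1, fun hm => ?_⟩
  obtain ⟨hp, x, hx⟩ := (isAssociatedPrime_iff).1 (AssociatedPrimes.mem_iff.1 hm)
  obtain ⟨x, rfl⟩ := Submodule.Quotient.mk_surjective _ x
  have hmx : ∀ a ∈ maximalIdeal Λ, a • x ∈ Γ := by
    intro a ha
    rw [hx] at ha
    have := Submodule.mem_colon_singleton.1 ha
    rwa [Submodule.mem_bot, ← Submodule.Quotient.mk_smul, Submodule.Quotient.mk_eq_zero] at this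
  have hxΓ : x ∉ Γ := by
    intro hxΓ
    apply hp.ne_top
    rw [hx, Ideal.eq_top_iff_one, Submodule.mem_colon_singleton,
      (Submodule.Quotient.mk_eq_zero Γ).2 hxΓ, smul_zero]
    exact zero_mem _
  refine h2 (Γ ⊔ Submodule.span Λ {x}) ?_ ?_
  · let i : Γ →ₗ[Λ] ↥(Γ ⊔ Submodule.span Λ {x}) := Submodule.inclusion le_sup_left
    have hfl : FL Λ (↥(Γ ⊔ Submodule.span Λ {x}) ⧸ LinearMap.range i) := by
      let y : ↥(Γ ⊔ Submodule.span Λ {x}) :=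
        ⟨x, Submodule.mem_sup_right (Submodule.mem_span_singleton_self x)⟩
      let g : Λ →ₗ[Λ] (↥(Γ ⊔ Submodule.span Λ {x}) ⧸ LinearMap.range i) :=
        LinearMap.toSpanSingleton Λ _ (Submodule.Quotient.mk y)
      have hg : maximalIdeal Λ ≤ LinearMap.ker g := by
        intro a ha
        rw [LinearMap.mem_ker, LinearMap.toSpanSingleton_apply, ← Submodule.Quotient.mk_smul,
          Submodule.Quotient.mk_eq_zero]
        exact ⟨⟨_, hmx a ha⟩, rfl⟩
      refine FL_surj ((maximalIdeal Λ).liftQ g hg) ?_ ?_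
      · rw [← LinearMap.range_eq_top, Submodule.range_liftQ, LinearMap.range_eq_top]
        intro w
        obtain ⟨⟨w, hw⟩, rfl⟩ := Submodule.Quotient.mk_surjective _ w
        obtain ⟨u, hu, v, hv, rfl⟩ := Submodule.mem_sup.1 hw
        obtain ⟨a, rfl⟩ := Submodule.mem_span_singleton.1 hv
        refine ⟨a, ?_⟩
        rw [LinearMap.toSpanSingleton_apply, ← Submodule.Quotient.mk_smul,
          Submodule.Quotient.eq]
        refine ⟨-⟨u, hu⟩, ?_⟩
        ext
        simp [i, y]
      · have : IsSimpleModule Λ (Λ ⧸ maximalIdeal Λ) :=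
          isSimpleModule_iff_isCoatom.2 (maximalIdeal.isMaximal Λ).out
        unfold FL
        rw [Module.length_eq_one]
        simp
    exact FL_exact i (LinearMap.range i).mkQ
      (LinearMap.exact_map_mkQ_range i) h1 hfl
  · refine lt_of_le_of_ne le_sup_left fun h => hxΓ ?_
    rw [h]
    exact Submodule.mem_sup_right (Submodule.mem_span_singleton_self x)

/-- the primes over `I` associated to `W̄` -/
lemma ass_bound {Λ W : Type} [CommRing Λ] [IsNoetherianRing Λ] [IsLocalRing Λ]
    [AddCommGroup W] [Module Λ W] (ts : List Λ) (hts : IsWeaklyRegular Λ ts)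
    (q : Ideal Λ) (hq : q ∈ associatedPrimes Λ W) (hI : Ideal.ofList ts ≤ q)
    (hFL : FL Λ (T Λ ts.length W (Λ ⧸ Ideal.ofList ts))) : q = maximalIdeal Λ := by
  have hqp : q.IsPrime := hq.1
  obtain ⟨f, hf⟩ : ∃ f : (Λ ⧸ q) →ₗ[Λ] W, Injective f := by
    obtain ⟨hp, x, hx⟩ := (isAssociatedPrime_iff).1 (AssociatedPrimes.mem_iff.1 hq)
    have hk : q = LinearMap.ker (LinearMap.toSpanSingleton Λ W x) := by
      rw [hx]; ext a; simp [Submodule.mem_colon_singleton]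
    refine ⟨q.liftQ (LinearMap.toSpanSingleton Λ W x) hk.le, ?_⟩
    rw [← LinearMap.ker_eq_bot]
    exact Submodule.ker_liftQ_eq_bot _ _ _ hk.ge
  obtain ⟨C, g, hg, hfg⟩ : ∃ (C : ModuleCat.{0} Λ) (g : W →ₗ[Λ] C), Surjective g ∧ Exact f g :=
    ⟨ModuleCat.of Λ (W ⧸ LinearMap.range f), (LinearMap.range f).mkQ,
      Submodule.mkQ_surjective _, LinearMap.exact_map_mkQ_range f⟩
  obtain ⟨δ, h1, h2⟩ := T_les (Y := Λ ⧸ Ideal.ofList ts) hf hfg hg ts.length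
  have h3 := (reg_ring (D := C) ts hts).1 (ts.length + 1) (by omega)
  have h4 : FL Λ (T Λ ts.length (Λ ⧸ q) (Λ ⧸ Ideal.ofList ts)) := by
    refine FL_exact _ _ h2 ?_ hFL
    exact @FL_sub _ _ _ _ _ h3
  obtain ⟨e⟩ := (reg_ring (D := Λ ⧸ q) ts hts).2.1 (by
    intro t ht d
    obtain ⟨d, rfl⟩ := Submodule.Quotient.mk_surjective _ d
    rw [← Submodule.Quotient.mk_smul, Submodule.Quotient.mk_eq_zero]
    exact q.mul_mem_right _ (hI (Ideal.subset_span ht)))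
  have h5 := FL_congr e h4
  have h6 : IsArtinian Λ (Λ ⧸ q) := (isFiniteLength_iff_isNoetherian_isArtinian.1
    (Module.length_ne_top_iff.1 h5)).2
  have h7 : IsArtinianRing (Λ ⧸ q) :=
    isArtinian_of_tower Λ h6
  have h8 : IsField (Λ ⧸ q) := IsArtinianRing.isField_of_isDomain _
  exact IsLocalRing.eq_maximalIdeal (Ideal.Quotient.maximal_of_isField q h8)

lemma exists_z {Λ W : Type} [CommRing Λ] [IsNoetherianRing Λ] [IsLocalRing Λ]
    [AddCommGroup W] [Module Λ W] [Module.Finite Λ W] (I : Ideal Λ) (hI : I ≠ ⊥)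
    (h : ∀ q ∈ associatedPrimes Λ W, ¬ I ≤ q) :
    ∃ z ∈ I, z ∉ maximalIdeal Λ * I ∧ IsSMulRegular W z := by
  classical
  by_contra hcon
  push Not at hcon
  have hfin := associatedPrimes.finite Λ W
  have hsub : (I : Set Λ) ⊆ ⋃ i ∈ ((insert (maximalIdeal Λ * I) hfin.toFinset : Finset (Ideal Λ)) :
      Set (Ideal Λ)), (id i : Ideal Λ) := by
    intro z hz
    by_cases hz2 : z ∈ maximalIdeal Λ * I
    · exact Set.mem_biUnion (by simp) hz2
    · have h3 : z ∈ ({r : Λ | IsSMulRegular W r}ᶜ : Set Λ) := hcon z hz hz2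
      rw [← biUnion_associatedPrimes_eq_compl_regular] at h3
      obtain ⟨q, hq, hzq⟩ := Set.mem_iUnion₂.1 h3
      exact Set.mem_biUnion (x := q) (by simp [hq]) hzq
  rw [Ideal.subset_union_prime (maximalIdeal Λ * I) (maximalIdeal Λ * I)] at hsub
  · obtain ⟨i, hi, hle⟩ := hsub
    rcases Finset.mem_insert.1 hi with rfl | hi
    · exact hI (Submodule.eq_bot_of_le_smul_of_le_jacobson_bot (maximalIdeal Λ) I
        (IsNoetherian.noetherian I) hle (IsLocalRing.maximalIdeal_le_jacobson _))
    · exact h i (hfin.mem_toFinset.1 hi) hle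
  · intro i hi h1 _
    rcases Finset.mem_insert.1 hi with rfl | hi
    · exact absurd rfl h1
    · exact (hfin.mem_toFinset.1 hi).1

lemma FL_semilin {R R1 M M' : Type} [CommRing R] [CommRing R1] (f : R →+* R1) (h : Surjective f)
    [AddCommGroup M]
    [Module R1 M] [AddCommGroup M'] [Module R M'] (e : M ≃+ M')
    (he : ∀ (a : R) (x : M), e (f a • x) = a • e x) :
    (FL R M' ↔ FL R1 M) ∧ ell R M' = ell R1 M := by
  let := f.toAlgebra
  let : Module R M := Module.compHom M f
  have : IsScalarTower R R1 M := ⟨fun a b x => by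
    rw [Algebra.smul_def, mul_smul]; rfl⟩
  let e' : M ≃ₗ[R] M' := { e with map_smul' := he }
  have := Module.length_eq_of_surjective (R := R1) (S := R) (M := M) h
  unfold FL ell
  rw [← e'.length_eq, this]
  exact ⟨Iff.rfl, rfl⟩

lemma T_base_change' {R Λ : Type} [CommRing R] [IsNoetherianRing R] [CommRing Λ] [Algebra R Λ]
    (Y : Type) [AddCommGroup Y] [Module Λ Y] [Module R Y] [IsScalarTower R Λ Y]
    (A : Type) [AddCommGroup A] [Module R A] [Module.Finite R A] (hA : Acyc R A Λ)
    (V : Type) [AddCommGroup V] [Module Λ V] (e : V ≃ₗ[Λ] Λ ⊗[R] A) (n : ℕ) :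
    ∃ e : T Λ (n+1) V Y ≃+ T R (n+1) A Y, ∀ (a : R) x, e (algebraMap R Λ a • x) = a • e x := by
  obtain ⟨e2⟩ := T_base_change (R := R) (Λ := Λ) Y A hA n
  have e1 := Tcongr (B := Λ ⊗[R] A) e (n+1) Y
  refine ⟨e1.toAddEquiv.trans e2.toAddEquiv, fun a x => ?_⟩
  change e2 (e1 (algebraMap R Λ a • x)) = a • e2 (e1 x)
  have h1 : e1 (algebraMap R Λ a • x) = algebraMap R Λ a • e1 x := e1.map_smul _ _
  have h2 : e2 (a • e1 x) = a • e2 (e1 x) := e2.map_smul _ _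
  rw [h1, ← h2]
  exact congrArg e2 (Subtype.ext (algebraMap_smul Λ a (e1 x).1))

/-- the conclusion of the nonnegativity lemma -/
def ChiGood (Λ W Y : Type) [CommRing Λ] [AddCommGroup W] [Module Λ W] [AddCommGroup Y]
    [Module Λ Y] (r : ℕ) : Prop :=
  ∀ n, r ≤ n → 0 ≤ ∑ i ∈ Finset.range n, (-1:ℤ)^i * ell Λ (T Λ (i+1) W Y) ∧
    (∑ i ∈ Finset.range n, (-1:ℤ)^i * ell Λ (T Λ (i+1) W Y) = 0 →
      ∀ i, Subsingleton (T Λ (i+1) W Y))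

/-- passing to the quotient by a regular element -/
lemma chi_quot {Λ Λ1 W Y : Type} [CommRing Λ] [IsNoetherianRing Λ] [CommRing Λ1] [Algebra Λ Λ1]
    (z : Λ) (hz : IsSMulRegular Λ z) (hsurj : Surjective (algebraMap Λ Λ1))
    (hker : RingHom.ker (algebraMap Λ Λ1) = Ideal.span {z})
    [AddCommGroup W] [Module Λ W] [Module.Finite Λ W] (hW : IsSMulRegular W z)
    [AddCommGroup Y] [Module Λ Y] [Module Λ1 Y] [IsScalarTower Λ Λ1 Y] (r : ℕ)
    (hFL : ∀ i, FL Λ (T Λ (i+1) W Y))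
    (V : Type) [AddCommGroup V] [Module Λ1 V] (e : V ≃ₗ[Λ1] Λ1 ⊗[Λ] W)
    (h : (∀ i, FL Λ1 (T Λ1 (i+1) V Y)) → ChiGood Λ1 V Y r) :
    ChiGood Λ W Y r := by
  have hA : Acyc Λ W Λ1 := Acyc_hyper z hz hsurj hker hW
  have e := fun n => T_base_change' (R := Λ) (Λ := Λ1) Y W hA V e n
  have h1 : ∀ i, ell Λ (T Λ (i+1) W Y) = ell Λ1 (T Λ1 (i+1) V Y) := by
    intro i
    obtain ⟨e, he⟩ := e i
    exact (FL_semilin (algebraMap Λ Λ1) hsurj e he).2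
  have h2 := h fun i => by
    obtain ⟨e, he⟩ := e i
    exact (FL_semilin (algebraMap Λ Λ1) hsurj e he).1.1 (hFL i)
  intro n hn
  simp only [h1]
  refine ⟨(h2 n hn).1, fun h0 i => ?_⟩
  obtain ⟨e, he⟩ := e i
  have := (h2 n hn).2 h0 i
  exact e.symm.toEquiv.subsingleton

lemma chi_gamma {Λ : Type} [CommRing Λ] [IsNoetherianRing Λ] [IsLocalRing Λ] (ts : List Λ)
    (hts : IsWeaklyRegular Λ ts) (hm : ∀ t ∈ ts, t ∈ maximalIdeal Λ) (hne : ts ≠ [])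
    {G W V : Type} [AddCommGroup G] [Module Λ G] [AddCommGroup W] [Module Λ W] [Module.Finite Λ W]
    [AddCommGroup V] [Module Λ V] {f : G →ₗ[Λ] W} {g : W →ₗ[Λ] V}
    (hf : Injective f) (hfg : Exact f g) (hg : Surjective g) (hG : FL Λ G)
    (hFL : ∀ i, FL Λ (T Λ (i+1) W (Λ ⧸ Ideal.ofList ts))) :
    (∀ i, FL Λ (T Λ (i+1) V (Λ ⧸ Ideal.ofList ts))) ∧
    (ChiGood Λ V (Λ ⧸ Ideal.ofList ts) ts.length → ChiGood Λ W (Λ ⧸ Ideal.ofList ts) ts.length)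
    := by
  obtain ⟨Y, hY⟩ : ∃ Y : ModuleCat.{0} Λ, Y = ModuleCat.of Λ (Λ ⧸ Ideal.ofList ts) := ⟨_, rfl⟩
  have r1 := (reg_ring (D := G) ts hts)
  have r2 := (reg_ring (D := W) ts hts).1
  have r3 := (reg_ring (D := V) ts hts).1
  have e0 : T Λ 0 G (Λ ⧸ Ideal.ofList ts) ≃ₗ[Λ] G ⊗[Λ] (Λ ⧸ Ideal.ofList ts) := T0e G _
  have hVFL : ∀ i, FL Λ (T Λ (i+1) V (Λ ⧸ Ideal.ofList ts)) := by
    intro i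
    obtain ⟨δ, h1, h2⟩ := T_les (Y := Λ ⧸ Ideal.ofList ts) hf hfg hg i
    exact FL_exact _ _ h1 (hFL i) ((r1.2.2 hG).1 i)
  refine ⟨hVFL, fun hV n hn => ?_⟩
  have hV := hV n hn
  obtain ⟨δ, d0, d1, d2, d3, d4, d5⟩ := T_les_num (Y := Λ ⧸ Ideal.ofList ts) hf hfg hg
  have k1 : ∀ i, ell Λ (T Λ (i+1) W (Λ ⧸ Ideal.ofList ts)) =
      ell Λ (T Λ (i+1) G (Λ ⧸ Ideal.ofList ts)) + ell Λ (T Λ (i+1) V (Λ ⧸ Ideal.ofList ts))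
        - (δ (i+1) + δ i) := by
    intro i
    have a1 := d1 (i+1) ((r1.2.2 hG).1 (i+1))
    have a2 := d2 (i+1) (hFL i)
    have a3 := d3 i (hVFL i)
    linarith
  have k2 : ∑ i ∈ Finset.range n, (-1:ℤ)^i * ell Λ (T Λ (i+1) G (Λ ⧸ Ideal.ofList ts)) =
      ell Λ (T Λ 0 G (Λ ⧸ Ideal.ofList ts)) := by
    have := (r1.2.2 hG).2 hne (n+1) (by omega)
    rw [Finset.sum_range_succ'] at this
    have h' : ∑ i ∈ Finset.range n, (-1:ℤ)^(i+1) * ell Λ (T Λ (i+1) G (Λ ⧸ Ideal.ofList ts)) =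
      - ∑ i ∈ Finset.range n, (-1:ℤ)^i * ell Λ (T Λ (i+1) G (Λ ⧸ Ideal.ofList ts)) := by
      rw [← Finset.sum_neg_distrib]
      exact Finset.sum_congr rfl fun i _ => by rw [pow_succ]; ring
    rw [h'] at this
    simp only [pow_zero, one_mul] at this
    linarith
  have k3 : δ n = 0 := by
    rcases Nat.eq_zero_or_pos n with h0 | h0
    · exfalso
      have := List.length_pos_iff.2 hne
      omega
    have hn' : Subsingleton (T Λ (n+1) V (Λ ⧸ Ideal.ofList ts)) := r3 _ (by omega)
    have a3 := d3 n (hVFL n)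
    rw [ell_sub] at a3
    have := rk_nonneg (Tmap g (n+1) (Λ ⧸ Ideal.ofList ts))
    have := d0 n
    linarith
  have k4 : ∑ i ∈ Finset.range n, (-1:ℤ)^i * ell Λ (T Λ (i+1) W (Λ ⧸ Ideal.ofList ts)) =
      ∑ i ∈ Finset.range n, (-1:ℤ)^i * ell Λ (T Λ (i+1) V (Λ ⧸ Ideal.ofList ts)) +
        rk (Tmap f 0 (Λ ⧸ Ideal.ofList ts)) := by
    have : ∑ i ∈ Finset.range n, (-1:ℤ)^i * ell Λ (T Λ (i+1) W (Λ ⧸ Ideal.ofList ts)) =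
      ∑ i ∈ Finset.range n, (-1:ℤ)^i * ell Λ (T Λ (i+1) G (Λ ⧸ Ideal.ofList ts)) +
      ∑ i ∈ Finset.range n, (-1:ℤ)^i * ell Λ (T Λ (i+1) V (Λ ⧸ Ideal.ofList ts)) -
      ∑ i ∈ Finset.range n, (-1:ℤ)^i * (δ (i+1) + δ i) := by
      rw [← Finset.sum_add_distrib, ← Finset.sum_sub_distrib]
      exact Finset.sum_congr rfl fun i _ => by rw [k1]; ring
    rw [this, k2, alt_telescope, k3, d1 0 ((r1.2.2 hG).1 0)]
    ring
  have k5 := rk_nonneg (Tmap f 0 (Λ ⧸ Ideal.ofList ts))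
  rw [k4]
  refine ⟨by linarith [hV.1], fun h0 => ?_⟩
  have k6 : ∀ i, Subsingleton (T Λ (i+1) V (Λ ⧸ Ideal.ofList ts)) :=
    hV.2 (by linarith [hV.1])
  have k7 : rk (Tmap f 0 (Λ ⧸ Ideal.ofList ts)) = 0 := by linarith [hV.1]
  have k8 : Tmap f 0 (Λ ⧸ Ideal.ofList ts) = 0 :=
    rk_eq_zero _ (FL_surj _ (LinearMap.surjective_rangeRestrict _) ((r1.2.2 hG).1 0)) k7
  obtain ⟨δ', h1, h2⟩ := T_les (Y := Λ ⧸ Ideal.ofList ts) hf hfg hg 0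
  have k9 : Subsingleton (T Λ 0 G (Λ ⧸ Ideal.ofList ts)) := by
    refine subsingleton_of_forall_eq 0 fun x => ?_
    obtain ⟨y, rfl⟩ := (h2 x).1 (by rw [k8]; rfl)
    have := k6 0
    rw [Subsingleton.elim y 0, map_zero]
  have k10 : Subsingleton G := by
    have k11 : Subsingleton (G ⊗[Λ] (Λ ⧸ Ideal.ofList ts)) := e0.symm.toEquiv.subsingleton
    have k12 : Subsingleton (G ⧸ (Ideal.ofList ts • ⊤ : Submodule Λ G)) :=
      (TensorProduct.tensorQuotEquivQuotSMul G (Ideal.ofList ts)).symm.toEquiv.subsingleton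
    have hfin : Module.Finite Λ G := Module.Finite.of_injective f hf
    rw [Submodule.Quotient.subsingleton_iff] at k12
    have := Submodule.eq_bot_of_le_smul_of_le_jacobson_bot (Ideal.ofList ts)
      (⊤ : Submodule Λ G) (IsNoetherian.noetherian _) k12.ge
      ((Ideal.span_le.2 fun x hx => hm x hx).trans (IsLocalRing.maximalIdeal_le_jacobson _))
    refine subsingleton_of_forall_eq 0 fun x => ?_
    have hx : x ∈ (⊤ : Submodule Λ G) := trivial
    rw [this] at hx
    exact hx
  intro i
  have e : W ≃ₗ[Λ] V := LinearEquiv.ofBijective g ⟨by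
    rw [injective_iff_map_eq_zero]
    intro w hw
    obtain ⟨x, rfl⟩ := (hfg w).1 hw
    rw [Subsingleton.elim x 0, map_zero], hg⟩
  exact sub_T_left e.symm _ (k6 i)

lemma chi_congr_right {Λ W Y Y' : Type} [CommRing Λ] [AddCommGroup W] [Module Λ W]
    [AddCommGroup Y] [Module Λ Y] [AddCommGroup Y'] [Module Λ Y'] (e : Y ≃ₗ[Λ] Y') (r : ℕ)
    (h : ChiGood Λ W Y r) : ChiGood Λ W Y' r := by
  have h1 : ∀ i, ell Λ (T Λ (i+1) W Y') = ell Λ (T Λ (i+1) W Y) := fun i =>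
    ell_congr (T_congr_right (R := Λ) W e.symm (i+1)).some
  intro n hn
  simp only [h1]
  refine ⟨(h n hn).1, fun h0 i => ?_⟩
  have := (h n hn).2 h0 i
  exact (T_congr_right (R := Λ) W e.symm (i+1)).some.toEquiv.subsingleton

/-- passing to the quotient, concrete -/
lemma chi_quot' {Λ : Type} [CommRing Λ] [IsNoetherianRing Λ] [IsLocalRing Λ] (z : Λ)
    (hzm : z ∈ maximalIdeal Λ)
    (l : List Λ) (hl : ∀ t ∈ l, t ∈ maximalIdeal Λ) (hreg : IsWeaklyRegular Λ (z :: l))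
    {W : Type} [AddCommGroup W] [Module Λ W] [Module.Finite Λ W] (hW : IsSMulRegular W z)
    (r : ℕ)
    (ih : ∀ (Λ1 : Type) [CommRing Λ1] [IsNoetherianRing Λ1] [IsLocalRing Λ1] (ts : List Λ1),
      ts.length = l.length → IsWeaklyRegular Λ1 ts → (∀ t ∈ ts, t ∈ maximalIdeal Λ1) →
      ∀ (W : Type) [AddCommGroup W] [Module Λ1 W] [Module.Finite Λ1 W],
      (∀ i, FL Λ1 (T Λ1 (i+1) W (Λ1 ⧸ Ideal.ofList ts))) →
      ChiGood Λ1 W (Λ1 ⧸ Ideal.ofList ts) r)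
    (hFL : ∀ i, FL Λ (T Λ (i+1) W (Λ ⧸ Ideal.ofList (z :: l)))) :
    ChiGood Λ W (Λ ⧸ Ideal.ofList (z :: l)) r := by
  let Λ1 := Λ ⧸ Ideal.span {z}
  have hsurj : Surjective (algebraMap Λ Λ1) := Ideal.Quotient.mk_surjective
  have : Nontrivial Λ1 := Ideal.Quotient.nontrivial_iff.2 (by
    intro h
    have := (Ideal.span_singleton_le_iff_mem _).2 hzm
    rw [h] at this
    exact (maximalIdeal.isMaximal Λ).ne_top (top_le_iff.1 this))
  have : IsLocalRing Λ1 := IsLocalRing.of_surjective' (algebraMap Λ Λ1) hsurj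
  let ts := l.map (algebraMap Λ Λ1)
  have h1 := (isWeaklyRegular_cons_iff' Λ z l).1 hreg
  obtain ⟨e1⟩ : Nonempty ((Λ ⧸ Ideal.ofList (z :: l)) ≃ₗ[Λ] (Λ1 ⧸ Ideal.ofList ts)) := by
    have : Ideal.ofList (z :: l) = Ideal.span {z} ⊔ Ideal.ofList l := Ideal.ofList_cons _ _
    rw [this]
    have e := (DoubleQuot.quotQuotEquivQuotSupₐ Λ (Ideal.span {z}) (Ideal.ofList l)).symm
    have : Ideal.ofList ts = (Ideal.ofList l).map (Ideal.Quotient.mkₐ Λ (Ideal.span {z})) := by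
      exact (Ideal.map_ofList (algebraMap Λ Λ1) l).symm
    rw [this]
    exact ⟨e.toLinearEquiv⟩
  have hts : IsWeaklyRegular Λ1 ts := by
    rw [isWeaklyRegular_map_algebraMap_iff]
    have h2 := (isWeaklyRegular_cons_iff Λ z l).1 hreg
    have e2 : QuotSMulTop z Λ ≃ₗ[Λ] Λ1 := Submodule.quotEquivOfEq _ _ (by
      ext x
      rw [Submodule.mem_smul_pointwise_iff_exists, Ideal.mem_span_singleton']
      constructor
      · rintro ⟨y, -, rfl⟩; exact ⟨y, by simp [mul_comm]⟩
      · rintro ⟨y, rfl⟩; exact ⟨y, trivial, by simp [mul_comm]⟩)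
    exact (e2.isWeaklyRegular_congr l).1 h2.2
  refine chi_congr_right e1.symm r ?_
  refine chi_quot (Λ1 := Λ1) z h1.1 hsurj Ideal.mk_ker hW r (fun i => ?_)
    (Λ1 ⊗[Λ] W) (LinearEquiv.refl _ _) fun hh => ?_
  · exact FL_congr (T_congr_right (R := Λ) W e1 (i+1)).some (hFL i)
  · refine ih Λ1 ts (by simp [ts]) hts ?_ (Λ1 ⊗[Λ] W) hh
    intro t ht
    obtain ⟨x, hx, rfl⟩ := List.mem_map.1 ht
    exact (mem_maximalIdeal _).2 fun hu => hl x hx (by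
      have := IsLocalHom.of_surjective (algebraMap Λ Λ1) hsurj
      exact isUnit_of_map_unit (algebraMap Λ Λ1) x hu)

theorem lemX (r : ℕ) : ∀ (Λ : Type) [CommRing Λ] [IsNoetherianRing Λ] [IsLocalRing Λ]
    (ts : List Λ), ts.length = r → IsWeaklyRegular Λ ts → (∀ t ∈ ts, t ∈ maximalIdeal Λ) →
    ∀ (W : Type) [AddCommGroup W] [Module Λ W] [Module.Finite Λ W],
    (∀ i, FL Λ (T Λ (i+1) W (Λ ⧸ Ideal.ofList ts))) →
    ChiGood Λ W (Λ ⧸ Ideal.ofList ts) r := by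
  induction r with
  | zero =>
    intro Λ _ _ _ ts hlen hts hm W _ _ _ hFL n hn
    have h := (reg_ring (D := W) ts hts).1
    have h' : ∀ i, Subsingleton (T Λ (i+1) W (Λ ⧸ Ideal.ofList ts)) :=
      fun i => h (i+1) (by omega)
    refine ⟨?_, fun _ => h'⟩
    rw [Finset.sum_eq_zero]
    intro i _
    rw [@ell_sub _ _ _ _ _ (h' i), mul_zero]
  | succ r ih =>
    intro Λ _ _ _ ts hlen hts hm W _ _ _ hFL
    obtain ⟨Γ, hΓ, hΓ2⟩ := exists_gamma (Λ := Λ) (W := W)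
    have hne : ts ≠ [] := by rintro rfl; simp at hlen
    have hle : Ideal.ofList ts ≤ maximalIdeal Λ := Ideal.span_le.2 fun x hx => hm x hx
    obtain ⟨V, g, hg, hfg, hV⟩ : ∃ (V : ModuleCat.{0} Λ) (g : W →ₗ[Λ] V), Surjective g ∧
        Exact Γ.subtype g ∧ maximalIdeal Λ ∉ associatedPrimes Λ V :=
      ⟨ModuleCat.of Λ (W ⧸ Γ), Γ.mkQ, Submodule.mkQ_surjective _,
        LinearMap.exact_subtype_mkQ Γ, hΓ2⟩
    have hVf : Module.Finite Λ V := Module.Finite.of_surjective g hg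
    obtain ⟨c1, c2⟩ := chi_gamma ts hts hm hne Γ.injective_subtype hfg hg hΓ hFL
    rw [← hlen]
    refine c2 ?_
    rw [hlen]
    obtain ⟨z, hz, hz2, hz3⟩ := exists_z (W := V) (Ideal.ofList ts) (by
      intro hbot
      obtain ⟨t, l, rfl⟩ := List.exists_cons_of_ne_nil hne
      have h0 : t = 0 := by
        rw [← Ideal.mem_bot, ← hbot]; exact Ideal.subset_span List.mem_cons_self
      have := ((isWeaklyRegular_cons_iff Λ t l).1 hts).1
      rw [h0] at this
      exact one_ne_zero (this (by simp : (0:Λ) • (1:Λ) = (0:Λ) • (0:Λ)))) (by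
      intro q hq hIq
      have := ass_bound ts hts q hq hIq (by rw [hlen]; exact c1 r)
      exact hV (this ▸ hq))
    obtain ⟨l, hl1, hl2, hl3, hl4⟩ := reg_swap ts hts hm z hz hz2
    rw [← hl4] at c1 ⊢
    have := chi_quot' z (hle hz) l hl2 hl3 hz3 r (fun Λ1 _ _ _ ts h => ih Λ1 ts (by omega)) c1
    exact fun n hn => this n (by omega)

end LemX

section FlatLem
open TensorProduct Function RingTheory.Sequence

lemma T_one_step {S V M C : Type} [CommRing S] [AddCommGroup V] [Module S V] [AddCommGroup M]
    [Module S M] [AddCommGroup C] [Module S C] (t : S) (h1 : IsSMulRegular M t)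
    {g : M →ₗ[S] C} (hg2 : Exact (LinearMap.lsmul S M t) g) (hg : Surjective g)
    (h3 : IsSMulRegular (M ⊗[S] V) t) (h : Subsingleton (T S 1 M V)) :
    Subsingleton (T S 1 C V) := by
  obtain ⟨δ, d1, d2⟩ := T_les (R := S) (Y := V) (f := LinearMap.lsmul S M t) h1 hg2 hg 0
  refine subsingleton_of_forall_eq 0 fun x => ?_
  have hx : δ x = 0 := by
    have h5 : Tmap (LinearMap.lsmul S M t) 0 V (δ x) = 0 := (d2 _).2 ⟨x, rfl⟩
    rw [Tmap_lsmul] at h5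
    have h6 := congrArg (T0e M V) h5
    rw [map_smul, map_zero] at h6
    have h7 : T0e M V (δ x) = 0 := h3 (by simpa using h6)
    exact (T0e M V).map_eq_zero_iff.1 h7
  obtain ⟨y, rfl⟩ := (d1 x).1 hx
  rw [Subsingleton.elim y 0, map_zero]

lemma T_one_reg {S V : Type} [CommRing S] [AddCommGroup V] [Module S V] (zs : List S) :
    ∀ (M : Type) [AddCommGroup M] [Module S M], IsWeaklyRegular M zs →
      IsWeaklyRegular (M ⊗[S] V) zs → Subsingleton (T S 1 M V) →
      Subsingleton (T S 1 (M ⧸ (Ideal.ofList zs • ⊤ : Submodule S M)) V) := by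
  induction zs with
  | nil =>
    intro M _ _ _ _ h
    have e : (M ⧸ (Ideal.ofList ([] : List S) • ⊤ : Submodule S M)) ≃ₗ[S] M :=
      Submodule.quotEquivOfEqBot _ (by rw [Ideal.ofList_nil]; exact Submodule.bot_smul _)
    exact sub_T_left e.symm 1 h
  | cons t ts ih =>
    intro M _ _ hreg hregV h
    obtain ⟨h1, h2⟩ := (isWeaklyRegular_cons_iff M t ts).1 hreg
    obtain ⟨h3, h4⟩ := (isWeaklyRegular_cons_iff (M ⊗[S] V) t ts).1 hregV
    have e : (M ⧸ (Ideal.ofList (t::ts) • ⊤ : Submodule S M)) ≃ₗ[S]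
        (QuotSMulTop t M ⧸ (Ideal.ofList ts • ⊤ : Submodule S (QuotSMulTop t M))) :=
      Submodule.quotOfListConsSMulTopEquivQuotSMulTopInner M t ts
    refine sub_T_left e.symm 1 (ih (QuotSMulTop t M) h2 ?_ ?_)
    · exact ((QuotSMulTop.quotSMulTopTensorEquivQuotSMulTop t V M).isWeaklyRegular_congr ts).2 h4
    · obtain ⟨g, hg, hg2⟩ := quot_ses (M := M) t
      exact T_one_step t h1 hg2 hg h3 h

lemma finite_tensor {S P V K : Type} [CommRing S] [CommRing P] [Algebra S P]
    [AddCommGroup V] [Module S V] [Module P V] [IsScalarTower S P V] [Module.Finite P V]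
    [AddCommGroup K] [Module S K] [Module.Finite S K] : Module.Finite P (V ⊗[S] K) := by
  obtain ⟨n, f, hf⟩ := Module.Finite.exists_fin' S K
  have : Module.Finite P (V ⊗[S] (Fin n → S)) :=
    Module.Finite.equiv (TensorProduct.piScalarRight S P V (Fin n)).symm
  exact Module.Finite.of_surjective (AlgebraTensorModule.lTensor P V f)
    (LinearMap.lTensor_surjective V hf)

lemma T_one_nak {S P V : Type} [CommRing S] [IsNoetherianRing S] [CommRing P] [IsNoetherianRing P]
    [IsLocalRing P] [Algebra S P]
    [AddCommGroup V] [Module S V] [Module P V] [IsScalarTower S P V] [Module.Finite P V]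
    (J : Ideal S) (x : S) (hx : algebraMap S P x ∈ maximalIdeal P)
    (h : ∀ w : T S 1 (S ⧸ J) V, ∃ w', w = x • w') : Subsingleton (T S 1 (S ⧸ J) V) := by
  obtain ⟨e1⟩ := T_comm (R := S) (S ⧸ J) V 1
  obtain ⟨e2⟩ := T_one_of_flat (R := S) (A := V) (Y := S ⧸ J) J.subtype J.mkQ
    J.injective_subtype (LinearMap.exact_subtype_mkQ J) J.mkQ_surjective
  let e := e1.trans e2
  have hfin : Module.Finite P (V ⊗[S] J) := finite_tensor
  let K := LinearMap.ker (AlgebraTensorModule.lTensor P V J.subtype)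
  have hK : K = ⊥ := by
    refine Submodule.eq_bot_of_le_smul_of_le_jacobson_bot (Ideal.span {algebraMap S P x})
      K (IsNoetherian.noetherian _) ?_ (le_trans ?_ (IsLocalRing.maximalIdeal_le_jacobson _))
    · intro y hy
      have hy' : y ∈ LinearMap.ker (J.subtype.lTensor V) := hy
      obtain ⟨w', hw'⟩ := h (e.symm ⟨y, hy'⟩)
      have h1 : (⟨y, hy'⟩ : LinearMap.ker (J.subtype.lTensor V)) = x • e w' := by
        rw [← map_smul, ← hw', LinearEquiv.apply_symm_apply]
      have h2 : y = x • (e w').1 := congrArg Subtype.val h1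
      rw [h2, ← algebraMap_smul P x (e w').1]
      exact Submodule.smul_mem_smul (Ideal.mem_span_singleton_self _) (e w').2
    · rw [Ideal.span_singleton_le_iff_mem]; exact hx
  have : Subsingleton (LinearMap.ker (J.subtype.lTensor V)) := by
    refine subsingleton_of_forall_eq 0 fun y => Subtype.ext ?_
    have : y.1 ∈ K := y.2
    rw [hK] at this
    exact this
  exact e.toEquiv.subsingleton

lemma flat_of_T_one {S V : Type} [CommRing S] [AddCommGroup V] [Module S V]
    (h : ∀ J : Ideal S, Subsingleton (T S 1 (S ⧸ J) V)) : Module.Flat S V := by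
  rw [Module.Flat.iff_lTensor_injective]
  intro J _
  obtain ⟨e1⟩ := T_comm (R := S) (S ⧸ J) V 1
  obtain ⟨e2⟩ := T_one_of_flat (R := S) (A := V) (Y := S ⧸ J) J.subtype J.mkQ
    J.injective_subtype (LinearMap.exact_subtype_mkQ J) J.mkQ_surjective
  have := h J
  have : Subsingleton (LinearMap.ker (J.subtype.lTensor V)) :=
    (e1.trans e2).symm.toEquiv.subsingleton
  rw [← LinearMap.ker_eq_bot]
  exact Submodule.subsingleton_iff_eq_bot.1 this

lemma sub_mid {S V A B C : Type} [CommRing S] [AddCommGroup V] [Module S V]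
    [AddCommGroup A] [Module S A] [AddCommGroup B] [Module S B] [AddCommGroup C] [Module S C]
    {f : A →ₗ[S] B} {g : B →ₗ[S] C} (hf : Injective f) (hfg : Exact f g) (hg : Surjective g)
    (n : ℕ) (hA : Subsingleton (T S n A V)) (hC : Subsingleton (T S n C V)) :
    Subsingleton (T S n B V) := by
  refine subsingleton_of_forall_eq 0 fun x => ?_
  obtain ⟨y, rfl⟩ := (T_exact (R := S) (Y := V) hf hfg hg n x).1 (Subsingleton.elim _ _)
  rw [Subsingleton.elim y 0, map_zero]

lemma ideal_ses {S : Type} [CommRing S] (J : Ideal S) (a : S) :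
    ∃ (g : (S ⧸ J) →ₗ[S] (S ⧸ (J ⊔ Ideal.span {a}))), Surjective g ∧
      Exact (LinearMap.lsmul S (S ⧸ J) a) g := by
  refine ⟨Submodule.factor le_sup_left, Submodule.factor_surjective _, ?_⟩
  intro y
  obtain ⟨y, rfl⟩ := Submodule.Quotient.mk_surjective _ y
  rw [show Submodule.factor (le_sup_left : J ≤ J ⊔ Ideal.span {a}) (Submodule.Quotient.mk y) =
    Submodule.Quotient.mk y from rfl, Submodule.Quotient.mk_eq_zero, Submodule.mem_sup]
  constructor
  · rintro ⟨u, hu, v, hv, rfl⟩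
    obtain ⟨b, rfl⟩ := Ideal.mem_span_singleton'.1 hv
    refine ⟨Submodule.Quotient.mk b, ?_⟩
    rw [LinearMap.lsmul_apply, ← Submodule.Quotient.mk_smul, Submodule.Quotient.eq]
    have : a • b - (u + b * a) = -u := by simp only [smul_eq_mul]; ring
    rw [this]; exact neg_mem hu
  · rintro ⟨w, hw⟩
    obtain ⟨b, rfl⟩ := Submodule.Quotient.mk_surjective _ w
    rw [LinearMap.lsmul_apply, ← Submodule.Quotient.mk_smul, Submodule.Quotient.eq] at hw
    refine ⟨y - a • b, by rw [← neg_sub]; exact neg_mem hw, b * a,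
      Ideal.mem_span_singleton'.2 ⟨b, rfl⟩, ?_⟩
    simp only [smul_eq_mul]; ring

theorem flat_lemma {S P V : Type} [CommRing S] [IsNoetherianRing S] [IsLocalRing S]
    [CommRing P] [IsNoetherianRing P]
    [IsLocalRing P] [Algebra S P] (hloc : ∀ x ∈ maximalIdeal S, algebraMap S P x ∈ maximalIdeal P)
    [AddCommGroup V] [Module S V] [Module P V] [IsScalarTower S P V] [Module.Finite P V]
    (zs : List S) (hzs : Ideal.ofList zs = maximalIdeal S) (hS : IsWeaklyRegular S zs)
    (hV : IsWeaklyRegular V zs) : Module.Flat S V := by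
  refine flat_of_T_one fun J => ?_
  have hwf : WellFounded ((· > ·) : Ideal S → Ideal S → Prop) :=
    (inferInstance : WellFoundedGT (Ideal S)).wf
  induction J using hwf.induction with
  | _ J ih =>
  by_cases htop : J = ⊤
  · have : Subsingleton (S ⧸ J) := by rw [htop]; infer_instance
    exact ⟨fun x y => Subtype.ext (Subsingleton.elim _ _)⟩
  by_cases hJ : J.IsPrime
  · by_cases hm : J = maximalIdeal S
    · have h1 := T_one_reg (V := V) zs S hS
        (((TensorProduct.lid S V).isWeaklyRegular_congr zs).2 hV) (T_flat 0)
      have e : (S ⧸ (Ideal.ofList zs • ⊤ : Submodule S S)) ≃ₗ[S] (S ⧸ J) :=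
        Submodule.quotEquivOfEq _ _ (by rw [hm, ← hzs]; simp)
      exact sub_T_left e 1 h1
    · obtain ⟨x, hx, hxJ⟩ : ∃ x ∈ maximalIdeal S, x ∉ J := by
        by_contra hcon
        push Not at hcon
        exact hm (le_antisymm (le_maximalIdeal htop) hcon)
      refine T_one_nak (P := P) J x (hloc x hx) fun w => ?_
      obtain ⟨g, hg, hg2⟩ := ideal_ses J x
      have hinj : Injective (LinearMap.lsmul S (S ⧸ J) x) := by
        rw [injective_iff_map_eq_zero]
        intro y hy
        obtain ⟨y, rfl⟩ := Submodule.Quotient.mk_surjective _ y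
        rw [LinearMap.lsmul_apply, ← Submodule.Quotient.mk_smul, Submodule.Quotient.mk_eq_zero]
          at hy
        rw [Submodule.Quotient.mk_eq_zero]
        exact (hJ.mem_or_mem hy).resolve_left hxJ
      have h1 : Subsingleton (T S 1 (S ⧸ (J ⊔ Ideal.span {x})) V) := ih _ (by
        refine lt_of_le_of_ne le_sup_left fun h => hxJ ?_
        rw [h]; exact Ideal.mem_sup_right (Ideal.mem_span_singleton_self x))
      obtain ⟨y, hy⟩ := (T_exact (R := S) (Y := V) hinj hg2 hg 1 w).1 (Subsingleton.elim _ _)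
      refine ⟨y, ?_⟩
      rw [← hy, Tmap_lsmul]
  · obtain ⟨a, b, hab, ha, hb⟩ : ∃ a b, a * b ∈ J ∧ a ∉ J ∧ b ∉ J := by
      by_contra hcon
      push Not at hcon
      refine hJ ⟨htop, fun {a b} hab => ?_⟩
      by_contra h
      push Not at h
      exact h.2 (hcon a b hab h.1)
    obtain ⟨g, hg, hg2⟩ := ideal_ses J a
    let J' : Ideal S := LinearMap.ker ((LinearMap.lsmul S (S ⧸ J) a).comp J.mkQ)
    let f : (S ⧸ J') →ₗ[S] (S ⧸ J) := J'.liftQ ((LinearMap.lsmul S (S ⧸ J) a).comp J.mkQ) le_rfl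
    have hmem : ∀ y, y ∈ J' ↔ a * y ∈ J := by
      intro y
      rw [LinearMap.mem_ker, LinearMap.comp_apply, LinearMap.lsmul_apply, ← map_smul,
        Submodule.mkQ_apply, Submodule.Quotient.mk_eq_zero, smul_eq_mul]
    have hf : Injective f := by
      rw [← LinearMap.ker_eq_bot]
      exact Submodule.ker_liftQ_eq_bot _ _ _ le_rfl
    have hfg : Exact f g := by
      intro y
      rw [show _ ↔ _ from hg2 y]
      constructor
      · rintro ⟨w, rfl⟩
        obtain ⟨w, rfl⟩ := Submodule.Quotient.mk_surjective _ w
        exact ⟨Submodule.Quotient.mk w, rfl⟩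
      · rintro ⟨w, rfl⟩
        obtain ⟨w, rfl⟩ := Submodule.Quotient.mk_surjective _ w
        exact ⟨Submodule.Quotient.mk w, rfl⟩
    refine sub_mid hf hfg hg 1 (ih _ ?_) (ih _ ?_)
    · refine lt_of_le_of_ne (fun y hy => (hmem y).2 (J.mul_mem_left _ hy)) fun h => hb ?_
      rw [h]; exact (hmem b).2 hab
    · refine lt_of_le_of_ne le_sup_left fun h => ha ?_
      rw [h]; exact Ideal.mem_sup_right (Ideal.mem_span_singleton_self a)

end FlatLem

section RegLoc
open Function RingTheory.Sequence Pointwise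

lemma dim_le_length {S : Type} [CommRing S] [IsNoetherianRing S] [IsLocalRing S] (zs : List S)
    (h : Ideal.ofList zs = maximalIdeal S) : ringKrullDim S ≤ (zs.length : ℕ) := by
  classical
  refine (ringKrullDim_le_spanFinrank_maximalIdeal S).trans ?_
  have h1 : (Ideal.ofList zs) = Submodule.span S (zs.toFinset : Set S) := by
    unfold Ideal.ofList; simp [Ideal.span]
  rw [← h, h1]
  have := Submodule.spanFinrank_span_le_ncard_of_finite (R := S) (s := (zs.toFinset : Set S))
    (Finset.finite_toSet _)
  rw [Set.ncard_coe_finset] at this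
  exact_mod_cast this.trans (List.toFinset_card_le zs)

lemma reg_quot_equiv {S : Type} [CommRing S] (t : S) :
    Nonempty (QuotSMulTop t S ≃ₗ[S] (S ⧸ Ideal.span {t})) := by
  refine ⟨Submodule.quotEquivOfEq _ _ ?_⟩
  ext x
  rw [Submodule.mem_smul_pointwise_iff_exists, Ideal.mem_span_singleton']
  constructor
  · rintro ⟨b, -, rfl⟩; exact ⟨b, by simp [mul_comm]⟩
  · rintro ⟨b, rfl⟩; exact ⟨b, trivial, by simp [mul_comm]⟩

lemma wreg_cons {S : Type} [CommRing S] (t : S) (l : List S) :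
    IsWeaklyRegular S (t :: l) ↔ IsSMulRegular S t ∧
      IsWeaklyRegular (S ⧸ Ideal.span {t}) (l.map (Ideal.Quotient.mk (Ideal.span {t}))) := by
  obtain ⟨e⟩ := reg_quot_equiv t
  rw [isWeaklyRegular_cons_iff, e.isWeaklyRegular_congr]
  have := isWeaklyRegular_map_algebraMap_iff (R := S) (S ⧸ Ideal.span {t}) (S ⧸ Ideal.span {t}) l
  rw [Ideal.Quotient.algebraMap_eq] at this
  rw [this]

lemma quot_gen {S : Type} [CommRing S] {t : S} [IsLocalRing S] [IsLocalRing (S ⧸ Ideal.span {t})] (l : List S)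
    (h : Ideal.ofList (t :: l) = maximalIdeal S) :
    Ideal.ofList (l.map (Ideal.Quotient.mk (Ideal.span {t}))) =
      maximalIdeal (S ⧸ Ideal.span {t}) := by
  have h1 : Ideal.map (Ideal.Quotient.mk (Ideal.span {t})) (Ideal.ofList (t :: l)) =
      Ideal.ofList (l.map (Ideal.Quotient.mk (Ideal.span {t}))) := by
    rw [Ideal.map_ofList, List.map_cons, Ideal.ofList_cons,
      Ideal.Quotient.eq_zero_iff_mem.2 (Ideal.mem_span_singleton_self t)]
    simp
  rw [← h1, h]
  have : IsLocalHom (Ideal.Quotient.mk (Ideal.span {t})) :=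
    IsLocalHom.of_surjective _ Ideal.Quotient.mk_surjective
  exact map_maximalIdeal_of_surjective _ Ideal.Quotient.mk_surjective

lemma swap_gen {S : Type} [CommRing S] [IsLocalRing S] (zs : List S)
    (h : Ideal.ofList zs = maximalIdeal S) (x : S) (hx : x ∈ maximalIdeal S)
    (hx2 : x ∉ maximalIdeal S ^ 2) : ∃ l : List S, l.length + 1 = zs.length ∧
      Ideal.ofList (x :: l) = maximalIdeal S := by
  obtain ⟨t, l, y, a, h1, h2, h3, rfl⟩ := (reg_swap_aux zs x (h ▸ hx)).resolve_left
    (by rw [h, ← pow_two]; exact hx2)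
  refine ⟨l, by simpa using h1.length_eq.symm, ?_⟩
  rw [← h, ofList_perm h1, Ideal.ofList_cons, Ideal.ofList_cons]
  apply le_antisymm
  · refine sup_le ?_ le_sup_right
    rw [Ideal.span_singleton_le_iff_mem]
    exact Ideal.add_mem _ ((le_sup_right : Ideal.ofList l ≤ _) h2)
      (Ideal.mul_mem_left _ _ ((le_sup_left : Ideal.span {t} ≤ _) (Ideal.mem_span_singleton_self t)))
  · refine sup_le ?_ le_sup_right
    rw [Ideal.span_singleton_le_iff_mem]
    obtain ⟨u, rfl⟩ := h3
    have : t = ↑u⁻¹ * ((y + u * t) - y) := by simp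
    have h4 : y + u * t ∈ Ideal.span {y + u * t} ⊔ Ideal.ofList l :=
      (le_sup_left : Ideal.span {y + u * t} ≤ _) (Ideal.mem_span_singleton_self _)
    have h5 : y ∈ Ideal.span {y + u * t} ⊔ Ideal.ofList l :=
      (le_sup_right : Ideal.ofList l ≤ _) h2
    have h6 := Ideal.mul_mem_left _ (↑u⁻¹ : S) (Ideal.sub_mem _ h4 h5)
    rwa [← this] at h6

theorem reg_dom (n : ℕ) : ∀ (S : Type) [CommRing S] [IsNoetherianRing S] [IsLocalRing S]
    (zs : List S), zs.length = n → Ideal.ofList zs = maximalIdeal S →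
    (n : WithBot ℕ∞) ≤ ringKrullDim S → IsDomain S ∧ IsWeaklyRegular S zs := by
  induction n with
  | zero =>
    intro S _ _ _ zs hz h hd
    rw [List.length_eq_zero_iff] at hz
    subst hz
    rw [Ideal.ofList_nil] at h
    refine ⟨?_, IsWeaklyRegular.nil S S⟩
    have := isField_iff_maximalIdeal_eq.2 h.symm
    exact this.isDomain
  | succ n ih =>
    intro S _ _ _ zs hz h hd
    -- the quotient step
    have key : ∀ (t : S) (l : List S), l.length = n → Ideal.ofList (t :: l) = maximalIdeal S →
        IsDomain (S ⧸ Ideal.span {t}) ∧ IsWeaklyRegular (S ⧸ Ideal.span {t})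
          (l.map (Ideal.Quotient.mk (Ideal.span {t}))) := by
      intro t l hl htl
      have ht : t ∈ maximalIdeal S := by
        rw [← htl]; exact Ideal.subset_span (by simp)
      have hne : Ideal.span {t} ≠ ⊤ := fun h' => (maximalIdeal.isMaximal S).ne_top
        (top_le_iff.1 (h' ▸ (Ideal.span_singleton_le_iff_mem _).2 ht))
      have : Nontrivial (S ⧸ Ideal.span {t}) := Ideal.Quotient.nontrivial_iff.2 hne
      have : IsLocalRing (S ⧸ Ideal.span {t}) :=
        IsLocalRing.of_surjective' _ Ideal.Quotient.mk_surjective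
      refine ih _ _ (by simpa using hl) (quot_gen l htl) ?_
      have h1 := ringKrullDim_le_ringKrullDim_quotient_add_card ({t} : Finset S)
        (by
          rw [Finset.coe_singleton, Set.singleton_subset_iff]
          rw [IsLocalRing.ringJacobson_eq_maximalIdeal]; exact ht)
      have h2 := hd.trans h1
      rw [Finset.coe_singleton, Finset.card_singleton] at h2
      push_cast at h2
      exact ENat.WithBot.add_le_add_one_right_iff.1 h2
    have hdimpos : ¬ ringKrullDim S ≤ (0 : ℕ) := by
      intro h'
      have := hd.trans h'
      have : n + 1 ≤ 0 := by exact_mod_cast this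
      omega
    have hdom : IsDomain S := by
      obtain ⟨x, hx, hx2, hxq⟩ : ∃ x ∈ maximalIdeal S, x ∉ maximalIdeal S ^ 2 ∧
          ∀ q ∈ minimalPrimes S, x ∉ q := by
        by_contra hcon
        push Not at hcon
        classical
        have hfin := minimalPrimes.finite_of_isNoetherianRing S
        have := (Ideal.subset_union_prime (s := insert (maximalIdeal S ^ 2) hfin.toFinset)
          (f := id) (maximalIdeal S ^ 2) (maximalIdeal S ^ 2) (by
            intro i hi h1 _
            rcases Finset.mem_insert.1 hi with h | h
            · exact absurd h h1
            · exact Ideal.IsMinimalPrime.isPrime (hfin.mem_toFinset.1 h)) (I := maximalIdeal S)).1 (by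
            intro x hx
            by_cases hx2 : x ∈ maximalIdeal S ^ 2
            · exact Set.mem_biUnion (x := maximalIdeal S ^ 2) (by simp) hx2
            · obtain ⟨q, hq, hxq⟩ := hcon x hx hx2
              exact Set.mem_biUnion (x := q) (by simp [hq]) hxq)
        obtain ⟨i, hi, hmi⟩ := this
        apply hdimpos
        rcases Finset.mem_insert.1 hi with rfl | hi
        · have hb : maximalIdeal S = ⊥ :=
            Submodule.eq_bot_of_le_smul_of_le_jacobson_bot (maximalIdeal S) _
              (IsNoetherian.noetherian _) (by simpa [pow_two] using hmi)
              (IsLocalRing.maximalIdeal_le_jacobson _)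
          have := dim_le_length ([] : List S) (by rw [hb, Ideal.ofList_nil])
          simpa using this
        · rw [← maximalIdeal_height_eq_ringKrullDim]
          have hq := hfin.mem_toFinset.1 hi
          have hqp : (id i : Ideal S).IsPrime := Ideal.IsMinimalPrime.isPrime hq
          have : maximalIdeal S = i := le_antisymm hmi (IsLocalRing.le_maximalIdeal hqp.ne_top)
          rw [this]
          have : i.height = 0 := by
            have : i.IsPrime := hqp
            exact Ideal.height_eq_zero_iff.2 hq
          rw [this]; rfl
      obtain ⟨l, hl, hxl⟩ := swap_gen zs h x hx hx2
      have hd1 := (key x l (by omega) hxl).1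
      have hpr : (Ideal.span {x}).IsPrime := (Ideal.Quotient.isDomain_iff_prime _).1 hd1
      obtain ⟨q, hq, hqx⟩ := Ideal.exists_minimalPrimes_le (I := (⊥ : Ideal S)) (J := Ideal.span {x})
        bot_le
      have hqp : q.IsPrime := Ideal.IsMinimalPrime.isPrime hq
      have hq0 : q = ⊥ := by
        refine Submodule.eq_bot_of_le_smul_of_le_jacobson_bot (maximalIdeal S) q
          (IsNoetherian.noetherian _) ?_ (IsLocalRing.maximalIdeal_le_jacobson _)
        intro y hy
        obtain ⟨a, rfl⟩ := Ideal.mem_span_singleton'.1 (hqx hy)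
        have : a ∈ q := (hqp.mem_or_mem hy).resolve_right (hxq q hq)
        rw [mul_comm]
        exact Submodule.smul_mem_smul hx this
      rw [hq0] at hqp
      have : NoZeroDivisors S := ⟨fun {a b} hab => by
        simpa using hqp.mem_or_mem (show a * b ∈ (⊥ : Ideal S) by simp [hab])⟩
      exact NoZeroDivisors.to_isDomain S
    refine ⟨hdom, ?_⟩
    match zs, hz with
    | t :: l, hz =>
      have hl : l.length = n := by simpa using hz
      rw [wreg_cons]
      refine ⟨?_, (key t l hl h).2⟩
      have ht : t ≠ 0 := by
        rintro rfl
        have h2 : Ideal.ofList l = maximalIdeal S := by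
          rw [← h, Ideal.ofList_cons]; simp
        have := hd.trans (dim_le_length l h2)
        have : n + 1 ≤ l.length := by exact_mod_cast this
        omega
      intro a b hab
      exact mul_left_cancel₀ ht hab

/-- A regular local ring: generators of the maximal ideal. -/
theorem reg_gens {S : Type} [CommRing S] [IsNoetherianRing S] [IsLocalRing S]
    (hS : ∃ s : Finset S, Ideal.span (s : Set S) = maximalIdeal S ∧
    (s.card : WithBot ℕ∞) = ringKrullDim S) :
    IsDomain S ∧ (∃ zs : List S, Ideal.ofList zs = maximalIdeal S ∧ IsWeaklyRegular S zs) ∧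
    ∀ x ∈ maximalIdeal S, x ∉ maximalIdeal S ^ 2 → ∃ zs : List S,
      Ideal.ofList (x :: zs) = maximalIdeal S ∧ IsWeaklyRegular S (x :: zs) := by
  obtain ⟨s, hs, hd⟩ := hS
  have h1 : Ideal.ofList s.toList = maximalIdeal S := by
    rw [← hs]; unfold Ideal.ofList; congr 1; ext; simp
  have h2 := reg_dom s.card S s.toList (by simp) h1 hd.le
  refine ⟨h2.1, ⟨_, h1, h2.2⟩, ?_⟩
  intro x hx hx2
  obtain ⟨l, hl, hxl⟩ := swap_gen s.toList h1 x hx hx2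
  exact ⟨l, hxl, (reg_dom s.card S (x :: l) (by simpa using hl) hxl hd.le).2⟩

end RegLoc

section Numeric
open Function

variable {K : Type} [CommRing K]

/-- a long exact sequence of change of rings type -/
structure LESData (A B : ℕ → Type) [∀ i, AddCommGroup (A i)] [∀ i, Module K (A i)]
    [∀ i, AddCommGroup (B i)] [∀ i, Module K (B i)] where
  al : ∀ m, A (m+2) →ₗ[K] A m
  be : ∀ m, A (m+1) →ₗ[K] B (m+2)
  ga : ∀ m, B (m+2) →ₗ[K] A (m+2)
  e1 : ∀ m, Exact (al (m+1)) (be m)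
  e2 : ∀ m, Exact (be m) (ga m)
  e3 : ∀ m, Exact (ga m) (al m)

variable {A B : ℕ → Type} [∀ i, AddCommGroup (A i)] [∀ i, Module K (A i)]
    [∀ i, AddCommGroup (B i)] [∀ i, Module K (B i)]

lemma LESData.fl (d : LESData (K := K) A B) (m : ℕ) (h1 : FL K (A (m+1))) (h2 : FL K (A (m+2))) : FL K (B (m+2)) :=
  FL_exact _ _ (d.e2 m) h1 h2

lemma LESData.len (d : LESData (K := K) A B) (m : ℕ) (h1 : FL K (A (m+1))) (h2 : FL K (A (m+2))) :
    ell K (B (m+2)) = (ell K (A (m+1)) - rk (d.al m)) + (ell K (A (m+2)) - rk (d.al (m+1))) := by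
  have a1 := ell_exact _ _ (d.e2 m) (d.fl m h1 h2)
  have a2 := ell_exact _ _ (d.e1 m) h1
  have a3 := ell_exact _ _ (d.e3 m) h2
  linarith

lemma LESData.down (d : LESData (K := K) A B) (m : ℕ) (h1 : Subsingleton (A (m+1))) (h2 : Subsingleton (A (m+2))) :
    Subsingleton (B (m+2)) := by
  refine subsingleton_of_forall_eq 0 fun y => ?_
  obtain ⟨x, rfl⟩ := (d.e2 m y).1 (Subsingleton.elim _ _)
  rw [Subsingleton.elim x 0, map_zero]

lemma LESData.inj (d : LESData (K := K) A B) (m : ℕ) (h : Subsingleton (B (m+2))) : Injective (d.al m) := by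
  rw [injective_iff_map_eq_zero]
  intro y hy
  obtain ⟨x, rfl⟩ := (d.e3 m y).1 hy
  rw [Subsingleton.elim x 0, map_zero]

lemma LESData.surj (d : LESData (K := K) A B) (m : ℕ) (h : Subsingleton (B (m+2))) : Surjective (d.al (m+1)) :=
  fun y => (d.e1 m y).1 (Subsingleton.elim _ _)

lemma bdd_alt (s : ℕ → ℤ) (C : ℤ) (h2 : ∀ i, s (i+2) = s i)
    (hb : ∀ n, |∑ i ∈ Finset.range n, (-1:ℤ)^i * s i| ≤ C) : s 1 = s 0 := by
  have key : ∀ n : ℕ, ∑ i ∈ Finset.range (2*n), (-1:ℤ)^i * s i = n * (s 0 - s 1) := by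
    have hs0 : ∀ n : ℕ, s (2*n) = s 0 := by
      intro n
      induction n with
      | zero => rfl
      | succ n ih => rw [← ih]; exact h2 _
    have hs1 : ∀ n : ℕ, s (2*n+1) = s 1 := by
      intro n
      induction n with
      | zero => rfl
      | succ n ih => rw [← ih]; exact h2 _
    intro n
    induction n with
    | zero => simp
    | succ n ih =>
      rw [show 2 * (n+1) = 2*n+1+1 by ring, Finset.sum_range_succ, Finset.sum_range_succ, ih, hs0, hs1]
      rw [pow_succ, pow_mul]
      push_cast
      simp
      ring
  by_contra hne
  have h1 := hb (2 * (C.toNat + 1))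
  rw [key, abs_mul] at h1
  have h3 : 1 ≤ |s 0 - s 1| := Int.one_le_abs (sub_ne_zero.2 (Ne.symm hne))
  have h4 : |((C.toNat + 1 : ℕ) : ℤ)| = (C.toNat : ℤ) + 1 := by push_cast; rw [abs_of_nonneg]; positivity
  rw [h4] at h1
  have h5 : C ≤ C.toNat := Int.self_le_toNat C
  nlinarith

lemma numeric (M : ℕ → ℕ → Type) [∀ j i, AddCommGroup (M j i)] [∀ j i, Module K (M j i)]
    (c t r : ℕ) (hc : 1 ≤ c) (d : ∀ j, j < c → LESData (K := K) (M (j+1)) (M j))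
    (hz : ∀ i, t + 1 ≤ i → i ≤ t + c → Subsingleton (M c i))
    (hF : ∀ j, j < c → ∀ i, t + c ≤ i + j → FL K (M (j+1) i))
    (hper : ∀ i, r ≤ i → ell K (M c (i+1)) = ell K (M c i))
    (hv : ∀ i, r ≤ i → Subsingleton (M 0 i))
    (hchi : (∀ i, FL K (M 0 (t + c + 1 + i))) → ∀ n, r ≤ n →
      0 ≤ ∑ i ∈ Finset.range n, (-1:ℤ)^i * ell K (M 0 (t + c + 1 + i)) ∧
      (∑ i ∈ Finset.range n, (-1:ℤ)^i * ell K (M 0 (t + c + 1 + i)) = 0 →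
        ∀ i, Subsingleton (M 0 (t + c + 1 + i)))) :
    ∀ j, j < c → ∀ i, t + c ≤ i + j → Subsingleton (M (j+1) i) := by
  -- vanishing windows
  have hwin : ∀ k, ∀ j, j + k + 1 = c → ∀ i, t + c ≤ i + j → i ≤ t + c → Subsingleton (M (j+1) i) := by
    intro k
    induction k with
    | zero =>
      intro j hj i h1 h2
      have : j + 1 = c := by omega
      rw [this]; exact hz i (by omega) h2
    | succ k ih =>
      intro j hj i h1 h2
      obtain ⟨m, rfl⟩ : ∃ m, i = m + 2 := ⟨i - 2, by omega⟩
      exact (d (j+1) (by omega)).down m (ih (j+1) (by omega) _ (by omega) (by omega))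
        (ih (j+1) (by omega) _ (by omega) (by omega))
  -- boundedness
  have hbdd : ∀ k, ∀ j, j + k + 1 = c → ∃ C : ℤ, ∃ r' : ℕ, ∀ i, r' ≤ i → ell K (M (j+1) i) ≤ C := by
    intro k
    induction k with
    | zero =>
      intro j hj
      have : j + 1 = c := by omega
      rw [this]
      refine ⟨ell K (M c r), r, fun i hi => ?_⟩
      induction i, hi using Nat.le_induction with
      | base => exact le_rfl
      | succ i hi ih => rw [hper i hi]; exact ih
    | succ k ih =>
      intro j hj
      obtain ⟨C, r', h⟩ := ih (j+1) (by omega)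
      refine ⟨2 * C, r' + t + c + 2, fun i hi => ?_⟩
      obtain ⟨m, rfl⟩ : ∃ m, i = m + 2 := ⟨i - 2, by omega⟩
      have h1 := h (m+1) (by omega)
      have h2 := h (m+2) (by omega)
      rw [(d (j+1) (by omega)).len m (hF (j+1) (by omega) _ (by omega)) (hF (j+1) (by omega) _ (by omega))]
      have := rk_nonneg ((d (j+1) (by omega)).al m)
      have := rk_nonneg ((d (j+1) (by omega)).al (m+1))
      linarith
  obtain ⟨a, ha⟩ : ∃ a, t + c = a + 1 := ⟨t + c - 1, by omega⟩
  have hF1 : ∀ i, a + 1 ≤ i → FL K (M 1 i) := fun i hi => hF 0 hc i (by omega)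
  have hF0 : ∀ i, FL K (M 0 (a + 2 + i)) := fun i => by
    rw [show a + 2 + i = (a + i) + 2 by ring]
    exact (d 0 hc).fl _ (hF1 _ (by omega)) (hF1 _ (by omega))
  let x : ℕ → ℤ := fun m => ell K (M 1 (m+1)) - rk ((d 0 hc).al m)
  have hlen : ∀ m, a ≤ m → ell K (M 0 (m+2)) = x m + x (m+1) := fun m hm =>
    (d 0 hc).len m (hF1 _ (by omega)) (hF1 _ (by omega))
  have hx0 : x a ≤ 0 := by
    have := hwin (c-1) 0 (by omega) (a+1) (by omega) (by omega)
    have h1 := ell_sub (R := K) (A := M 1 (a+1))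
    have := rk_nonneg ((d 0 hc).al a)
    change ell K (M 1 (a+1)) - rk ((d 0 hc).al a) ≤ 0
    linarith
  have hsum : ∀ n, ∑ i ∈ Finset.range n, (-1:ℤ)^i * ell K (M 0 (a + 2 + i)) =
      x a - (-1:ℤ)^n * x (a + n) := by
    intro n
    refine Eq.trans ?_ (alt_telescope (fun i => x (a + i)) n)
    refine Finset.sum_congr rfl fun i _ => ?_
    rw [show a + 2 + i = (a + i) + 2 by ring, hlen _ (by omega)]
    ring_nf
  -- large indices
  have hxl : ∀ m, r ≤ m → x m = ell K (M 1 (m+1)) - ell K (M 1 (m+2)) := by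
    intro m hm
    have := (d 0 hc).inj m (hv _ (by omega))
    change ell K (M 1 (m+1)) - rk ((d 0 hc).al m) = _
    rw [rk_inj _ this]
  have hper2 : ∀ m, r ≤ m → a ≤ m → ell K (M 1 (m+3)) = ell K (M 1 (m+1)) := by
    intro m hm hm2
    have h1 := hlen m hm2
    have := hv (m+2) (by omega)
    rw [ell_sub, hxl m hm, hxl (m+1) (by omega)] at h1
    linarith [h1]
  have hkap : ∃ m, r ≤ m ∧ x (a + m) = 0 := by
    rcases Nat.lt_or_ge 1 c with hc2 | hc2
    · -- codimension at least two
      obtain ⟨C, r', hC⟩ := hbdd (c-2) 1 (by omega)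
      have hF2 : ∀ i, a ≤ i → FL K (M 2 i) := fun i hi => hF 1 hc2 i (by omega)
      let y : ℕ → ℤ := fun m => ell K (M 2 (m+1)) - rk ((d 1 hc2).al m)
      have hlen2 : ∀ m, a ≤ m → ell K (M 1 (m+2)) = y m + y (m+1) := fun m hm =>
        (d 1 hc2).len m (hF2 _ (by omega)) (hF2 _ (by omega))
      have hy : ∀ m, r' ≤ m → a ≤ m → |y m| ≤ C := by
        intro m hm hm2
        have h1 := hC (m+1) (by omega)
        have h2 := hC (m+2) (by omega)
        have h3 := rk_nonneg ((d 1 hc2).al m)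
        have h4 := rk_le_dom ((d 1 hc2).al m) (hF2 _ (by omega))
        have h5 := ell_nonneg (R := K) (A := M 2 (m+1))
        change |ell K (M 2 (m+1)) - rk ((d 1 hc2).al m)| ≤ C
        rw [abs_le]; constructor <;> linarith
      let b := r + r' + a
      have := bdd_alt (fun i => ell K (M 1 (b + i + 2))) (2 * C) (fun i => hper2 (b+i+1) (by omega) (by omega)) (by
        intro n
        have e : ∑ i ∈ Finset.range n, (-1:ℤ)^i * ell K (M 1 (b + i + 2)) =
            y b - (-1:ℤ)^n * y (b + n) := by
          refine Eq.trans ?_ (alt_telescope (fun i => y (b + i)) n)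
          refine Finset.sum_congr rfl fun i _ => ?_
          rw [hlen2 _ (by omega)]
          ring_nf
        rw [e]
        refine (abs_sub _ _).trans ?_
        rw [abs_mul, abs_pow, abs_neg, abs_one, one_pow, one_mul]
        have h1 := hy b (by omega) (by omega)
        have h2 := hy (b+n) (by omega) (by omega)
        linarith)
      refine ⟨r + r' + 1, by omega, ?_⟩
      rw [hxl _ (by omega)]
      have e1 : a + (r + r' + 1) + 1 = b + 0 + 2 := by omega
      have e2 : a + (r + r' + 1) + 2 = b + 1 + 2 := by omega
      rw [e1, e2]
      change ell K (M 1 (b + 1 + 2)) = ell K (M 1 (b + 0 + 2)) at this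
      rw [this, sub_self]
    · have : c = 1 := by omega
      subst this
      refine ⟨r, le_rfl, ?_⟩
      rw [hxl _ (by omega), ← hper (a + r + 1) (by omega), sub_self]
  obtain ⟨m, hm, hxm⟩ := hkap
  have hcc := hchi (fun i => by rw [ha]; exact hF0 i) m hm
  rw [ha] at hcc
  have hs := hsum m
  rw [hxm, mul_zero, sub_zero] at hs
  have hc0 := hcc.1
  simp only [show a + 1 + 1 = a + 2 from rfl] at hcc hc0
  rw [hs] at hcc hc0
  have hxa : x a = 0 := le_antisymm hx0 hc0
  have hM0' := hcc.2 hxa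
  have hM0 : ∀ i, a ≤ i → Subsingleton (M 0 (i + 2)) := fun i hi => by
    have := hM0' (i - a)
    rwa [show a + 2 + (i - a) = i + 2 by omega] at this
  intro j
  induction j with
  | zero =>
    intro _ 
    have h1 : Subsingleton (M 1 (a+1)) := hwin (c-1) 0 (by omega) (a+1) (by omega) (by omega)
    have h2 : Subsingleton (M 1 (a+2)) := by
      refine ell_eq_zero (hF1 _ (by omega)) ?_
      rw [← rk_inj _ ((d 0 hc).inj a (hM0 a le_rfl))]
      change ell K (M 1 (a+1)) - rk ((d 0 hc).al a) = 0 at hxa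
      rw [ell_sub] at hxa
      linarith
    have h3 : ∀ n, Subsingleton (M 1 (a + 1 + n)) ∧ Subsingleton (M 1 (a + 2 + n)) := by
      intro n
      induction n with
      | zero => exact ⟨h1, h2⟩
      | succ n ih =>
        have e : a + 1 + (n+1) = a + 2 + n := by omega
        refine ⟨by rw [e]; exact ih.2, ?_⟩
        have i1 := ih.1
        rw [show a + 2 + (n + 1) = (a + 1 + n) + 2 by omega]
        exact ((d 0 hc).inj (a + 1 + n) (hM0 _ (by omega))).subsingleton
    intro i hi
    have := (h3 (i - (a+1))).1
    rwa [show a + 1 + (i - (a+1)) = i by omega] at this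
  | succ j ih =>
    intro hj
    have ih' := ih (by omega)
    have hw := hwin (c - j - 2) (j+1) (by omega)
    have h3 : ∀ n, Subsingleton (M (j+1+1) (t + c - (j+1) + n)) ∧
        Subsingleton (M (j+1+1) (t + c - (j+1) + n + 1)) := by
      intro n
      induction n with
      | zero => exact ⟨hw _ (by omega) (by omega), hw _ (by omega) (by omega)⟩
      | succ n ihn =>
        refine ⟨ihn.2, ?_⟩
        have i1 := ihn.1
        exact ((d (j+1) hj).inj (t + c - (j+1) + n) (ih' _ (by omega))).subsingleton
    intro i hi
    have := (h3 (i - (t + c - (j+1)))).1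
    rwa [show t + c - (j+1) + (i - (t + c - (j+1))) = i by omega] at this

end Numeric

section Chain
open Function TensorProduct RingTheory.Sequence

lemma LESData.congr {K : Type} [CommRing K] {A B A' : ℕ → Type} [∀ i, AddCommGroup (A i)]
    [∀ i, Module K (A i)] [∀ i, AddCommGroup (B i)] [∀ i, Module K (B i)]
    [∀ i, AddCommGroup (A' i)] [∀ i, Module K (A' i)] (e : ∀ i, A' i ≃ₗ[K] A i)
    (d : LESData (K := K) A B) : Nonempty (LESData (K := K) A' B) := by
  refine ⟨⟨fun m => (e m).symm.toLinearMap ∘ₗ d.al m ∘ₗ (e (m+2)).toLinearMap,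
    fun m => d.be m ∘ₗ (e (m+1)).toLinearMap, fun m => (e (m+2)).symm.toLinearMap ∘ₗ d.ga m,
    ?_, ?_, ?_⟩⟩
  · intro m y
    simp only [LinearMap.comp_apply, LinearEquiv.coe_coe]
    rw [show _ ↔ _ from d.e1 m (e (m+1) y)]
    constructor
    · rintro ⟨z, hz⟩
      exact ⟨(e (m+3)).symm z, by simp [hz]⟩
    · rintro ⟨z, hz⟩
      exact ⟨e (m+3) z, by rw [← hz]; simp⟩
  · intro m y
    simp only [LinearMap.comp_apply, LinearEquiv.coe_coe]
    rw [LinearEquiv.map_eq_zero_iff, show _ ↔ _ from d.e2 m y]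
    constructor
    · rintro ⟨z, hz⟩
      exact ⟨(e (m+1)).symm z, by simp [hz]⟩
    · rintro ⟨z, hz⟩
      exact ⟨e (m+1) z, by rw [← hz]; simp⟩
  · intro m y
    simp only [LinearMap.comp_apply, LinearEquiv.coe_coe]
    rw [LinearEquiv.map_eq_zero_iff, show _ ↔ _ from d.e3 m _]
    constructor
    · rintro ⟨z, hz⟩
      exact ⟨z, by simp [hz]⟩
    · rintro ⟨z, hz⟩
      exact ⟨z, by rw [← hz]; simp⟩

/-- change of rings, restricted to a base ring -/
lemma les_S {S R' R : Type} [CommRing S] [CommRing R'] [IsNoetherianRing R'] [CommRing R]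
    [Algebra R' R] [Algebra S R'] [Algebra S R] [IsScalarTower S R' R]
    (f : R') (hf : IsSMulRegular R' f) (hsurj : Surjective (algebraMap R' R))
    (hker : RingHom.ker (algebraMap R' R) = Ideal.span {f})
    (N X : Type) [AddCommGroup N] [Module R N] [Module R' N] [IsScalarTower R' R N]
    [Module.Finite R' N] [AddCommGroup X] [Module R X] [Module R' X] [IsScalarTower R' R X]
    [Module S N] [IsScalarTower S R' N] [IsScalarTower S R N] :
    Nonempty (LESData (K := S) (fun i => T R i N X) (fun i => T R' i N X)) := by
  obtain ⟨α, β, γ, h1, h2, h3⟩ := les_change f hf hsurj hker N X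
  exact ⟨⟨fun m => (α m).restrictScalars S, fun m => (β m).restrictScalars S,
    fun m => (γ m).restrictScalars S, h1, h2, h3⟩⟩

lemma T_bij {S A R : Type} [CommRing S] [CommRing A] [IsNoetherianRing A] [CommRing R]
    [Algebra A R] [Algebra S A] [Algebra S R] [IsScalarTower S A R]
    (hb : Bijective (algebraMap A R))
    (N X : Type) [AddCommGroup N] [Module R N] [Module A N] [IsScalarTower A R N]
    [Module.Finite A N] [AddCommGroup X] [Module R X] [Module A X] [IsScalarTower A R X]
    [Module S N] [IsScalarTower S A N] [IsScalarTower S R N] (n : ℕ) :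
    Nonempty (T A (n+1) N X ≃ₗ[S] T R (n+1) N X) := by
  have hflat : Module.Flat A R := Module.Flat.of_linearEquiv
    (LinearEquiv.ofBijective (Algebra.linearMap A R) hb).symm
  have e : R ⊗[A] N ≃ₗ[R] N := by
    refine LinearEquiv.ofBijective (LinearMap.liftBaseChange R (LinearMap.id : N →ₗ[A] N)) ⟨?_, ?_⟩
    · have : Injective (LinearMap.liftBaseChange R (LinearMap.id : N →ₗ[A] N) ∘
          (TensorProduct.mk A R N 1)) := by
        intro x y h; simpa using h
      exact (Injective.of_comp_iff' _ ⟨by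
        have := this.of_comp
        exact this, TensorProduct.mk_surjective A N R hb.2⟩).1 this
    · intro x; exact ⟨1 ⊗ₜ x, by simp⟩
  obtain ⟨e1, he1⟩ := T_base_change' (R := A) (Λ := R) X N (fun i => Acyc_flat_right i) N e.symm n
  refine ⟨LinearEquiv.symm ⟨⟨⟨e1, map_add e1⟩, fun s x => ?_⟩, e1.symm, e1.left_inv, e1.right_inv⟩⟩
  change e1 (s • x) = s • e1 x
  rw [← algebraMap_smul A s (e1 x), ← he1, ← algebraMap_smul R s x,
    IsScalarTower.algebraMap_apply S A R]

theorem chain {S R : Type} [CommRing S] [CommRing R] [Algebra S R]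
    (N X : Type) [AddCommGroup N] [Module R N] [Module S N] [IsScalarTower S R N]
    [Module.Finite S N] [AddCommGroup X] [Module R X] [Module S X] [IsScalarTower S R X]
    [Module.Finite S X] (n : ℕ) :
    ∀ (A : Type) [CommRing A] [IsNoetherianRing A] [Algebra S A] [Algebra A R] [IsScalarTower S A R]
    [Module A N] [IsScalarTower S A N] [IsScalarTower A R N] [Module A X] [IsScalarTower S A X]
    [IsScalarTower A R X]
    (xs : List A), xs.length = n → Surjective (algebraMap S A) → Surjective (algebraMap A R) →
    RingHom.ker (algebraMap A R) = Ideal.ofList xs → IsWeaklyRegular A xs →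
    ∃ M : ℕ → ℕ → ModuleCat.{0} S, (∀ i, Nonempty (M 0 i ≃ₗ[S] T A i N X)) ∧
      (∀ i, Nonempty (M n (i+1) ≃ₗ[S] T R (i+1) N X)) ∧ (∀ j i, Module.Finite S (M j i)) ∧
      ∀ j, j < n → Nonempty (LESData (K := S) (fun i => M (j+1) i) (fun i => M j i)) := by
  have hfin : ∀ (A : Type) [CommRing A] [IsNoetherianRing A] [Algebra S A]
    [Module A N] [IsScalarTower S A N]  [Module A X] [IsScalarTower S A X],
    Surjective (algebraMap S A) → ∀ i, Module.Finite S (T A i N X) := by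
    intro A _ _ _ _ _ _ _ hs i
    have : Module.Finite A N := Module.Finite.of_restrictScalars_finite S A N
    have : Module.Finite A X := Module.Finite.of_restrictScalars_finite S A X
    have : Module.Finite S A := Module.Finite.of_surjective (Algebra.linearMap S A) hs
    have := T_finite (R := A) X i N
    exact Module.Finite.trans A _
  induction n with
  | zero =>
    intro A _ _ _ _ _ _ _ _ _ _ _ xs hxs hsA hAR hker hreg
    rw [List.length_eq_zero_iff] at hxs
    subst hxs
    rw [Ideal.ofList_nil] at hker
    have hb : Bijective (algebraMap A R) := ⟨(RingHom.injective_iff_ker_eq_bot _).2 hker, hAR⟩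
    have : Module.Finite A N := Module.Finite.of_restrictScalars_finite S A N
    refine ⟨fun _ i => ModuleCat.of S (T A i N X), fun i => ⟨LinearEquiv.refl _ _⟩,
      fun i => T_bij hb N X i, fun _ i => hfin A hsA i, fun j hj => absurd hj (by omega)⟩
  | succ n ih =>
    intro A _ _ _ _ _ _ _ _ _ _ _ xs hxs hsA hAR hker hreg
    match xs, hxs with
    | x :: l, hxs =>
    have hl : l.length = n := by simpa using hxs
    have hx0 : ∀ a ∈ Ideal.span {x}, algebraMap A R a = 0 := by
      intro a ha
      rw [← RingHom.mem_ker, hker, Ideal.ofList_cons]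
      exact (le_sup_left : Ideal.span {x} ≤ _) ha
    rw [wreg_cons] at hreg
    let g : (A ⧸ Ideal.span {x}) →+* R := Ideal.Quotient.lift _ (algebraMap A R) hx0
    have hg : ∀ a, g (Ideal.Quotient.mk _ a) = algebraMap A R a := fun a => rfl
    obtain ⟨A1, i1, i2, i3, i4, l1, hl1, hsurj1, hker1, f, hf, hlf, hr1⟩ :
      ∃ (A1 : Type) (_ : CommRing A1) (_ : IsNoetherianRing A1) (_ : Algebra A A1) (_ : Algebra S A1) (l1 : List A1),
        l1.length = n ∧ Surjective (algebraMap A A1) ∧ RingHom.ker (algebraMap A A1) = Ideal.span {x} ∧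
        ∃ f : A1 →+* R, (∀ a, f (algebraMap A A1 a) = algebraMap A R a) ∧
          (∀ s, algebraMap S A1 s = algebraMap A A1 (algebraMap S A s)) ∧
          l1 = l.map (algebraMap A A1) ∧ IsWeaklyRegular A1 l1 :=
      ⟨A ⧸ Ideal.span {x}, inferInstance, inferInstance, inferInstance, inferInstance,
        l.map (Ideal.Quotient.mk (Ideal.span {x})), by simpa using hl, Ideal.Quotient.mk_surjective,
        Ideal.mk_ker, g, hg, fun s => rfl, rfl, hreg.2⟩
    let _ : Algebra A1 R := f.toAlgebra
    let _ : Module A1 N := Module.compHom N f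
    let _ : Module A1 X := Module.compHom X f
    have hAA : ∀ a, algebraMap A1 R (algebraMap A A1 a) = algebraMap A R a := hf
    have : IsScalarTower A A1 R := IsScalarTower.of_algebraMap_eq fun a => (hf a).symm
    have : IsScalarTower S A A1 := IsScalarTower.of_algebraMap_eq hlf
    have t1 : IsScalarTower S A1 R := IsScalarTower.of_algebraMap_eq fun s => by
      rw [hlf, hAA, ← IsScalarTower.algebraMap_apply]
    have t2 : IsScalarTower A1 R N := IsScalarTower.of_algebraMap_smul fun a y => rfl
    have t3 : IsScalarTower A1 R X := IsScalarTower.of_algebraMap_smul fun a y => rfl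
    have t4 : IsScalarTower A A1 N := IsScalarTower.of_algebraMap_smul fun a y => by
      rw [← algebraMap_smul R (algebraMap A A1 a) y, hAA, algebraMap_smul]
    have t5 : IsScalarTower A A1 X := IsScalarTower.of_algebraMap_smul fun a y => by
      rw [← algebraMap_smul R (algebraMap A A1 a) y, hAA, algebraMap_smul]
    have t6 : IsScalarTower S A1 N := IsScalarTower.of_algebraMap_smul fun a y => by
      rw [hlf, algebraMap_smul, algebraMap_smul]
    have t7 : IsScalarTower S A1 X := IsScalarTower.of_algebraMap_smul fun a y => by
      rw [hlf, algebraMap_smul, algebraMap_smul]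
    have hkk : RingHom.ker (algebraMap A1 R) = Ideal.ofList l1 := by
      have h1 : Ideal.map (algebraMap A A1) (Ideal.ofList (x :: l)) = Ideal.ofList l1 := by
        have hx1 : algebraMap A A1 x = 0 := by
          rw [← RingHom.mem_ker, hker1]; exact Ideal.mem_span_singleton_self x
        rw [Ideal.map_ofList, List.map_cons, Ideal.ofList_cons, hx1, hr1.1]
        simp
      rw [← h1, ← hker]
      ext y
      obtain ⟨a, rfl⟩ := hsurj1 y
      constructor
      · intro hy
        exact Ideal.mem_map_of_mem _ (by rw [RingHom.mem_ker] at hy ⊢; rw [← hy, hAA])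
      · intro hy
        have : Ideal.map (algebraMap A A1) (RingHom.ker (algebraMap A R)) ≤
            RingHom.ker (algebraMap A1 R) := by
          rw [Ideal.map_le_iff_le_comap]
          intro b hb
          rw [Ideal.mem_comap, RingHom.mem_ker, hAA]; exact hb
        exact this hy
    obtain ⟨M', h1, h2, h3, h4⟩ := ih A1 l1 hl1
      (fun y => by
        obtain ⟨a, rfl⟩ := hsurj1 y
        obtain ⟨s, rfl⟩ := hsA a
        exact ⟨s, hlf s⟩)
      (fun y => by
        obtain ⟨a, rfl⟩ := hAR y
        exact ⟨algebraMap A A1 a, hAA a⟩) hkk hr1.2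
    have : Module.Finite A N := Module.Finite.of_restrictScalars_finite S A N
    refine ⟨fun j => Nat.casesOn j (fun i => ModuleCat.of S (T A i N X)) M',
      fun i => ⟨LinearEquiv.refl _ _⟩, h2, fun j i => ?_, fun j hj => ?_⟩
    · cases j with
      | zero => exact hfin A hsA i
      | succ j => exact h3 j i
    · cases j with
      | zero =>
        obtain ⟨d⟩ := les_S (S := S) x hreg.1 hsurj1 hker1 N X
        exact LESData.congr (A' := fun i => M' 0 i) (fun i => (h1 i).some) d
      | succ j => exact h4 j (by omega)
end Chain

section Step8
open Function TensorProduct RingTheory.Sequence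

lemma FL_of_primes {K V : Type} [CommRing K] [IsNoetherianRing K] [IsLocalRing K] [AddCommGroup V]
    [Module K V] [Module.Finite K V]
    (h : ∀ p : Ideal K, p.IsPrime → Module.annihilator K V ≤ p → p = maximalIdeal K) : FL K V := by
  have h1 : Ring.KrullDimLE 0 (K ⧸ Module.annihilator K V) := by
    refine Ring.krullDimLE_zero_iff.2 fun P hP => ?_
    have h2 := h (P.comap (Ideal.Quotient.mk _)) (hP.comap _) (fun x hx => by
      rw [Ideal.mem_comap, Ideal.Quotient.eq_zero_iff_mem.2 hx]; exact zero_mem _)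
    have h3 : (P.comap (Ideal.Quotient.mk (Module.annihilator K V))).IsMaximal := by
      rw [h2]; infer_instance
    have := Ideal.map_eq_top_or_isMaximal_of_surjective _ (Ideal.Quotient.mk_surjective (I := Module.annihilator K V)) h3
    rw [Ideal.map_comap_of_surjective _ Ideal.Quotient.mk_surjective] at this
    exact this.resolve_left hP.ne_top
  have h2 : IsArtinianRing (K ⧸ Module.annihilator K V) :=
    IsNoetherianRing.isArtinianRing_of_krullDimLE_zero
  let _ : Module (K ⧸ Module.annihilator K V) V := Module.quotientAnnihilator
  have _ : IsScalarTower K (K ⧸ Module.annihilator K V) V :=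
    IsScalarTower.of_algebraMap_smul fun r x => rfl
  have h3 : Module.Finite (K ⧸ Module.annihilator K V) V :=
    Module.Finite.of_restrictScalars_finite K (K ⧸ Module.annihilator K V) V
  have h4 : Module.length (K ⧸ Module.annihilator K V) V ≠ ⊤ := Module.length_ne_top
  have h5 := Module.length_eq_of_surjective (S := K) (R := (K ⧸ Module.annihilator K V)) (M := V)
    Ideal.Quotient.mk_surjective
  unfold FL
  first
  | rwa [h5]
  | rwa [← h5]

/-- localised base change -/
lemma nontriv_iff {S D : Type} [CommRing S] [CommRing D] [Algebra S D]
    (q : Ideal D) [q.IsPrime] (M : Type) [AddCommGroup M] [Module S M] [Module.Finite S M] :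
    Nontrivial (Localization.AtPrime q ⊗[S] M) ↔ Module.annihilator D (D ⊗[S] M) ≤ q := by
  have e1 := LocalizedModule.equivTensorProduct q.primeCompl (D ⊗[S] M)
  have e2 : Localization.AtPrime q ⊗[D] (D ⊗[S] M) ≃ₗ[Localization.AtPrime q]
      Localization.AtPrime q ⊗[S] M :=
    TensorProduct.AlgebraTensorModule.cancelBaseChange S D (Localization.AtPrime q) (Localization.AtPrime q) M
  have h := Module.mem_support_iff_of_finite (R := D) (M := D ⊗[S] M) (p := ⟨q, inferInstance⟩)
  rw [Module.mem_support_iff] at h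
  rw [← h]
  exact ⟨fun _ => (e1.trans e2).toEquiv.nontrivial, fun _ => (e1.trans e2).symm.toEquiv.nontrivial⟩

lemma FL_min {S D : Type} [CommRing S] [CommRing D] [IsNoetherianRing D] [Algebra S D]
    (q : Ideal D) [q.IsPrime] (M : Type) [AddCommGroup M] [Module S M] [Module.Finite S M]
    (h : ∀ q' : Ideal D, q'.IsPrime → Module.annihilator D (D ⊗[S] M) ≤ q' → q' ≤ q → q' = q) :
    FL (Localization.AtPrime q) (Localization.AtPrime q ⊗[S] M) := by
  have : IsNoetherianRing (Localization.AtPrime q) :=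
    IsLocalization.isNoetherianRing q.primeCompl _ inferInstance
  have e2 : Localization.AtPrime q ⊗[D] (D ⊗[S] M) ≃ₗ[Localization.AtPrime q]
      Localization.AtPrime q ⊗[S] M :=
    TensorProduct.AlgebraTensorModule.cancelBaseChange S D (Localization.AtPrime q) (Localization.AtPrime q) M
  refine FL_of_primes fun p hp hap => ?_
  have hm : (maximalIdeal (Localization.AtPrime q)).comap (algebraMap D (Localization.AtPrime q)) = q :=
    Localization.AtPrime.under_maximalIdeal
  have h1 : p ≤ maximalIdeal _ := IsLocalRing.le_maximalIdeal hp.ne_top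
  have h2 := h (p.comap (algebraMap D (Localization.AtPrime q))) (hp.comap _) (fun x hx => by
    rw [Ideal.mem_comap]
    apply hap
    rw [Module.mem_annihilator] at hx ⊢
    intro y
    obtain ⟨y, rfl⟩ := e2.surjective y
    rw [← map_smul]
    rw [show algebraMap D (Localization.AtPrime q) x • y = 0 from ?_, map_zero]
    rw [algebraMap_smul]
    induction y with
    | zero => simp
    | add a b ha hb => rw [smul_add, ha, hb, add_zero]
    | tmul a b => rw [← TensorProduct.tmul_smul, hx, TensorProduct.tmul_zero])
    (by conv_rhs => rw [← hm]
        exact Ideal.comap_mono h1)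
  refine le_antisymm h1 ?_
  rw [← Localization.AtPrime.map_eq_maximalIdeal, Ideal.map_le_iff_le_comap, h2]

/-- the nonnegativity and rigidity property of partial Euler characteristics after base change -/
def DiagGood (S D : Type) [CommRing S] [CommRing D] [Algebra S D] : Prop :=
  ∀ (q : Ideal D) [q.IsPrime] (N X : Type) [AddCommGroup N] [Module S N] [Module.Finite S N]
    [AddCommGroup X] [Module S X] [Module.Finite S X] (a : ℕ), 1 ≤ a →
    ∃ r : ℕ, (∀ i, r ≤ i → Subsingleton (Localization.AtPrime q ⊗[S] T S i N X)) ∧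
      ((∀ i, FL (Localization.AtPrime q) (Localization.AtPrime q ⊗[S] T S (a+1+i) N X)) →
        ∀ n, r ≤ n → 0 ≤ ∑ i ∈ Finset.range n, (-1:ℤ)^i *
            ell (Localization.AtPrime q) (Localization.AtPrime q ⊗[S] T S (a+1+i) N X) ∧
          (∑ i ∈ Finset.range n, (-1:ℤ)^i *
            ell (Localization.AtPrime q) (Localization.AtPrime q ⊗[S] T S (a+1+i) N X) = 0 →
            ∀ i, Subsingleton (Localization.AtPrime q ⊗[S] T S (a+1+i) N X)))

lemma LESData.base {S K : Type} [CommRing S] [CommRing K] [Algebra S K] [Module.Flat S K]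
    {A B : ℕ → Type} [∀ i, AddCommGroup (A i)]
    [∀ i, Module S (A i)] [∀ i, AddCommGroup (B i)] [∀ i, Module S (B i)]
    (d : LESData (K := S) A B) :
    Nonempty (LESData (K := K) (fun i => K ⊗[S] A i) (fun i => K ⊗[S] B i)) :=
  ⟨⟨fun m => (d.al m).baseChange K, fun m => (d.be m).baseChange K, fun m => (d.ga m).baseChange K,
    fun m => Module.Flat.lTensor_exact K (d.e1 m), fun m => Module.Flat.lTensor_exact K (d.e2 m),
    fun m => Module.Flat.lTensor_exact K (d.e3 m)⟩⟩

theorem step8 {S D : Type} [CommRing S] [IsNoetherianRing S] [CommRing D] [IsNoetherianRing D]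
    [Algebra S D] [Module.FaithfullyFlat S D] (hD : DiagGood S D)
    (N X : Type) [AddCommGroup N] [Module S N] [Module.Finite S N]
    [AddCommGroup X] [Module S X] [Module.Finite S X]
    (M : ℕ → ℕ → ModuleCat.{0} S) (c t r0 : ℕ) (hc : 1 ≤ c)
    (h0 : ∀ i, Nonempty (M 0 i ≃ₗ[S] T S i N X))
    (hfin : ∀ j i, Module.Finite S (M j i))
    (hd : ∀ j, j < c → Nonempty (LESData (K := S) (fun i => M (j+1) i) (fun i => M j i)))
    (hper : ∀ i, r0 ≤ i → Nonempty (M c (i+1) ≃ₗ[S] M c i))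
    (hz : ∀ i, t + 1 ≤ i → i ≤ t + c → Subsingleton (M c i)) :
    ∀ i, t + 1 ≤ i → Subsingleton (M c i) := by
  suffices H : ∀ j, j < c → ∀ i, t + c ≤ i + j → Subsingleton (M (j+1) i) by
    intro i hi
    have := H (c-1) (by omega) i (by omega)
    rwa [show c - 1 + 1 = c by omega] at this
  by_contra hcon
  push Not at hcon
  obtain ⟨j0, hj0, i0, hi0, hnt⟩ := hcon
  let Z : Set (PrimeSpectrum D) := {q | ∃ j, j < c ∧ ∃ i, t + c ≤ i + j ∧
    Module.annihilator D (D ⊗[S] M (j+1) i) ≤ q.asIdeal}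
  have hZ : Z.Nonempty := by
    have : Nontrivial (M (j0+1) i0) := hnt
    have : Nontrivial (D ⊗[S] M (j0+1) i0) := Module.FaithfullyFlat.lTensor_nontrivial S D _
    obtain ⟨q, hq⟩ := Module.nonempty_support_of_nontrivial (R := D) (M := D ⊗[S] M (j0+1) i0)
    exact ⟨q, j0, hj0, i0, hi0, Module.mem_support_iff_of_finite.1 hq⟩
  obtain ⟨q, hq, hmin⟩ : ∃ q ∈ Z, ∀ q' ∈ Z, q'.asIdeal ≤ q.asIdeal → q'.asIdeal = q.asIdeal := by
    let ht : PrimeSpectrum D → ℕ := fun q => q.asIdeal.height.toNat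
    obtain ⟨q, hq, hm⟩ := (measure ht).wf.has_min Z hZ
    refine ⟨q, hq, fun q' hq' hle => ?_⟩
    by_contra hne
    have hlt : q'.asIdeal < q.asIdeal := lt_of_le_of_ne hle hne
    refine hm q' hq' ?_
    have h1 := Ideal.height_strict_mono_of_isPrime_of_isPrime hlt
    have h2 : q.asIdeal.height < ⊤ := Ideal.height_lt_top_of_isPrime
    change q'.asIdeal.height.toNat < q.asIdeal.height.toNat
    have h3 := h1.trans h2
    rw [← ENat.natCast_toNat h2.ne, ← ENat.natCast_toNat h3.ne] at h1
    exact_mod_cast h1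
  let K := Localization.AtPrime q.asIdeal
  have hKflat : Module.Flat S K := Module.Flat.trans S D K
  obtain ⟨r, hr1, hr2⟩ := hD q.asIdeal N X (t + c) (by omega)
  have eq0 : ∀ i, Nonempty (K ⊗[S] M 0 i ≃ₗ[K] K ⊗[S] T S i N X) := fun i =>
    ⟨(h0 i).some.baseChange S K _ _⟩
  have hell : ∀ i, ell K (K ⊗[S] M 0 i) = ell K (K ⊗[S] T S i N X) := fun i =>
    ell_congr (eq0 i).some
  have key := numeric (K := K) (fun j i => K ⊗[S] M j i) c t (r + r0) hc
    (fun j hj => (LESData.base (K := K) (hd j hj).some).some)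
    (fun i h1 h2 => by
      have := hz i h1 h2
      refine subsingleton_of_forall_eq 0 fun y => ?_
      induction y with
      | zero => rfl
      | add a b ha hb => rw [ha, hb, add_zero]
      | tmul a b => rw [Subsingleton.elim b 0, TensorProduct.tmul_zero])
    (fun j hj i hi => by
      have := hfin (j+1) i
      refine FL_min q.asIdeal _ fun q' hq' h1 h2 => ?_
      exact hmin ⟨q', hq'⟩ ⟨j, hj, i, hi, h1⟩ h2)
    (fun i hi => ell_congr ((hper i (by omega)).some.baseChange S K _ _))
    (fun i hi => by
      have := hr1 i (by omega)
      exact (eq0 i).some.toEquiv.subsingleton)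
    (fun hF n hn => by
      simp only [hell]
      have := hr2 (fun i => FL_congr (eq0 _).some (hF i)) n (by omega)
      refine ⟨this.1, fun h i => ?_⟩
      have := this.2 h i
      exact (eq0 _).some.toEquiv.subsingleton)
  obtain ⟨j, hj, i, hi, hann⟩ := hq
  have h1 := hfin (j+1) i
  have h2 := (nontriv_iff q.asIdeal (M (j+1) i)).2 hann
  exact not_subsingleton_iff_nontrivial.2 h2 (key j hj i hi)

end Step8

section Step5
open Function TensorProduct RingTheory.Sequence

lemma Acyc_base {R Λ : Type} [CommRing R] [IsNoetherianRing R] [CommRing Λ] [Algebra R Λ]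
    [Module.Flat R Λ]
    (Y : Type) [AddCommGroup Y] [Module Λ Y] [Module R Y] [IsScalarTower R Λ Y] [Module.Flat R Y]
    (A : Type) [AddCommGroup A] [Module R A] [Module.Finite R A]
    (V : Type) [AddCommGroup V] [Module Λ V] (e : V ≃ₗ[Λ] Λ ⊗[R] A) : Acyc Λ V Y := by
  refine Acyc_congr_left e.symm fun n => ?_
  obtain ⟨e'⟩ := T_base_change (R := R) (Λ := Λ) Y A Acyc_flat_right n
  have : Subsingleton (T R (n+1) A Y) := Acyc_flat_right n
  exact e'.toEquiv.subsingleton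

lemma diag_tor {S S2 Λ : Type} [CommRing S] [IsNoetherianRing S] [CommRing S2] [IsNoetherianRing S2]
    [CommRing Λ] [Algebra S Λ] [Algebra S2 Λ] [Algebra S2 S]
    [Module.Flat S Λ] [Module.Flat S2 Λ] [Module.Flat S2 S]
    (Y : Type) [AddCommGroup Y] [Module Λ Y] [Module S Y] [IsScalarTower S Λ Y] [Module.Flat S Y]
    [Module S2 Y] [IsScalarTower S2 Λ Y] [IsScalarTower S2 S Y]
    (hsur : Surjective (algebraMap S2 S))
    (X : Type) [AddCommGroup X] [Module S X] [Module S2 X] [IsScalarTower S2 S X]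
    [Module.Finite S X]
    (A : Type) [AddCommGroup A] [Module S A] [Module.Finite S A]
    (V : Type) [AddCommGroup V] [Module Λ V] [Module S2 V] [IsScalarTower S2 Λ V] [Module.Flat S2 V]
    (eV : V ≃ₗ[Λ] Λ ⊗[S] A)
    (C : Type) [AddCommGroup C] [Module Λ C] [Module S C] [IsScalarTower S Λ C]
    (eC : C ≃ₗ[Λ] Λ ⊗[S2] X) (n : ℕ) :
    Nonempty (T Λ (n+1) (C ⊗[S] A) Y ≃ₗ[Λ] Y ⊗[S] (T S (n+1) A X)) := by
  have hX : Module.Finite S2 X := by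
    have : Module.Finite S2 S := Module.Finite.of_surjective (Algebra.linearMap S2 S) hsur
    exact Module.Finite.trans S X
  have : Module.Flat S2 Y := Module.Flat.trans S2 S Y
  have hCY : Acyc Λ C Y := Acyc_base (R := S2) Y X C eC
  have hA : Acyc S A C := by
    intro n
    obtain ⟨e'⟩ := T_base_change (R := S) (Λ := Λ) C A Acyc_flat_right n
    have h1 : Acyc Λ (Λ ⊗[S] A) C :=
      Acyc_congr_left eV (Acyc_comm (Acyc_base (R := S2) V X C eC))
    have := h1 n
    exact e'.symm.toEquiv.subsingleton
  let e1 : (C ⊗[Λ] Y) ≃ₗ[Λ] (Y ⊗[S2] X) :=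
    (TensorProduct.comm Λ C Y).trans (((TensorProduct.congr (LinearEquiv.refl Λ Y) eC)).trans
      (AlgebraTensorModule.cancelBaseChange S2 Λ Λ Y X))
  have : CompatibleSMul S2 S Y X := ⟨fun s y x => by
    obtain ⟨s, rfl⟩ := hsur s
    rw [algebraMap_smul, algebraMap_smul, TensorProduct.smul_tmul]⟩
  let e2 : (Y ⊗[S] X) ≃ₗ[Λ] (Y ⊗[S2] X) := TensorProduct.equivOfCompatibleSMul S2 S Λ Y X
  exact T_change_flat C Y hCY Y X (e1.trans e2.symm) A hA n
end Step5

section Step5b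
open Function TensorProduct RingTheory.Sequence

lemma exists_syz {S : Type} [CommRing S] [IsNoetherianRing S] (X : Type) [AddCommGroup X] [Module S X]
    (a : ℕ) : ∀ (N : Type) [AddCommGroup N] [Module S N] [Module.Finite S N],
    ∃ A : ModuleCat.{0} S, Module.Finite S A ∧ (∃ (k : ℕ) (u : A →ₗ[S] (Fin k → S)), Injective u) ∧
      ∀ m, Nonempty (T S (a+1+1+m) N X ≃ₗ[S] T S (m+1) A X) := by
  induction a with
  | zero =>
    intro N _ _ _
    obtain ⟨k, K, u, v, hK, hu, huv, hv⟩ := exists_fcover (R := S) N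
    refine ⟨K, hK, ⟨k, u, hu⟩, fun m => ?_⟩
    rw [show 0 + 1 + 1 + m = m + 2 by omega]
    exact T_shift hu huv hv Acyc_flat m
  | succ a ih =>
    intro N _ _ _
    obtain ⟨k, K, u, v, hK, hu, huv, hv⟩ := exists_fcover (R := S) N
    obtain ⟨A, h1, h2, h3⟩ := ih K
    refine ⟨A, h1, h2, fun m => ?_⟩
    obtain ⟨e1⟩ := h3 m
    obtain ⟨e2⟩ := T_shift (Y := X) hu huv hv Acyc_flat (a + 1 + m)
    rw [show a + 1 + 1 + 1 + m = a + 1 + m + 2 by omega]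
    rw [show a + 1 + 1 + m = a + 1 + m + 1 by omega] at e1
    exact ⟨e2.trans e1⟩

lemma diag_local {S S2 Λ K : Type} [CommRing S] [IsNoetherianRing S] [CommRing S2]
    [IsNoetherianRing S2] [CommRing Λ] [IsNoetherianRing Λ] [IsLocalRing Λ] [Algebra S Λ]
    [Algebra S2 Λ] [Algebra S2 S] [CommRing K] [Algebra S K] [Module.Flat S K]
    [Module.Flat S Λ] [Module.Flat S2 Λ] [Module.Flat S2 S]
    (hsur : Surjective (algebraMap S2 S)) (f : Λ →ₐ[S] K) (hf : Surjective f)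
    (ts : List Λ) (hts : IsWeaklyRegular Λ ts) (hm : ∀ t ∈ ts, t ∈ maximalIdeal Λ)
    (hker : RingHom.ker f = Ideal.ofList ts)
    (hdiag : ∀ s : S2, algebraMap S2 Λ s - algebraMap S Λ (algebraMap S2 S s) ∈ Ideal.ofList ts)
    (hfl : ∀ (A : Type) [AddCommGroup A] [Module S A] [Module.Finite S A] (k : ℕ)
      (u : A →ₗ[S] (Fin k → S)), Injective u → ∃ (V : Type) (_ : AddCommGroup V) (_ : Module Λ V)
        (_ : Module S2 V) (_ : IsScalarTower S2 Λ V), Nonempty (V ≃ₗ[Λ] Λ ⊗[S] A) ∧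
        Module.Flat S2 V)
    (N X : Type) [AddCommGroup N] [Module S N] [Module.Finite S N]
    [AddCommGroup X] [Module S X] [Module.Finite S X] (a : ℕ) (ha : 1 ≤ a) :
    ∃ r : ℕ, (∀ i, r ≤ i → Subsingleton (K ⊗[S] T S i N X)) ∧
      ((∀ i, FL K (K ⊗[S] T S (a+1+i) N X)) →
        ∀ n, r ≤ n → 0 ≤ ∑ i ∈ Finset.range n, (-1:ℤ)^i *
            ell K (K ⊗[S] T S (a+1+i) N X) ∧
          (∑ i ∈ Finset.range n, (-1:ℤ)^i * ell K (K ⊗[S] T S (a+1+i) N X) = 0 →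
            ∀ i, Subsingleton (K ⊗[S] T S (a+1+i) N X))) := by
  obtain ⟨a, rfl⟩ : ∃ b, a = b + 1 := ⟨a - 1, by omega⟩
  obtain ⟨A, hAf, ⟨k, u, hu⟩, hA⟩ := exists_syz (S := S) X a N
  obtain ⟨V, _, _, _, _, ⟨eV⟩, hV⟩ := hfl A k u hu
  let _ : Module S2 X := Module.compHom X (algebraMap S2 S)
  have _ : IsScalarTower S2 S X := IsScalarTower.of_algebraMap_smul fun r x => rfl
  have hX : Module.Finite S2 X := by
    have : Module.Finite S2 S := Module.Finite.of_surjective (Algebra.linearMap S2 S) hsur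
    exact Module.Finite.trans S X
  obtain ⟨C, _, _, _, _, ⟨eC⟩⟩ : ∃ (C : Type) (_ : AddCommGroup C) (_ : Module Λ C)
      (_ : Module S C) (_ : IsScalarTower S Λ C), Nonempty (C ≃ₗ[Λ] Λ ⊗[S2] X) := by
    obtain ⟨C, i0, i1, ⟨e⟩⟩ : ∃ (C : Type) (_ : AddCommGroup C) (_ : Module Λ C),
        Nonempty (C ≃ₗ[Λ] Λ ⊗[S2] X) :=
      ⟨Λ ⊗[S2] X, inferInstance, inferInstance, ⟨LinearEquiv.refl _ _⟩⟩
    let i2 : Module S C := Module.compHom C (algebraMap S Λ)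
    exact ⟨C, i0, i1, i2, IsScalarTower.of_algebraMap_smul fun r x => rfl, ⟨e⟩⟩
  have hCfin : Module.Finite Λ C := Module.Finite.equiv eC.symm
  have hY : IsScalarTower S2 S (Λ ⧸ Ideal.ofList ts) := IsScalarTower.of_algebraMap_eq fun s => by
    have := Ideal.Quotient.eq.2 (hdiag s)
    exact this
  let ε : (Λ ⧸ Ideal.ofList ts) ≃+* K := 
    (Ideal.quotEquivOfEq hker.symm).trans (RingHom.quotientKerEquivOfSurjective hf)
  have hε : ∀ x : Λ, ε (Ideal.Quotient.mk _ x) = f x := fun x => rfl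
  let εS : (Λ ⧸ Ideal.ofList ts) ≃ₗ[S] K := { ε with
    map_smul' := fun s x => by
      obtain ⟨x, rfl⟩ := Ideal.Quotient.mk_surjective x
      change ε (Ideal.Quotient.mk _ (s • x)) = _
      rw [hε, map_smul]; rfl }
  have hYflat : Module.Flat S (Λ ⧸ Ideal.ofList ts) := Module.Flat.of_linearEquiv εS
  have key := fun n => diag_tor (S := S) (S2 := S2) (Λ := Λ) (Λ ⧸ Ideal.ofList ts) hsur X A V eV C eC n
  obtain ⟨W, _, _, _, ⟨eW⟩⟩ : ∃ (W : Type) (_ : AddCommGroup W) (_ : Module Λ W)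
      (_ : Module.Finite Λ W), Nonempty (W ≃ₗ[Λ] C ⊗[S] A) := by
    refine ⟨C ⊗[S] A, inferInstance, inferInstance, ?_, ⟨LinearEquiv.refl _ _⟩⟩
    exact Module.Finite.equiv (AlgebraTensorModule.cancelBaseChange S Λ Λ C A)
  have e2 : ∀ i, ∃ e : (K ⊗[S] T S (a+1+1+i) N X) ≃+ T Λ (i+1) W (Λ ⧸ Ideal.ofList ts),
      ∀ (b : Λ) x, e ((f : Λ →+* K) b • x) = b • e x := by
    intro i
    obtain ⟨e1⟩ := key i
    obtain ⟨e3⟩ := hA i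
    have e4 : T Λ (i+1) W (Λ ⧸ Ideal.ofList ts) ≃ₗ[Λ] (Λ ⧸ Ideal.ofList ts) ⊗[S] T S (i+1) A X :=
      (Tcongr (R := Λ) (A := W) (B := C ⊗[S] A) eW (i+1) (Λ ⧸ Ideal.ofList ts)).trans e1
    let e5 : ((Λ ⧸ Ideal.ofList ts) ⊗[S] T S (i+1) A X) ≃ₗ[S] (K ⊗[S] T S (a+1+1+i) N X) :=
      TensorProduct.congr εS e3.symm
    refine ⟨(e4.toAddEquiv.trans e5.toAddEquiv).symm, fun b x => ?_⟩
    obtain ⟨y, rfl⟩ := (e4.toAddEquiv.trans e5.toAddEquiv).surjective x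
    rw [AddEquiv.symm_apply_eq, AddEquiv.symm_apply_apply]
    change f b • e5 (e4 y) = e5 (e4 (b • y))
    rw [e4.map_smul]
    generalize e4 y = z
    induction z with
    | zero => simp
    | add p q hp hq => rw [map_add, smul_add, hp, hq, smul_add, map_add]
    | tmul p q =>
      obtain ⟨p, rfl⟩ := Ideal.Quotient.mk_surjective p
      rw [TensorProduct.smul_tmul', TensorProduct.congr_tmul, TensorProduct.congr_tmul,
        TensorProduct.smul_tmul']
      congr 1
      change f b * f p = f (b * p)
      rw [map_mul]
  have hls := fun i => FL_semilin (f : Λ →+* K) hf (e2 i).choose (e2 i).choose_spec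
  refine ⟨a + 1 + 1 + ts.length, fun i hi => ?_, fun hFL n hn => ?_⟩
  · obtain ⟨j, rfl⟩ : ∃ j, i = a + 1 + 1 + j := ⟨i - (a+1+1), by omega⟩
    have := (reg_ring (R := Λ) (D := W) ts hts).1 (j+1) (by omega)
    exact (e2 j).choose.toEquiv.subsingleton
  · have := lemX ts.length Λ ts rfl hts hm W (fun i => (hls i).1.2 (hFL i)) n (by omega)
    simp only [(hls _).2] at this
    refine ⟨this.1, fun h i => ?_⟩
    have := this.2 h i
    exact (e2 i).choose.toEquiv.subsingleton
end Step5b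

section Step5c
open Function TensorProduct RingTheory.Sequence

lemma flat_loc {S2 P Λ V0 : Type} [CommRing S2] [CommRing P] [CommRing Λ] [Algebra S2 P]
    [Algebra P Λ] [Module.Flat P Λ] [AddCommGroup V0] [Module P V0] [Module S2 V0]
    [IsScalarTower S2 P V0] [Module.Flat S2 V0] [Algebra S2 Λ] [IsScalarTower S2 P Λ] :
    Module.Flat S2 (Λ ⊗[P] V0) := by
  rw [Module.Flat.iff_lTensor_preserves_injective_linearMap]
  intro M M' _ _ _ _ f hf
  have h1 : Injective (f.lTensor V0) := Module.Flat.lTensor_preserves_injective_linearMap _ hf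
  let f' := AlgebraTensorModule.lTensor P V0 f
  have h2 : Injective (f'.lTensor Λ) := Module.Flat.lTensor_preserves_injective_linearMap _ h1
  have h3 : ∀ x, f'.lTensor Λ (AlgebraTensorModule.assoc S2 P P Λ V0 M x) =
      AlgebraTensorModule.assoc S2 P P Λ V0 M' (f.lTensor (Λ ⊗[P] V0) x) := by
    intro x
    induction x with
    | zero => simp
    | add a b ha hb => simp only [map_add, ha, hb]
    | tmul a b =>
      induction a with
      | zero => simp
      | add a c ha hb => simp only [add_tmul, map_add, ha, hb]
      | tmul a c => simp [f']
  intro x y hxy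
  apply (AlgebraTensorModule.assoc S2 P P Λ V0 M).injective
  apply h2
  rw [h3, h3, hxy]

lemma diagGood_of {S S2 P : Type} [CommRing S] [IsNoetherianRing S] [CommRing S2]
    [IsNoetherianRing S2] [CommRing P] [IsNoetherianRing P] [Algebra S P]
    [Algebra S2 P] [Algebra S2 S]
    [Module.Flat S P] [Module.Flat S2 P] [Module.Flat S2 S]
    (hsur : Surjective (algebraMap S2 S)) 
    (us : List P) (hus : IsWeaklyRegular P us) [Module.Flat S (P ⧸ Ideal.ofList us)]
    (hdiag : ∀ s : S2, algebraMap S2 P s - algebraMap S P (algebraMap S2 S s) ∈ Ideal.ofList us)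
    (hfl : ∀ (A : Type) [AddCommGroup A] [Module S A] [Module.Finite S A] (k : ℕ)
      (u : A →ₗ[S] (Fin k → S)), Injective u → ∃ (V : Type) (_ : AddCommGroup V) (_ : Module P V)
        (_ : Module S2 V) (_ : IsScalarTower S2 P V), Nonempty (V ≃ₗ[P] P ⊗[S] A) ∧
        Module.Flat S2 V) : DiagGood S (P ⧸ Ideal.ofList us) := by
  intro q hq N X _ _ _ _ _ _ a ha
  let Q := q.comap (Ideal.Quotient.mk (Ideal.ofList us))
  have hQ : Q.IsPrime := hq.comap _
  obtain ⟨Λ, hΛ⟩ : ∃ Λ, Λ = Localization.AtPrime Q := ⟨_, rfl⟩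
  let f0 : Localization.AtPrime Q →+* Localization.AtPrime q :=
    Localization.localRingHom Q q (Ideal.Quotient.mk _) rfl
  have hf0 : Surjective f0 :=
    RingHom.surjectiveOnStalks_of_surjective Ideal.Quotient.mk_surjective q hq
  let f : Localization.AtPrime Q →ₐ[S] Localization.AtPrime q := 
    { f0 with 
      commutes' := fun s => by
        change f0 (algebraMap S (Localization.AtPrime Q) s) = _
        rw [IsScalarTower.algebraMap_apply S P (Localization.AtPrime Q),
          IsScalarTower.algebraMap_apply S (P ⧸ Ideal.ofList us) (Localization.AtPrime q)]
        exact Localization.localRingHom_to_map _ _ _ _ _ }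
  have hff0 : ∀ x, f x = f0 x := fun x => rfl
  have hPΛ : Module.Flat P (Localization.AtPrime Q) := inferInstance
  have : IsNoetherianRing (Localization.AtPrime Q) :=
    IsLocalization.isNoetherianRing Q.primeCompl _ inferInstance
  have hIQ : Ideal.ofList us ≤ Q := fun x hx => by
    rw [Ideal.mem_comap, Ideal.Quotient.eq_zero_iff_mem.2 hx]; exact zero_mem _
  have hmap : Ideal.ofList (us.map (algebraMap P (Localization.AtPrime Q))) =
      (Ideal.ofList us).map (algebraMap P (Localization.AtPrime Q)) := (Ideal.map_ofList _ _).symm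
  refine diag_local (S := S) (S2 := S2) (Λ := Localization.AtPrime Q)
    (K := Localization.AtPrime q) hsur f hf0 (us.map (algebraMap P (Localization.AtPrime Q)))
    (hus.of_flat) ?_ ?_ ?_ ?_ N X a ha
  · intro t ht
    obtain ⟨t, ht1, rfl⟩ := List.mem_map.1 ht
    rw [← Localization.AtPrime.map_eq_maximalIdeal]
    exact Ideal.mem_map_of_mem _ (hIQ (Ideal.subset_span ht1))
  · rw [hmap]
    apply le_antisymm
    · intro x hx
      obtain ⟨y, s, rfl⟩ := IsLocalization.exists_mk'_eq Q.primeCompl x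
      have hx : f0 _ = 0 := hx
      rw [Localization.localRingHom_mk', IsLocalization.mk'_eq_zero_iff] at hx
      obtain ⟨⟨m, hm⟩, hm2⟩ := hx
      obtain ⟨m, rfl⟩ := Ideal.Quotient.mk_surjective m
      simp only [← map_mul] at hm2
      rw [Ideal.Quotient.eq_zero_iff_mem] at hm2
      rw [IsLocalization.mk'_mem_iff]
      have hu : IsUnit (algebraMap P (Localization.AtPrime Q) m) :=
        IsLocalization.map_units (M := Q.primeCompl) (Localization.AtPrime Q) ⟨m, hm⟩
      have := Ideal.mem_map_of_mem (algebraMap P (Localization.AtPrime Q)) hm2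
      rw [map_mul] at this
      exact (Ideal.unit_mul_mem_iff_mem _ hu).1 this
    · rw [Ideal.map_le_iff_le_comap]
      intro x hx
      change f0 (algebraMap _ _ x) = 0
      rw [Localization.localRingHom_to_map, Ideal.Quotient.eq_zero_iff_mem.2 hx, map_zero]
  · intro s
    rw [hmap, IsScalarTower.algebraMap_apply S P (Localization.AtPrime Q),
      IsScalarTower.algebraMap_apply S2 P (Localization.AtPrime Q), ← map_sub]
    exact Ideal.mem_map_of_mem _ (hdiag s)
  · intro A _ _ _ k u hu
    obtain ⟨V, _, _, _, _, ⟨e⟩, hV⟩ := hfl A k u hu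
    refine ⟨Localization.AtPrime Q ⊗[P] V, inferInstance, inferInstance, inferInstance,
      inferInstance, ⟨?_⟩, flat_loc⟩
    exact (AlgebraTensorModule.congr (LinearEquiv.refl _ _) e).trans
      (AlgebraTensorModule.cancelBaseChange S P (Localization.AtPrime Q) (Localization.AtPrime Q) A)
end Step5c

section Noeth
open Function TensorProduct

lemma noeth_complete {A B : Type} [CommRing A] [IsNoetherianRing A] [CommRing B] (g : A →+* B)
    (J : Ideal B) [IsAdicComplete J B] (n : ℕ) (b : Fin n → B) (hb : Ideal.span (Set.range b) = J)
    (hs : Surjective ((Ideal.Quotient.mk J).comp g)) : IsNoetherianRing B := by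
  let ev : MvPolynomial (Fin n) A →+* B := MvPolynomial.eval₂Hom g b
  have hV : (MvPolynomial.idealOfVars (Fin n) A).map ev ≤ J := by
    rw [MvPolynomial.idealOfVars, Ideal.map_span, Ideal.span_le]
    rintro _ ⟨_, ⟨i, rfl⟩, rfl⟩
    simp only [ev, MvPolynomial.coe_eval₂Hom, MvPolynomial.eval₂_X]
    rw [← hb]; exact Ideal.subset_span ⟨i, rfl⟩
  have hVk : ∀ k, (MvPolynomial.idealOfVars (Fin n) A)^k ≤ (J^k).comap ev := fun k => by
    rw [← Ideal.map_le_iff_le_comap, Ideal.map_pow]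
    exact Ideal.pow_right_mono hV k
  let f : (k : ℕ) → MvPowerSeries (Fin n) A →+* B ⧸ J^k := fun k =>
    (Ideal.quotientMap (J^k) ev (hVk k)).comp (MvPowerSeries.truncTotalAlgHom (Fin n) A k).toRingHom
  have hfk : ∀ k x, f k x = Ideal.Quotient.mk (J^k) (ev (MvPowerSeries.truncTotal k x)) := 
    fun k x => rfl
  have hfp : ∀ k (p : MvPolynomial (Fin n) A), f k (p : MvPowerSeries (Fin n) A) =
      Ideal.Quotient.mk (J^k) (ev p) := fun k p => by
    have := (MvPowerSeries.truncTotalAlgHom (Fin n) A k).commutes p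
    have h2 : f k (p : MvPowerSeries (Fin n) A) = Ideal.quotientMap (J^k) ev (hVk k) 
      ((MvPowerSeries.truncTotalAlgHom (Fin n) A k) (p : MvPowerSeries (Fin n) A)) := rfl
    rw [h2, show (p : MvPowerSeries (Fin n) A) = algebraMap (MvPolynomial (Fin n) A) _ p from ?_,
      this]
    · rfl
    · simp [MvPowerSeries.algebraMap_apply']
  have hf : ∀ {k l : ℕ} (hle : k ≤ l), (Ideal.Quotient.factorPow J hle).comp (f l) = f k := by
    intro k l hle
    ext x
    rw [RingHom.comp_apply, hfk, hfk]
    refine Eq.trans (Ideal.Quotient.factor_mk (Ideal.pow_le_pow_right hle) _) ?_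
    rw [Ideal.Quotient.eq, ← map_sub]
    exact hVk k (MvPowerSeries.truncTotal_sub_truncTotal_mem_pow_idealOfVars hle le_rfl x)
  let F := IsAdicComplete.liftRingHom J f hf
  have hFp : ∀ p : MvPolynomial (Fin n) A, F (p : MvPowerSeries (Fin n) A) = ev p := fun p => by
    rw [← sub_eq_zero]
    refine IsHausdorff.haus (I := J) inferInstance _ fun k => ?_
    rw [SModEq.zero]
    have := IsAdicComplete.mk_liftRingHom J f hf k (p : MvPowerSeries (Fin n) A)
    rw [hfp, Ideal.Quotient.eq] at this
    simpa using this
  have hmap : (Ideal.span (Set.range MvPowerSeries.X) : Ideal (MvPowerSeries (Fin n) A)).map F = J := by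
    rw [Ideal.map_span, ← Set.range_comp, ← hb]
    congr 1
    congr 1
    ext i
    rw [Function.comp_apply, ← MvPolynomial.coe_X, hFp]
    simp [ev]
  have hsurj : Surjective F := by
    have h1 : IsHausdorff ((Ideal.span (Set.range MvPowerSeries.X) :
      Ideal (MvPowerSeries (Fin n) A)).map F) B := by rw [hmap]; infer_instance
    apply surjective_of_mk_map_comp_surjective F (I := Ideal.span (Set.range MvPowerSeries.X))
    rw [hmap]
    intro y
    obtain ⟨a, rfl⟩ := hs y
    refine ⟨(MvPolynomial.C a : MvPolynomial (Fin n) A), ?_⟩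
    rw [RingHom.comp_apply, hFp]
    simp [ev]
  exact isNoetherianRing_of_surjective _ _ F hsurj

/-- the completion of a polynomial ring at a maximal ideal -/
lemma exists_compl {A : Type} [CommRing A] [IsNoetherianRing A] (M : Ideal A) [hM : M.IsMaximal] :
    ∃ (P : Type) (_ : CommRing P) (_ : IsNoetherianRing P) (_ : IsLocalRing P) (_ : Algebra A P),
      Module.Flat A P ∧ maximalIdeal P = M.map (algebraMap A P) ∧
      IsAdicComplete (maximalIdeal P) P ∧ Surjective ((residue P).comp (algebraMap A P)) ∧
      (∀ x, algebraMap A P x ∈ maximalIdeal P ↔ x ∈ M) := by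
  have hfg : M.FG := (isNoetherianRing_iff_ideal_fg A).1 inferInstance M
  have h1 := AdicCompletion.isMaximal_map_of_le M M le_rfl hfg
  have h2 := AdicCompletion.isAdicComplete_self M hfg
  have h3 := isLocalRing_of_isAdicComplete_maximal (M.map (algebraMap A (AdicCompletion M A)))
  have h4 : M.map (algebraMap A (AdicCompletion M A)) = maximalIdeal _ := IsLocalRing.eq_maximalIdeal h1
  have hk := AdicCompletion.ker_evalOneₐ_eq_map M hfg
  have hs : Surjective ((Ideal.Quotient.mk (M.map (algebraMap A (AdicCompletion M A)))).comp
      (algebraMap A (AdicCompletion M A))) := by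
    intro y
    obtain ⟨y, rfl⟩ := Ideal.Quotient.mk_surjective y
    obtain ⟨a, ha⟩ := Ideal.Quotient.mk_surjective (AdicCompletion.evalOneₐ M y)
    refine ⟨a, ?_⟩
    rw [RingHom.comp_apply, Ideal.Quotient.eq, ← hk, RingHom.mem_ker, map_sub, sub_eq_zero]
    refine Eq.trans ?_ ha
    exact RingHom.congr_fun (AdicCompletion.evalOneₐ_comp_algebraMap_eq_mk M) a
  obtain ⟨n, a, ha⟩ := Submodule.fg_iff_exists_fin_generating_family.1 hfg
  have h5 : IsNoetherianRing (AdicCompletion M A) := by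
    refine noeth_complete (algebraMap A (AdicCompletion M A)) (M.map (algebraMap A _)) n
      (fun i => algebraMap A _ (a i)) ?_ hs
    have h6 := congrArg (Ideal.map (algebraMap A (AdicCompletion M A))) 
      (show Ideal.span (Set.range a) = M from ha)
    rw [Ideal.map_span, ← Set.range_comp] at h6
    exact h6
  refine ⟨AdicCompletion M A, inferInstance, h5, h3, inferInstance, AdicCompletion.flat_of_isNoetherian M,
    h4.symm, h4 ▸ h2, ?_, fun x => ?_⟩
  · rw [h4] at hs; exact hs
  · rw [← h4, ← hk, RingHom.mem_ker, ← Ideal.Quotient.eq_zero_iff_mem]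
    rw [← AdicCompletion.evalOneₐ_comp_algebraMap_eq_mk M]; rfl
end Noeth

section FieldSection
open Function Polynomial

lemma section_zero {k E : Type} [Field k] [CharZero k] [CommRing E] (π : E →+* k)
    (hπ : Surjective π) (hsq : ∀ a b, π a = 0 → π b = 0 → a * b = 0) :
    ∃ s : k →+* E, π.comp s = RingHom.id k := by
  have hunit : ∀ e : E, π e ≠ 0 → IsUnit e := by
    intro e he
    obtain ⟨f, hf⟩ := hπ (π e)⁻¹
    have h1 : π (e * f - 1) = 0 := by rw [map_sub, map_mul, hf, map_one, mul_inv_cancel₀ he, sub_self]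
    have h2 := hsq _ _ h1 h1
    refine IsUnit.of_mul_eq_one (f * (2 - e * f)) ?_
    linear_combination -h2
  let g : ℚ →+* E := IsLocalization.lift (M := nonZeroDivisors ℤ) (g := Int.castRingHom E) (by
    intro y
    apply hunit
    simp)
  let _ : Algebra ℚ E := g.toAlgebra
  obtain ⟨s, hs⟩ := exists_isTranscendenceBasis ℚ k
  have hs' := hs.isAlgebraic_field
  have hsep : Algebra.IsSeparable (IntermediateField.adjoin ℚ (Set.range (Subtype.val : s → k))) k :=
    Algebra.IsAlgebraic.isSeparable_of_perfectField
  have : Algebra.FormallySmooth ℚ k := Algebra.FormallySmooth.of_algebraicIndependent_of_isSeparable hs.1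
  have hnil : IsNilpotent (RingHom.ker (π.toRatAlgHom)) := by
    refine ⟨2, ?_⟩
    rw [pow_two, Ideal.zero_eq_bot, eq_bot_iff, Ideal.mul_le]
    intro a ha b hb
    exact hsq a b ha hb
  refine ⟨(Algebra.FormallySmooth.liftOfSurjective (AlgHom.id ℚ k) π.toRatAlgHom hπ hnil).toRingHom, ?_⟩
  ext x
  exact DFunLike.congr_fun (Algebra.FormallySmooth.comp_liftOfSurjective (AlgHom.id ℚ k) π.toRatAlgHom hπ hnil) x

lemma section_p {k E : Type} [Field k] [CommRing E] (p : ℕ) [hp : Fact p.Prime] [CharP E p] (π : E →+* k)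
    (hπ : Surjective π) (hsq : ∀ a b, π a = 0 → π b = 0 → a * b = 0) :
    ∃ s : k →+* E, π.comp s = RingHom.id k := by
  have hpw : ∀ a, π a = 0 → a ^ p = 0 := fun a ha => by
    obtain ⟨m, hm⟩ := Nat.exists_eq_add_of_le hp.1.two_le
    rw [hm, pow_add, pow_two, hsq a a ha ha, zero_mul]
  let Z : Set (Subring E) := {L | (∀ e, e ^ p ∈ L) ∧ ∀ x ∈ L, π x = 0 → x = 0}
  have h0 : (frobenius E p).range ∈ Z := by
    refine ⟨fun e => ⟨e, rfl⟩, ?_⟩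
    rintro _ ⟨e, rfl⟩ he
    rw [frobenius_def, map_pow] at he
    rw [frobenius_def]
    exact hpw e (pow_eq_zero_iff hp.1.ne_zero |>.1 he)
  obtain ⟨L, -, hL⟩ := zorn_le_nonempty₀ Z (fun c hc hch y hy => by
    refine ⟨sSup c, ⟨fun e => ?_, ?_⟩, fun z hz => le_sSup hz⟩
    · exact (le_sSup hy) ((hc hy).1 e)
    · intro x hx h
      rw [Subring.mem_sSup_of_directedOn ⟨y, hy⟩ hch.directedOn] at hx
      obtain ⟨s, hs, hx⟩ := hx
      exact (hc hs).2 x hx h) _ h0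
  have hLZ := hL.prop
  have hinj : ∀ x : L, π x = 0 → x = 0 := fun x hx => Subtype.ext (hLZ.2 _ x.2 hx)
  have hfield : IsField L := by
    refine ⟨⟨0, 1, fun h => ?_⟩, mul_comm, fun {x} hx => ?_⟩
    · have := congrArg (fun y : L => π y) h
      simp at this
    · have hx' : π x ≠ 0 := fun h => hx (hinj x h)
      obtain ⟨f, hf⟩ := hπ (π x)⁻¹
      refine ⟨x ^ (p - 1) * ⟨f ^ p, hLZ.1 f⟩, ?_⟩
      apply sub_eq_zero.1
      apply hinj
      have : (x:E) * (x ^ (p-1) * f ^ p) = (x * f)^p := by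
        rw [← mul_assoc, ← pow_succ', mul_pow, Nat.sub_add_cancel hp.1.one_le]
      push_cast
      rw [this, map_sub, map_pow, map_mul, hf, mul_inv_cancel₀ hx', one_pow, map_one, sub_self]
  have hsurj : ∀ α : k, ∃ x : L, π x = α := by
    intro α
    by_contra hα
    obtain ⟨a, rfl⟩ := hπ α
    let _ : Field L := hfield.toField
    let _ : Algebra L k := (π.comp L.subtype).toAlgebra
    have hmap : ∀ f : L[X], π (aeval a f) = aeval (π a) f := fun f => by
      rw [aeval_def, aeval_def, hom_eval₂]; rfl
    let c : L := ⟨a ^ p, hLZ.1 a⟩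
    have hirr : Irreducible (X ^ p - C c) := by
      apply X_pow_sub_C_irreducible_of_prime hp.1
      intro b hb
      refine hα ⟨b, ?_⟩
      have h1 : (b : E)^p = a ^ p := congrArg Subtype.val hb
      have h2 : (b - a : E)^p = 0 := by
        rw [sub_pow_char, h1, sub_self]
      have h3 : (π (b - a : E))^p = 0 := by rw [← map_pow, h2, map_zero]
      have h4 := pow_eq_zero_iff hp.1.ne_zero |>.1 h3
      rwa [map_sub, sub_eq_zero] at h4
    have hz : aeval a (X ^ p - C c) = 0 := by
      rw [map_sub, map_pow, aeval_X, aeval_C]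
      exact sub_self _
    have hz' : aeval (π a) (X ^ p - C c) = 0 := by rw [← hmap, hz, map_zero]
    have hmin := minpoly.eq_of_irreducible_of_monic hirr hz' (monic_X_pow_sub_C c hp.1.ne_zero)
    have hL' : (aeval a : L[X] →ₐ[L] E).toRingHom.range ∈ Z := by
      refine ⟨fun e => ⟨C ⟨e ^ p, hLZ.1 e⟩, ?_⟩, ?_⟩
      · exact aeval_C _ _
      · rintro _ ⟨f, rfl⟩ hf
        have h1 : aeval (π a) f = 0 := by rw [← hmap]; exact hf
        have h2 := minpoly.dvd L (π a) h1
        rw [← hmin] at h2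
        obtain ⟨g, rfl⟩ := h2
        change aeval a ((X ^ p - C c) * g) = 0
        rw [map_mul, hz, zero_mul]
    have hle : L ≤ (aeval a : L[X] →ₐ[L] E).toRingHom.range := fun x hx =>
      ⟨C ⟨x, hx⟩, aeval_C _ _⟩
    have h5 := hL.le_of_ge hL' hle
    have h6 : a ∈ L := h5 ⟨X, aeval_X _⟩
    exact hα ⟨⟨a, h6⟩, rfl⟩
  let ψ : L ≃+* k := RingEquiv.ofBijective (π.comp L.subtype)
    ⟨(injective_iff_map_eq_zero _).2 hinj, hsurj⟩
  refine ⟨L.subtype.comp ψ.symm.toRingHom, ?_⟩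
  ext x
  exact ψ.apply_symm_apply x

lemma section_field {k E : Type} [Field k] [CommRing E] (hE : ((ringChar k : ℕ) : E) = 0) (π : E →+* k)
    (hπ : Surjective π) (hsq : ∀ a b, π a = 0 → π b = 0 → a * b = 0) :
    ∃ s : k →+* E, π.comp s = RingHom.id k := by
  rcases CharP.char_is_prime_or_zero k (ringChar k) with h | h
  · have : Fact (ringChar k).Prime := ⟨h⟩
    have : Nontrivial E := π.domain_nontrivial
    have : CharP E (ringChar k) := by
      obtain ⟨r, hr⟩ := CharP.exists E
      have h1 : r ∣ ringChar k := (CharP.cast_eq_zero_iff E r _).1 hE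
      rcases (Nat.dvd_prime h).1 h1 with rfl | rfl
      · exact absurd rfl (CharP.char_ne_one E 1)
      · exact hr
    exact section_p (ringChar k) π hπ hsq
  · have : CharP k 0 := h ▸ ringChar.charP k
    have : CharZero k := CharP.charP_to_charZero k
    exact section_zero π hπ hsq
end FieldSection

section Lifting
open Function

lemma lift_one {E S : Type} [CommRing E] [CommRing S] (π : E →+* S) (hπ : Surjective π)
    (xt : E) (hk : ∀ a, π a = 0 → xt * a = 0) (hx : IsSMulRegular S (π xt))
    (s1 : S ⧸ Ideal.span {π xt} →+* E ⧸ Ideal.span {xt})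
    (hs1 : ∀ a e, s1 (Ideal.Quotient.mk _ a) = Ideal.Quotient.mk _ e → π e - a ∈ Ideal.span {π xt}) :
    ∃ s : S →+* E, (∀ a, π (s a) = a) ∧ 
      ∀ e, s1 (Ideal.Quotient.mk _ (π e)) = Ideal.Quotient.mk _ e → s (π e) = e := by
  have huniq : ∀ e f, π e = π f → Ideal.Quotient.mk (Ideal.span {xt}) e = Ideal.Quotient.mk _ f → e = f := by
    intro e f h1 h2
    rw [Ideal.Quotient.eq, Ideal.mem_span_singleton'] at h2
    obtain ⟨g, hg⟩ := h2
    have h3 : π xt * π g = 0 := by rw [← map_mul, mul_comm, hg, map_sub, h1, sub_self]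
    have h4 : π g = 0 := hx (by simpa using h3)
    rw [← sub_eq_zero, ← hg, mul_comm, hk g h4]
  have hex : ∀ a, ∃ e, π e = a ∧ Ideal.Quotient.mk (Ideal.span {xt}) e = s1 (Ideal.Quotient.mk _ a) := by
    intro a
    obtain ⟨e0, he0⟩ := Ideal.Quotient.mk_surjective (s1 (Ideal.Quotient.mk _ a))
    have h1 := hs1 a e0 he0.symm
    rw [Ideal.mem_span_singleton'] at h1
    obtain ⟨b, hb⟩ := h1
    obtain ⟨b, rfl⟩ := hπ b
    refine ⟨e0 - b * xt, ?_, ?_⟩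
    · rw [map_sub, map_mul, hb]; ring
    · rw [← he0, Ideal.Quotient.eq, Ideal.mem_span_singleton']
      exact ⟨-b, by ring⟩
  choose s hs hs' using hex
  refine ⟨{ toFun := s, map_one' := ?_, map_mul' := ?_, map_zero' := ?_, map_add' := ?_}, hs, ?_⟩
  · apply huniq <;> simp [hs, hs']
  · intro x y; apply huniq <;> simp [hs, hs']
  · apply huniq <;> simp [hs, hs']
  · intro x y; apply huniq <;> simp [hs, hs']
  · intro e he
    apply huniq
    · exact hs _
    · exact (hs' _).trans he

lemma lift_list {k : Type} [Field k] (zt0 : ℕ) : ∀ (E S : Type) [CommRing E] [CommRing S] (π : E →+* S)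
    (_ : Surjective π) (_ : ∀ a b, π a = 0 → π b = 0 → a * b = 0)
    (zt : List E) (_ : zt.length = zt0) (_ : ∀ x ∈ zt, ∀ a, π a = 0 → x * a = 0)
    (_ : RingTheory.Sequence.IsWeaklyRegular S (zt.map π))
    (ρ : S →+* k) (_ : Surjective ρ) (_ : RingHom.ker ρ = Ideal.ofList (zt.map π))
    (_ : ((ringChar k : ℕ) : E) ∈ Ideal.ofList zt),
    ∃ s : S →+* E, (∀ a, π (s a) = a) ∧ ∀ x ∈ zt, s (π x) = x := by
  induction zt0 with
  | zero =>
    intro E S _ _ π hπ hsq zt hl hk hreg ρ hρ hker hq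
    obtain rfl := List.length_eq_zero_iff.1 hl
    have hinj : Injective ρ := by
      rw [RingHom.injective_iff_ker_eq_bot, hker]; simp
    have hbij : Bijective ρ := ⟨hinj, hρ⟩
    have h0 : ((ringChar k : ℕ) : E) = 0 := by simpa using hq
    obtain ⟨s, hs⟩ := section_field h0 (ρ.comp π) (hρ.comp hπ) (fun a b ha hb =>
      hsq a b (hinj (by rw [map_zero]; exact ha)) (hinj (by rw [map_zero]; exact hb)))
    refine ⟨s.comp ρ, fun a => hinj ?_, by simp⟩
    exact RingHom.congr_fun hs (ρ a)
  | succ n ih =>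
    intro E S _ _ π hπ hsq zt hl hk hreg ρ hρ hker hq
    obtain ⟨xt, zt, rfl⟩ := List.exists_cons_of_length_eq_add_one hl
    rw [List.map_cons, wreg_cons] at hreg
    have hmap : Ideal.span {xt} ≤ (Ideal.span {π xt}).comap π := by
      rw [Ideal.span_singleton_le_iff_mem, Ideal.mem_comap]
      exact Ideal.mem_span_singleton_self _
    let π1 : E ⧸ Ideal.span {xt} →+* S ⧸ Ideal.span {π xt} := Ideal.quotientMap _ π hmap
    have hπ1 : Surjective π1 := by
      intro y
      obtain ⟨y, rfl⟩ := Ideal.Quotient.mk_surjective y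
      obtain ⟨y, rfl⟩ := hπ y
      exact ⟨Ideal.Quotient.mk _ y, rfl⟩
    have hkl : ∀ y, π1 y = 0 → ∃ a, π a = 0 ∧ Ideal.Quotient.mk _ a = y := by
      intro y hy
      obtain ⟨y, rfl⟩ := Ideal.Quotient.mk_surjective y
      have : Ideal.Quotient.mk (Ideal.span {π xt}) (π y) = 0 := hy
      rw [Ideal.Quotient.eq_zero_iff_mem, Ideal.mem_span_singleton'] at this
      obtain ⟨b, hb⟩ := this
      obtain ⟨b, rfl⟩ := hπ b
      refine ⟨y - b * xt, by rw [map_sub, map_mul, hb, sub_self], ?_⟩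
      rw [Ideal.Quotient.eq, Ideal.mem_span_singleton']
      exact ⟨-b, by ring⟩
    have hρ0 : ∀ a ∈ Ideal.span {π xt}, ρ a = 0 := by
      intro a ha
      rw [← RingHom.mem_ker, hker, List.map_cons, Ideal.ofList_cons]
      exact Ideal.mem_sup_left ha
    have key : ∃ s1 : S ⧸ Ideal.span {π xt} →+* E ⧸ Ideal.span {xt}, (∀ a, π1 (s1 a) = a) ∧
        ∀ x ∈ zt.map (Ideal.Quotient.mk (Ideal.span {xt})), s1 (π1 x) = x := by
      refine ih (E ⧸ Ideal.span {xt}) (S ⧸ Ideal.span {π xt}) π1 hπ1 ?_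
        (zt.map (Ideal.Quotient.mk _)) (by simpa using hl) ?_ ?_ (Ideal.Quotient.lift _ ρ hρ0) ?_ ?_ ?_
      · intro a b ha hb
        obtain ⟨a, ha', rfl⟩ := hkl a ha
        obtain ⟨b, hb', rfl⟩ := hkl b hb
        rw [← map_mul, hsq a b ha' hb', map_zero]
      · intro x hx a ha
        obtain ⟨x, hx', rfl⟩ := List.mem_map.1 hx
        obtain ⟨a, ha', rfl⟩ := hkl a ha
        rw [← map_mul, hk x (List.mem_cons_of_mem _ hx') a ha', map_zero]
      · have := hreg.2
        rw [List.map_map] at this ⊢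
        exact this
      · exact Ideal.Quotient.lift_surjective_of_surjective _ _ hρ
      · ext y
        obtain ⟨y, rfl⟩ := Ideal.Quotient.mk_surjective y
        rw [RingHom.mem_ker, Ideal.Quotient.lift_mk, ← RingHom.mem_ker, hker]
        rw [show (List.map π1 (List.map (Ideal.Quotient.mk (Ideal.span {xt})) zt)) = 
          (zt.map π).map (Ideal.Quotient.mk (Ideal.span {π xt})) by rw [List.map_map, List.map_map]; rfl]
        rw [← Ideal.map_ofList (Ideal.Quotient.mk (Ideal.span {π xt})), List.map_cons, Ideal.ofList_cons, Ideal.mem_quotient_iff_mem_sup, sup_comm]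
      · have := Ideal.mem_map_of_mem (Ideal.Quotient.mk (Ideal.span {xt})) hq
        rw [map_natCast, Ideal.map_ofList, List.map_cons, Ideal.ofList_cons] at this
        rw [Ideal.Quotient.eq_zero_iff_mem.2 (Ideal.mem_span_singleton_self _)] at this
        simpa using this
    obtain ⟨s1, hs1, hs1'⟩ := key
    obtain ⟨s, hs, hs'⟩ := lift_one π hπ xt (hk xt (by simp)) hreg.1 s1 (fun a e h => by
      have := hs1 (Ideal.Quotient.mk _ a)
      rw [h] at this
      exact Ideal.Quotient.eq.1 this)
    refine ⟨s, hs, ?_⟩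
    intro x hx
    apply hs'
    rcases List.mem_cons.1 hx with rfl | hx
    · rw [Ideal.Quotient.eq_zero_iff_mem.2 (Ideal.mem_span_singleton_self _),
        Ideal.Quotient.eq_zero_iff_mem.2 (Ideal.mem_span_singleton_self _), map_zero]
    · exact hs1' (Ideal.Quotient.mk _ x) (List.mem_map_of_mem hx)
end Lifting

section Lifting2
open Function

lemma lift_step {S P : Type} [CommRing S] [IsLocalRing S] [CommRing P] [IsLocalRing P]
    (zts : List (S × P)) (hreg : RingTheory.Sequence.IsWeaklyRegular S (zts.map Prod.fst))
    (hgen : Ideal.ofList (zts.map Prod.fst) = maximalIdeal S)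
    (ht : ∀ x ∈ zts, x.2 ∈ maximalIdeal P)
    (hq : ((ringChar (ResidueField S) : ℕ) : S × P) = 0 ∨ ((ringChar (ResidueField S) : ℕ) : S × P) ∈ zts)
    (J J' : Ideal P) (hJ : J ≤ maximalIdeal P) (hle : J' ≤ J) (hJJ : ∀ x ∈ maximalIdeal P, ∀ y ∈ J, x * y ∈ J')
    (f : S →+* P ⧸ J) (hf : ∀ x ∈ zts, f x.1 = Ideal.Quotient.mk _ x.2) :
    ∃ f' : S →+* P ⧸ J', (Ideal.Quotient.factor hle).comp f' = f ∧
      ∀ x ∈ zts, f' x.1 = Ideal.Quotient.mk _ x.2 := by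
  let E : Subring (S × P ⧸ J') := RingHom.eqLocus (f.comp (RingHom.fst _ _))
    ((Ideal.Quotient.factor hle).comp (RingHom.snd _ _))
  have hE : ∀ x, x ∈ E ↔ f x.1 = Ideal.Quotient.factor hle x.2 := fun x => Iff.rfl
  let π : E →+* S := (RingHom.fst _ _).comp E.subtype
  have hker : ∀ a : E, π a = 0 → ∃ y ∈ J, a.1 = (0, Ideal.Quotient.mk _ y) := by
    intro a ha
    obtain ⟨⟨a, b⟩, hab⟩ := a
    obtain rfl : a = 0 := ha
    obtain ⟨b, rfl⟩ := Ideal.Quotient.mk_surjective b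
    refine ⟨b, ?_, rfl⟩
    rw [hE] at hab
    simp only [map_zero] at hab
    exact Ideal.Quotient.eq_zero_iff_mem.1 hab.symm
  let zt : List E := zts.pmap (fun x hx => ⟨(x.1, Ideal.Quotient.mk _ x.2), hx⟩) (fun x hx => by
    rw [hE]; exact hf x hx)
  have hmap : zt.map π = zts.map Prod.fst := by
    rw [List.map_pmap]
    exact List.pmap_eq_map _
  have hmem : ∀ y ∈ zt, ∃ x ∈ zts, y.1 = (x.1, Ideal.Quotient.mk _ x.2) := by
    intro y hy
    obtain ⟨x, hx, rfl⟩ := List.mem_pmap.1 hy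
    exact ⟨x, hx, rfl⟩
  have hmem' : ∀ x ∈ zts, ∃ y ∈ zt, y.1 = (x.1, Ideal.Quotient.mk _ x.2) := by
    intro x hx
    exact ⟨_, List.mem_pmap.2 ⟨x, hx, rfl⟩, rfl⟩
  have key : ∃ s : S →+* E, (∀ a, π (s a) = a) ∧ ∀ x ∈ zt, s (π x) = x := by
    refine lift_list (k := ResidueField S) zt.length E S π ?_ ?_ zt rfl ?_ (by rwa [hmap])
      (residue S) residue_surjective (by rw [ker_residue, hmap, hgen]) ?_
    · intro a
      obtain ⟨b, hb⟩ := Ideal.Quotient.mk_surjective (f a)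
      exact ⟨⟨(a, Ideal.Quotient.mk _ b), by rw [hE]; exact hb.symm⟩, rfl⟩
    · intro a b ha hb
      obtain ⟨y, hy, hay⟩ := hker a ha
      obtain ⟨z, hz, hbz⟩ := hker b hb
      apply Subtype.ext
      rw [Subring.coe_mul, hay, hbz, Prod.mk_mul_mk, ← map_mul, mul_zero,
        Ideal.Quotient.eq_zero_iff_mem.2 (hJJ y (hJ hy) z hz)]
      rfl
    · intro x hx a ha
      obtain ⟨y, hy, hay⟩ := hker a ha
      obtain ⟨z, hz, hbz⟩ := hmem x hx
      apply Subtype.ext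
      rw [Subring.coe_mul, hay, hbz, Prod.mk_mul_mk, ← map_mul, mul_zero,
        Ideal.Quotient.eq_zero_iff_mem.2 (hJJ _ (ht z hz) y hy)]
      rfl
    · rcases hq with h | h
      · have h1 : ((ringChar (ResidueField S) : ℕ) : E) = 0 := by
          apply Subtype.ext
          have h2 := congrArg Prod.fst h
          have h3 := congrArg (fun x : S × P => Ideal.Quotient.mk J' x.2) h
          simp at h2 h3
          simp [Prod.ext_iff, h2, h3]
        rw [h1]; exact Ideal.zero_mem _
      · obtain ⟨y, hy, hyx⟩ := hmem' _ h
        have h1 : ((ringChar (ResidueField S) : ℕ) : E) = y := by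
          apply Subtype.ext
          rw [hyx]
          simp [Prod.ext_iff]
        rw [h1]
        exact Ideal.subset_span hy
  obtain ⟨s, hs, hs'⟩ := key
  refine ⟨(RingHom.snd _ _).comp (E.subtype.comp s), ?_, ?_⟩
  · ext a
    have := (hE _).1 (s a).2
    refine this.symm.trans ?_
    exact congrArg f (hs a)
  · intro x hx
    obtain ⟨y, hy, hyx⟩ := hmem' x hx
    have := hs' y hy
    have h2 : π y = x.1 := congrArg Prod.fst hyx
    rw [h2] at this
    change (s x.1).1.2 = _
    rw [this, hyx]

lemma exists_phi {S P : Type} [CommRing S] [IsLocalRing S] [CommRing P] [IsLocalRing P] [IsNoetherianRing P]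
    [IsAdicComplete (maximalIdeal P) P] (ι : S →+* P) (I : Ideal P) (hI : I ≤ maximalIdeal P)
    (zts : List (S × P)) (hreg : RingTheory.Sequence.IsWeaklyRegular S (zts.map Prod.fst))
    (hgen : Ideal.ofList (zts.map Prod.fst) = maximalIdeal S)
    (ht : ∀ x ∈ zts, x.2 ∈ maximalIdeal P) (hι : ∀ x ∈ zts, ι x.1 - x.2 ∈ I)
    (hq : ((ringChar (ResidueField S) : ℕ) : S × P) = 0 ∨ ((ringChar (ResidueField S) : ℕ) : S × P) ∈ zts) :
    ∃ φ : S →+* P, (∀ x ∈ zts, φ x.1 = x.2) ∧ ∀ s, φ s - ι s ∈ I := by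
  obtain ⟨J, hJ0, hJle, hJI, hJm, hJs⟩ : ∃ J : ℕ → Ideal P, J 0 = I ∧ (∀ n, J (n+1) ≤ J n) ∧
      (∀ n, J n ≤ I) ∧ (∀ n, J n ≤ (maximalIdeal P)^n) ∧
      ∀ n, ∀ x ∈ maximalIdeal P, ∀ y ∈ J n, x * y ∈ J (n+1) := by
    refine ⟨fun n => I * (maximalIdeal P)^n, by simp,
      fun n => Ideal.mul_mono_right (Ideal.pow_le_pow_right n.le_succ), fun n => Ideal.mul_le_left,
      fun n => Ideal.mul_le_right, fun n x hx y hy => ?_⟩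
    have : y * x ∈ I * (maximalIdeal P)^n * maximalIdeal P := Ideal.mul_mem_mul hy hx
    rw [mul_assoc, ← pow_succ] at this
    rwa [mul_comm]
  have step : ∀ n (f : {f : S →+* P ⧸ J n // ∀ x ∈ zts, f x.1 = Ideal.Quotient.mk _ x.2}),
      ∃ f' : {f : S →+* P ⧸ J (n+1) // ∀ x ∈ zts, f x.1 = Ideal.Quotient.mk _ x.2},
      (Ideal.Quotient.factor (hJle n)).comp f'.1 = f.1 := by
    rintro n ⟨f, hf⟩
    obtain ⟨f', h1, h2⟩ := lift_step zts hreg hgen ht hq (J n) (J (n+1)) ((hJI n).trans hI) (hJle n)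
      (hJs n) f hf
    exact ⟨⟨f', h2⟩, h1⟩
  choose g hg using step
  obtain ⟨F, hF0, hF⟩ : ∃ F : (n : ℕ) → {f : S →+* P ⧸ J n // ∀ x ∈ zts, f x.1 = Ideal.Quotient.mk _ x.2},
      (∀ s, (F 0).1 s = Ideal.Quotient.mk (J 0) (ι s)) ∧
      ∀ n, (Ideal.Quotient.factor (hJle n)).comp (F (n+1)).1 = (F n).1 := by
    have h0 : ∀ x ∈ zts, ((Ideal.Quotient.mk (J 0)).comp ι) x.1 = Ideal.Quotient.mk _ x.2 := by
      intro x hx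
      rw [RingHom.comp_apply, Ideal.Quotient.eq]
      exact hJ0.symm ▸ hι x hx
    let F : (n : ℕ) → {f : S →+* P ⧸ J n // ∀ x ∈ zts, f x.1 = Ideal.Quotient.mk _ x.2} :=
      fun n => Nat.rec ⟨(Ideal.Quotient.mk (J 0)).comp ι, h0⟩ (fun n f => g n f) n
    exact ⟨F, fun s => rfl, fun n => hg n (F n)⟩
  have hFI : ∀ n s, Ideal.Quotient.factor (hJI n) ((F n).1 s) = Ideal.Quotient.mk I (ι s) := by
    intro n s
    induction n with
    | zero => rw [hF0]; rfl
    | succ n ih =>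
      rw [← ih, ← hF n, RingHom.comp_apply]
      obtain ⟨y, hy⟩ := Ideal.Quotient.mk_surjective ((F (n+1)).1 s)
      rw [← hy]; rfl
  let f : (n : ℕ) → S →+* P ⧸ (maximalIdeal P)^n := fun n => (Ideal.Quotient.factor (hJm n)).comp (F n).1
  have hfs : ∀ n, (Ideal.Quotient.factorPow (maximalIdeal P) n.le_succ).comp (f (n+1)) = f n := by
    intro n
    ext s
    simp only [f]
    rw [← hF n]
    simp only [RingHom.comp_apply]
    obtain ⟨y, hy⟩ := Ideal.Quotient.mk_surjective ((F (n+1)).1 s)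
    rw [← hy]; rfl
  have hf : ∀ {k l : ℕ} (hle : k ≤ l), (Ideal.Quotient.factorPow (maximalIdeal P) hle).comp (f l) = f k := by
    intro k l hle
    induction l, hle using Nat.le_induction with
    | base =>
      ext s
      obtain ⟨y, hy⟩ := Ideal.Quotient.mk_surjective (f k s)
      rw [RingHom.comp_apply, ← hy]; rfl
    | succ l hkl ih =>
      rw [← ih, ← hfs l]
      ext s
      obtain ⟨y, hy⟩ := Ideal.Quotient.mk_surjective (f (l+1) s)
      simp only [RingHom.comp_apply]
      rw [← hy]; rfl
  obtain ⟨φ, hφ⟩ : ∃ φ : S →+* P, ∀ n s, Ideal.Quotient.mk _ (φ s) = f n s := 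
    ⟨IsAdicComplete.liftRingHom (maximalIdeal P) f hf, fun n s =>
      IsAdicComplete.mk_liftRingHom (maximalIdeal P) f hf n s⟩
  refine ⟨φ, ?_, ?_⟩
  · intro x hx
    rw [← sub_eq_zero]
    refine IsHausdorff.haus (I := maximalIdeal P) inferInstance _ fun n => ?_
    rw [SModEq.zero]
    have h1 := hφ n x.1
    simp only [f, RingHom.comp_apply, (F n).2 x hx] at h1
    have h2 := Ideal.Quotient.eq.1 (h1.trans (Ideal.Quotient.factor_mk (hJm n) _))
    simpa using h2
  · intro s
    have hH : IsHausdorff (maximalIdeal P) (P ⧸ I) := IsHausdorff.of_isLocalRing _ _ (maximalIdeal.isMaximal P).ne_top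
    rw [← Ideal.Quotient.eq_zero_iff_mem]
    refine hH.haus _ fun n => ?_
    rw [SModEq.zero]
    obtain ⟨y, hy⟩ := Ideal.Quotient.mk_surjective ((F n).1 s)
    have h1 := hφ n s
    simp only [f, RingHom.comp_apply, ← hy] at h1
    have h2 := Ideal.Quotient.eq.1 (h1.trans (Ideal.Quotient.factor_mk (hJm n) _))
    have h3 := hFI n s
    rw [← hy] at h3
    have h4 := Ideal.Quotient.eq.1 ((Ideal.Quotient.factor_mk (hJI n) _).symm.trans h3)
    have h5 : Ideal.Quotient.mk I (φ s - ι s) = (φ s - y) • (1 : P ⧸ I) := by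
      rw [Algebra.smul_def, mul_one]
      refine Ideal.Quotient.eq.2 ?_
      convert h4 using 1; ring
    rw [h5]
    exact Submodule.smul_mem_smul h2 trivial
end Lifting2

section Poly
open Function TensorProduct Polynomial RingTheory.Sequence Pointwise

lemma poly_inj {A Q : Type} [CommRing A] [AddCommGroup Q] [Module A Q] (v : A) :
    IsSMulRegular (A[X] ⊗[A] Q) (X - C v) := by
  let f : A[X] →ₗ[A] A[X] := LinearMap.mulLeft A (X - C v)
  let g : A[X] →ₗ[A] A := (aeval v : A[X] →ₐ[A] A).toLinearMap
  have hfi : Injective f := by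
    intro a b hab
    exact (monic_X_sub_C v).isRegular.1 hab
  have hex : Exact f g := by
    intro y
    have h1 : g y = eval v y := coe_aeval_eq_eval v ▸ rfl
    rw [h1, ← IsRoot.def, ← dvd_iff_isRoot]
    constructor
    · rintro ⟨z, rfl⟩; exact ⟨z, rfl⟩
    · rintro ⟨z, rfl⟩; exact ⟨z, rfl⟩
  obtain ⟨-, l, hl⟩ := (hex.split_tfae'.out 0 1 rfl rfl).1 ⟨hfi, Algebra.linearMap A A[X], by
    ext; simp [g]⟩
  have hinj : Injective (LinearMap.rTensor Q f) := by
    have : ∀ x, LinearMap.rTensor Q l (LinearMap.rTensor Q f x) = x := by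
      intro x
      rw [← LinearMap.comp_apply, ← LinearMap.rTensor_comp, hl, LinearMap.rTensor_id]; rfl
    exact LeftInverse.injective this
  have heq : ∀ x, (X - C v) • x = LinearMap.rTensor Q f x := by
    intro x
    induction x with
    | zero => simp
    | add x y hx hy => rw [smul_add, hx, hy, map_add]
    | tmul a b => rw [smul_tmul', LinearMap.rTensor_tmul]; rfl
  intro x y hxy
  apply hinj
  rw [← heq, ← heq]; exact hxy

lemma poly_quot {A Q : Type} [CommRing A] [AddCommGroup Q] [Module A Q] (v : A) :
    ∃ e : QuotSMulTop (X - C v) (A[X] ⊗[A] Q) ≃+ Q, ∀ (a : A) x, e (C a • x) = a • e x := by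
  let ψ : A[X] ⊗[A] Q →ₗ[A] Q := TensorProduct.lift
    ((LinearMap.lsmul A Q).comp (aeval v : A[X] →ₐ[A] A).toLinearMap)
  have hψ : ∀ (f : A[X]) q, ψ (f ⊗ₜ q) = (eval v f) • q := fun f q => by
    simp [ψ, coe_aeval_eq_eval]
  have hψ2 : ∀ (f : A[X]) x, ψ (f • x) = eval v f • ψ x := by
    intro f x
    induction x with
    | zero => simp
    | add x y hx hy => rw [smul_add, map_add, map_add, hx, hy, smul_add]
    | tmul a b => rw [smul_tmul', hψ, hψ, smul_eq_mul, eval_mul, mul_smul]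
  let _ : Module A[X] Q := Module.compHom Q (evalRingHom v)
  have hQ : ∀ (f : A[X]) (q : Q), f • q = eval v f • q := fun f q => rfl
  let ψ' : A[X] ⊗[A] Q →ₗ[A[X]] Q := 
    { toFun := ψ, map_add' := map_add ψ, map_smul' := hψ2 }
  have hψ's : Surjective ψ' := fun q => ⟨1 ⊗ₜ q, by
    change ψ _ = _
    rw [hψ]; simp⟩
  have hmem : ∀ x, x - 1 ⊗ₜ ψ x ∈ (X - C v) • (⊤ : Submodule A[X] (A[X] ⊗[A] Q)) := by
    intro x
    induction x with
    | zero => simp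
    | add x y hx hy =>
      have := add_mem hx hy
      rw [map_add, tmul_add]
      convert this using 1
      abel
    | tmul f q =>
      obtain ⟨g, hg⟩ := X_sub_C_dvd_sub_C_eval (a := v) (p := f)
      rw [hψ, tmul_smul, smul_tmul', ← sub_tmul]
      rw [show f - eval v f • (1 : A[X]) = (X - C v) • g by
        rw [smul_eq_mul, ← hg, smul_eq_C_mul, mul_one], ← smul_tmul']
      exact Submodule.smul_mem_pointwise_smul _ _ _ trivial
  have hker : LinearMap.ker ψ' = (X - C v) • (⊤ : Submodule A[X] (A[X] ⊗[A] Q)) := by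
    ext x
    constructor
    · intro hx
      have := hmem x
      rwa [show ψ x = 0 from hx, tmul_zero, sub_zero] at this
    · intro hx
      obtain ⟨y, -, rfl⟩ := (Submodule.mem_smul_pointwise_iff_exists _ _ _).1 hx
      rw [LinearMap.mem_ker, map_smul, hQ]; simp
  let e : QuotSMulTop (X - C v) (A[X] ⊗[A] Q) ≃ₗ[A[X]] Q :=
    (Submodule.quotEquivOfEq _ _ hker.symm).trans (ψ'.quotKerEquivOfSurjective hψ's)
  refine ⟨e.toAddEquiv, fun a x => ?_⟩
  refine (e.map_smul (C a) x).trans ?_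
  rw [hQ, eval_C]; rfl

lemma poly_reg {A Q : Type} [CommRing A] [AddCommGroup Q] [Module A Q] (v : A) (l : List A)
    (hl : IsWeaklyRegular Q l) : IsWeaklyRegular (A[X] ⊗[A] Q) ((X - C v) :: l.map C) := by
  rw [isWeaklyRegular_cons_iff]
  refine ⟨poly_inj v, ?_⟩
  obtain ⟨e, he⟩ := poly_quot (Q := Q) v
  rw [AddEquiv.isWeaklyRegular_congr (e := e) (bs := l)]
  · exact hl
  · rw [List.forall₂_map_left_iff, List.forall₂_same]
    intro a _ x
    exact he a x
end Poly

section Poly2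
open Function TensorProduct Polynomial RingTheory.Sequence Pointwise

/-- the list `u_i - v_i` -/
def dl {S A : Type} [CommRing S] [CommRing A] [Algebra S A] (us : List A) (vs : List S) : List A :=
  List.zipWith (fun u v => u - algebraMap S A v) us vs

lemma exists_poly {S : Type} [CommRing S] [IsNoetherianRing S] (d : ℕ) :
    ∃ (A : Type) (_ : CommRing A) (_ : IsNoetherianRing A) (_ : Algebra S A) (us : List A),
      us.length = d ∧ Module.Flat S A ∧ ∀ vs : List S, vs.length = d →
        (∃ ev : A →ₐ[S] S, RingHom.ker ev = Ideal.ofList (dl us vs)) ∧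
        ∀ (N : Type) [AddCommGroup N] [Module S N], IsWeaklyRegular (A ⊗[S] N) (dl us vs) := by
  induction d with
  | zero =>
    refine ⟨S, inferInstance, inferInstance, inferInstance, [], rfl, inferInstance, fun vs _ => ⟨?_, ?_⟩⟩
    · refine ⟨AlgHom.id S S, ?_⟩
      rw [show dl ([] : List S) vs = [] from rfl, Ideal.ofList_nil, ← RingHom.injective_iff_ker_eq_bot]
      exact injective_id
    · intro N _ _
      rw [show dl ([] : List S) vs = [] from rfl]
      exact IsWeaklyRegular.nil _ _
  | succ d ih =>
    obtain ⟨A, _, _, _, us, hus, hflat, H⟩ := ih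
    refine ⟨A[X], inferInstance, inferInstance, inferInstance, X :: us.map C, by simp [hus],
      Module.Flat.trans S A A[X], ?_⟩
    intro vs hvs
    obtain ⟨v, vs, rfl⟩ := List.exists_cons_of_length_eq_add_one hvs
    obtain ⟨⟨ev, hev⟩, hN⟩ := H vs (by simpa using hvs)
    have hdl : dl (X :: us.map C) (v :: vs) = (X - C (algebraMap S A v)) :: (dl us vs).map C := by
      simp only [dl, List.zipWith_cons_cons, List.map_zipWith, List.zipWith_map_left, map_sub]
      rfl
    rw [hdl]
    refine ⟨?_, ?_⟩
    · refine ⟨ev.comp ((aeval (algebraMap S A v) : A[X] →ₐ[A] A).restrictScalars S), ?_⟩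
      have h1 : ∀ f : A[X], (ev.comp ((aeval (algebraMap S A v) : A[X] →ₐ[A] A).restrictScalars S)) f
          = ev (Polynomial.eval (algebraMap S A v) f) := fun f => by
        rw [← coe_aeval_eq_eval]; rfl
      ext f
      rw [RingHom.mem_ker, Ideal.ofList_cons]
      refine (Eq.congr (h1 f) rfl).trans ?_
      rw [show ev (Polynomial.eval (algebraMap S A v) f) = 0 ↔ _ from RingHom.mem_ker (f := ev).symm, hev]
      obtain ⟨g, hg⟩ := X_sub_C_dvd_sub_C_eval (a := algebraMap S A v) (p := f)
      constructor
      · intro h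
        have h2 := Ideal.mem_map_of_mem C h
        rw [Ideal.map_ofList] at h2
        have h3 : f = g * (X - C (algebraMap S A v)) + C (Polynomial.eval (algebraMap S A v) f) := by
          rw [mul_comm, ← hg]; ring
        rw [h3]
        exact add_mem (Ideal.mem_sup_left (Ideal.mem_span_singleton'.2 ⟨g, rfl⟩)) (Ideal.mem_sup_right h2)
      · intro h
        have h2 : Ideal.span {X - C (algebraMap S A v)} ⊔ Ideal.ofList ((dl us vs).map C) ≤
            (Ideal.ofList (dl us vs)).comap (evalRingHom (algebraMap S A v)) := by
          rw [sup_le_iff, Ideal.span_singleton_le_iff_mem, ← Ideal.map_ofList, Ideal.map_le_iff_le_comap,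
            Ideal.comap_comap]
          refine ⟨by simp, ?_⟩
          intro x hx
          simpa using hx
        exact h2 h
    · intro N _ _
      have h1 := poly_reg (A := A) (Q := A ⊗[S] N) (algebraMap S A v) (dl us vs) (hN N)
      rwa [LinearEquiv.isWeaklyRegular_congr 
        (TensorProduct.AlgebraTensorModule.cancelBaseChange S A A[X] A[X] N)] at h1

lemma append_reg {S A : Type} [CommRing S] [CommRing A] [Algebra S A] [Module.Flat S A] (us : List A)
    (H : ∀ (N : Type) [AddCommGroup N] [Module S N], IsWeaklyRegular (A ⊗[S] N) us) (ps : List S) :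
    ∀ (N : Type) [AddCommGroup N] [Module S N], IsWeaklyRegular N ps →
      IsWeaklyRegular (A ⊗[S] N) (ps.map (algebraMap S A) ++ us) := by
  induction ps with
  | nil => intro N _ _ _; exact H N
  | cons p ps ih =>
    intro N _ _ h
    rw [isWeaklyRegular_cons_iff] at h
    rw [List.map_cons, List.cons_append, isWeaklyRegular_cons_iff]
    refine ⟨?_, ?_⟩
    · have h1 : IsSMulRegular (A ⊗[S] N) p := IsSMulRegular.lTensor A h.1
      intro x y hxy
      apply h1
      simpa using hxy
    · exact (LinearEquiv.isWeaklyRegular_congr (QuotSMulTop.algebraMapTensorEquivTensorQuotSMulTop p N A) _).2 (ih _ h.2)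

lemma flat_quot {S A P : Type} [CommRing S] [CommRing A] [Algebra S A] [CommRing P] [Algebra A P] [Algebra S P]
    [IsScalarTower S A P] [Module.Flat A P] (ev : A →ₐ[S] S) (J : Ideal A) (hJ : RingHom.ker ev = J)
    (K : Ideal P) (hK : K = J.map (algebraMap A P)) : Module.Flat S (P ⧸ K) := by
  subst hK
  have hb : Bijective (algebraMap S (A ⧸ J)) := by
    constructor
    · rw [injective_iff_map_eq_zero]
      intro s hs
      rw [IsScalarTower.algebraMap_apply S A (A ⧸ J), Ideal.Quotient.algebraMap_eq, 
        Ideal.Quotient.eq_zero_iff_mem, ← hJ, RingHom.mem_ker, AlgHom.commutes] at hs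
      exact hs
    · intro y
      obtain ⟨y, rfl⟩ := Ideal.Quotient.mk_surjective y
      refine ⟨ev y, ?_⟩
      rw [IsScalarTower.algebraMap_apply S A (A ⧸ J), Ideal.Quotient.algebraMap_eq, 
        Ideal.Quotient.eq, ← hJ, RingHom.mem_ker, map_sub, AlgHom.commutes]
      exact sub_self _
  let g : A ⧸ J →+* P ⧸ J.map (algebraMap A P) := Ideal.quotientMap _ (algebraMap A P) Ideal.le_comap_map
  have hg : g.Flat := by
    let _ : Algebra (A ⧸ J) (P ⧸ J.map (algebraMap A P)) := g.toAlgebra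
    have : IsScalarTower A (A ⧸ J) (P ⧸ J.map (algebraMap A P)) := IsScalarTower.of_algebraMap_eq fun x => rfl
    have e1 : (A ⧸ J) ⊗[A] P ≃ₗ[A] P ⧸ J.map (algebraMap A P) :=
      (TensorProduct.comm _ _ _).trans
      ((Algebra.TensorProduct.quotIdealMapEquivTensorQuot P J).symm.toLinearEquiv.restrictScalars A)
    have e2 := LinearEquiv.extendScalarsOfSurjective (S := A ⧸ J) (Ideal.Quotient.mk_surjective) e1
    have : Module.Flat (A ⧸ J) (P ⧸ J.map (algebraMap A P)) := Module.Flat.of_linearEquiv e2.symm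
    exact this
  have h := RingHom.Flat.comp (RingHom.Flat.of_bijective hb) hg
  have h2 : g.comp (algebraMap S (A ⧸ J)) = algebraMap S (P ⧸ J.map (algebraMap A P)) := by
    ext s
    change Ideal.Quotient.mk _ (algebraMap A P (algebraMap S A s)) = Ideal.Quotient.mk _ (algebraMap S P s)
    rw [← IsScalarTower.algebraMap_apply]
  rw [h2] at h
  exact RingHom.flat_algebraMap_iff.1 h
end Poly2

section Data
open Function TensorProduct RingTheory.Sequence Pointwise

lemma dl_zero {S A : Type} [CommRing S] [CommRing A] [Algebra S A] (us : List A) :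
    dl us (List.replicate us.length (0 : S)) = us := by
  induction us with
  | nil => rfl
  | cons u us ih =>
    rw [List.length_cons, List.replicate_succ]
    change (u - algebraMap S A 0) :: dl us _ = _
    rw [ih, map_zero, sub_zero]

lemma dl_mem_zip {S A P : Type} [CommRing S] [CommRing A] [Algebra S A] [CommRing P] (g : A →+* P)
    (us : List A) : ∀ (ws : List S), ∀ x ∈ List.zip ws (us.map g), ∃ y ∈ dl us ws,
      g (algebraMap S A x.1) - x.2 = - g y := by
  induction us with
  | nil => intro ws x hx; simp at hx
  | cons u us ih =>
    intro ws x hx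
    cases ws with
    | nil => simp at hx
    | cons w ws =>
      rw [List.map_cons, List.zip_cons_cons, List.mem_cons] at hx
      rcases hx with rfl | hx
      · refine ⟨u - algebraMap S A w, List.mem_cons_self, ?_⟩
        rw [map_sub]; ring
      · obtain ⟨y, hy, h⟩ := ih ws x hx
        exact ⟨y, List.mem_cons_of_mem _ hy, h⟩

lemma dl_mem {S A : Type} [CommRing S] [CommRing A] [Algebra S A]
    (us : List A) : ∀ (ws : List S), ∀ y ∈ dl us ws, ∃ u ∈ us, ∃ w ∈ ws, y = u - algebraMap S A w := by
  induction us with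
  | nil => intro ws x hx; simp [dl] at hx
  | cons u us ih =>
    intro ws x hx
    cases ws with
    | nil => simp [dl] at hx
    | cons w ws =>
      have hx : x ∈ (u - algebraMap S A w) :: dl us ws := hx
      rw [List.mem_cons] at hx
      rcases hx with rfl | hx
      · exact ⟨u, by simp, w, by simp, rfl⟩
      · obtain ⟨a, ha, b, hb, h⟩ := ih ws x hx
        exact ⟨a, by simp [ha], b, by simp [hb], h⟩

lemma exists_data {S : Type} [CommRing S] [IsNoetherianRing S] [IsLocalRing S] (ws : List S)
    (hws : ∀ w ∈ ws, w ∈ maximalIdeal S) :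
    ∃ (P : Type) (_ : CommRing P) (_ : IsNoetherianRing P) (_ : IsLocalRing P) (_ : Algebra S P)
      (us ds : List P), Module.Flat S P ∧ IsAdicComplete (maximalIdeal P) P ∧
      us.length = ws.length ∧ (∀ s, algebraMap S P s ∈ maximalIdeal P ↔ s ∈ maximalIdeal S) ∧
      (∀ u ∈ us, u ∈ maximalIdeal P) ∧ IsWeaklyRegular P ds ∧ Ideal.ofList ds ≤ maximalIdeal P ∧
      (∀ x ∈ List.zip ws us, algebraMap S P x.1 - x.2 ∈ Ideal.ofList ds) ∧
      Module.Flat S (P ⧸ Ideal.ofList ds) ∧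
      ∀ (ps : List S) (N : Type) [AddCommGroup N] [Module S N], IsWeaklyRegular N ps →
        IsWeaklyRegular (P ⊗[S] N) (ps.map (algebraMap S P) ++ us) := by
  obtain ⟨A, _, _, _, us, hlen, hflat, H⟩ := exists_poly (S := S) ws.length
  obtain ⟨⟨ev0, hev0⟩, hreg0⟩ := H (List.replicate us.length 0) (by simp [hlen])
  rw [dl_zero] at hev0
  simp only [dl_zero] at hreg0
  obtain ⟨⟨ev, hev⟩, hreg⟩ := H ws rfl
  have hsurj : Surjective ev0 := fun s => ⟨algebraMap S A s, ev0.commutes s⟩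
  have hMax : (Ideal.comap ev0 (maximalIdeal S)).IsMaximal := Ideal.comap_isMaximal_of_surjective ev0 hsurj
  obtain ⟨P, _, _, _, _, hAP, hmP, hcomp, -, hmem⟩ := exists_compl (Ideal.comap ev0 (maximalIdeal S))
  let _ : Algebra S P := ((algebraMap A P).comp (algebraMap S A)).toAlgebra
  have : IsScalarTower S A P := IsScalarTower.of_algebraMap_eq fun x => rfl
  have hι : ∀ s, algebraMap S P s ∈ maximalIdeal P ↔ s ∈ maximalIdeal S := by
    intro s
    rw [IsScalarTower.algebraMap_apply S A P, hmem, Ideal.mem_comap, AlgHom.commutes]; rfl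
  have hu : ∀ u ∈ us, algebraMap A P u ∈ maximalIdeal P := by
    intro u hu
    have h1 : u ∈ RingHom.ker ev0 := by rw [hev0]; exact Ideal.subset_span hu
    rw [hmem, Ideal.mem_comap, RingHom.mem_ker.1 h1]
    exact Ideal.zero_mem _
  refine ⟨P, inferInstance, inferInstance, inferInstance, inferInstance, us.map (algebraMap A P),
    (dl us ws).map (algebraMap A P), Module.Flat.trans S A P, hcomp, by simp [hlen], hι, ?_, ?_, ?_, ?_, ?_, ?_⟩
  · intro u h
    obtain ⟨u, h', rfl⟩ := List.mem_map.1 h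
    exact hu u h'
  · have h1 := hreg S
    rw [LinearEquiv.isWeaklyRegular_congr (TensorProduct.AlgebraTensorModule.rid S A A)] at h1
    exact h1.of_flat
  · refine Ideal.span_le.2 fun y hy => ?_
    obtain ⟨y, hy', rfl⟩ := List.mem_map.1 hy
    obtain ⟨u, h1, w, h2, rfl⟩ := dl_mem us ws y hy'
    rw [map_sub]
    exact sub_mem (hu u h1) ((hι w).2 (hws w h2))
  · intro x hx
    obtain ⟨y, hy, h⟩ := dl_mem_zip (algebraMap A P) us ws x hx
    refine (congrArg (· ∈ _) h).mpr ?_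
    exact neg_mem (Ideal.subset_span (List.mem_map_of_mem hy))
  · exact flat_quot ev _ hev _ (Ideal.map_ofList _ _).symm
  · intro ps N _ _ hps
    have h1 := append_reg us (fun N _ _ => hreg0 N) ps N hps
    have h2 := h1.of_flat_of_isBaseChange (TensorProduct.isBaseChange A (A ⊗[S] N) P)
    rw [LinearEquiv.isWeaklyRegular_congr 
        (TensorProduct.AlgebraTensorModule.cancelBaseChange S A P P N), List.map_append, List.map_map] at h2
    exact h2
end Data

section Diag
open Function TensorProduct RingTheory.Sequence Pointwise

lemma exists_diag_core {S : Type} [CommRing S] [IsNoetherianRing S] [IsLocalRing S] (ps ws : List S)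
    (hgen : Ideal.ofList (ps ++ ws) = maximalIdeal S) (hreg : IsWeaklyRegular S (ps ++ ws))
    (hps : (ps = [] ∧ ((ringChar (ResidueField S) : ℕ) : S) = 0) ∨
      ps = [((ringChar (ResidueField S) : ℕ) : S)]) :
    ∃ (D : Type) (_ : CommRing D) (_ : IsNoetherianRing D) (_ : Algebra S D),
      Module.FaithfullyFlat S D ∧ DiagGood S D := by
  have hmem : ∀ x ∈ ps ++ ws, x ∈ maximalIdeal S := fun x hx => hgen ▸ Ideal.subset_span hx
  obtain ⟨P, _, _, _, _, us, ds, hflat, hcomp, hlen, hι, hus, hds, hdsm, hzip, hflD, hN⟩ :=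
    exists_data ws (fun w hw => hmem w (by simp [hw]))
  let zts : List (S × P) := ps.map (fun x => (x, algebraMap S P x)) ++ List.zip ws us
  have hfst : zts.map Prod.fst = ps ++ ws := by
    simp only [zts, List.map_append, List.map_map]
    rw [List.map_fst_zip hlen.ge]
    congr 1
    exact List.map_id ps
  have hsnd : zts.map Prod.snd = ps.map (algebraMap S P) ++ us := by
    simp only [zts, List.map_append, List.map_map]
    rw [List.map_snd_zip hlen.le]
    rfl
  obtain ⟨φ, hφ, hφι⟩ := exists_phi (algebraMap S P) (Ideal.ofList ds) hdsm zts (by rwa [hfst])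
    (by rwa [hfst]) (by
      intro x hx
      rcases List.mem_append.1 hx with h | h
      · obtain ⟨y, hy, rfl⟩ := List.mem_map.1 h
        exact (hι y).2 (hmem y (by simp [hy]))
      · exact hus _ (List.of_mem_zip (show (x.1, x.2) ∈ _ from h)).2) (by
      intro x hx
      rcases List.mem_append.1 hx with h | h
      · obtain ⟨y, hy, rfl⟩ := List.mem_map.1 h
        simp
      · exact hzip x h) (by
      rcases hps with ⟨-, h⟩ | h
      · left
        have h2 : ((ringChar (ResidueField S) : ℕ) : P) = 0 := by
          rw [← map_natCast (algebraMap S P), h, map_zero]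
        ext
        · simpa using h
        · simpa using h2
      · right
        apply List.mem_append_left
        rw [h]
        simp [Prod.ext_iff])
  have hφz : (ps ++ ws).map φ = ps.map (algebraMap S P) ++ us := by
    rw [← hfst, ← hsnd, List.map_map]
    exact List.map_congr_left hφ
  have hφm : ∀ x ∈ maximalIdeal S, φ x ∈ maximalIdeal P := by
    intro x hx
    have h1 := (hι x).2 hx
    have h2 := add_mem (hdsm (hφι x)) h1
    rwa [sub_add_cancel] at h2
  obtain ⟨S2, _, ⟨σ⟩⟩ : ∃ (S2 : Type) (_ : CommRing S2), Nonempty (S ≃+* S2) :=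
    ⟨S, inferInstance, ⟨RingEquiv.refl S⟩⟩
  have : IsLocalRing S2 := σ.isLocalRing
  have : IsNoetherianRing S2 := isNoetherianRing_of_ringEquiv S σ
  let _ : Algebra S2 S := σ.symm.toRingHom.toAlgebra
  let _ : Algebra S2 P := (φ.comp σ.symm.toRingHom).toAlgebra
  have hm2 : Ideal.map σ (maximalIdeal S) = maximalIdeal S2 := by
    exact IsLocalRing.map_maximalIdeal_of_surjective σ.toRingHom σ.surjective
  have hgen2 : Ideal.ofList ((ps ++ ws).map σ) = maximalIdeal S2 := by
    rw [← hm2, ← hgen]; exact (Ideal.map_ofList σ.toRingHom (ps ++ ws)).symm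
  have hreg2 : IsWeaklyRegular S2 ((ps ++ ws).map σ) := by
    refine (AddEquiv.isWeaklyRegular_congr (e := σ.toAddEquiv) ?_).1 hreg
    rw [List.forall₂_map_right_iff, List.forall₂_same]
    intro a _ x
    exact map_mul σ a x
  have hloc2 : ∀ x ∈ maximalIdeal S2, algebraMap S2 P x ∈ maximalIdeal P := by
    intro x hx
    apply hφm
    rw [← hm2] at hx
    obtain ⟨y, hy, rfl⟩ := (Ideal.mem_map_of_equiv σ x).1 hx
    simpa using hy
  have hfl : ∀ (A : Type) [AddCommGroup A] [Module S A] [Module.Finite S A] (k : ℕ)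
      (u : A →ₗ[S] (Fin k → S)), Injective u → ∃ (V : Type) (_ : AddCommGroup V) (_ : Module P V)
        (_ : Module S2 V) (_ : IsScalarTower S2 P V), Nonempty (V ≃ₗ[P] P ⊗[S] A) ∧
        Module.Flat S2 V := by
    intro A _ _ _ k u hu
    have hA : IsWeaklyRegular A ps := by
      rcases hps with ⟨h, -⟩ | h
      · rw [h]; exact IsWeaklyRegular.nil _ _
      · rw [h] at hreg ⊢
        rw [isWeaklyRegular_singleton_iff]
        rw [List.singleton_append, isWeaklyRegular_cons_iff] at hreg
        exact IsSMulRegular.of_injective u hu (IsSMulRegular.pi fun _ => hreg.1)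
    have h1 := hN ps A hA
    rw [← hφz] at h1
    obtain ⟨V, _, _, hVf, ⟨e⟩⟩ : ∃ (V : Type) (_ : AddCommGroup V) (_ : Module P V) (_ : Module.Finite P V),
        Nonempty (V ≃ₗ[P] P ⊗[S] A) := ⟨P ⊗[S] A, inferInstance, inferInstance, inferInstance, ⟨LinearEquiv.refl _ _⟩⟩
    rw [← LinearEquiv.isWeaklyRegular_congr e] at h1
    let _ : Module S2 V := Module.compHom V (algebraMap S2 P)
    have : IsScalarTower S2 P V := IsScalarTower.of_algebraMap_smul fun r x => rfl
    refine ⟨V, inferInstance, inferInstance, inferInstance, inferInstance, ⟨e⟩, ?_⟩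
    refine flat_lemma (S := S2) (P := P) (V := V) hloc2 _ hgen2 hreg2 ?_
    rw [← isWeaklyRegular_map_algebraMap_iff P]
    rw [List.map_map]
    convert h1 using 2
    ext x
    exact congrArg φ (σ.symm_apply_apply x)
  have hflat2 : Module.Flat S2 P := by
    obtain ⟨V, _, _, _, _, ⟨e⟩, hV⟩ := hfl S 1 (LinearMap.pi fun _ => LinearMap.id) (fun a b h => congrFun h 0)
    let e2 : V ≃ₗ[P] P := e.trans (TensorProduct.AlgebraTensorModule.rid S P P)
    exact Module.Flat.of_linearEquiv (e2.symm.restrictScalars S2)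
  have hfl3 : Module.Flat S2 S := RingHom.flat_algebraMap_iff.1 (RingHom.Flat.of_bijective σ.symm.bijective)
  have hD : Nontrivial (P ⧸ Ideal.ofList ds) :=
    Ideal.Quotient.nontrivial_iff.2 fun h => (maximalIdeal.isMaximal P).ne_top (top_le_iff.1 (h ▸ hdsm))
  have hDl : IsLocalRing (P ⧸ Ideal.ofList ds) := IsLocalRing.of_surjective' (Ideal.Quotient.mk _) Ideal.Quotient.mk_surjective
  have hlh : IsLocalHom (algebraMap S (P ⧸ Ideal.ofList ds)) := by
    refine ⟨fun s hs => ?_⟩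
    by_contra hns
    have h1 : algebraMap S P s ∈ maximalIdeal P := (hι s).2 hns
    have hlm : IsLocalHom (Ideal.Quotient.mk (Ideal.ofList ds)) :=
      IsLocalHom.of_surjective _ Ideal.Quotient.mk_surjective
    exact h1 (isUnit_of_map_unit (Ideal.Quotient.mk (Ideal.ofList ds)) _ hs)
  refine ⟨P ⧸ Ideal.ofList ds, inferInstance, inferInstance, inferInstance, 
    Module.FaithfullyFlat.of_flat_of_isLocalHom, ?_⟩
  refine diagGood_of (S2 := S2) σ.symm.surjective ds hds ?_ hfl
  intro s
  exact hφι (σ.symm s)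

theorem exists_diag {S : Type} [CommRing S] [IsNoetherianRing S] [IsLocalRing S]
    (hS : ∃ s : Finset S, Ideal.span (s : Set S) = maximalIdeal S ∧
      (s.card : WithBot ℕ∞) = ringKrullDim S)
    (hun : ∀ p : ℕ, p.Prime → (p : S) ≠ 0 → (p : S) ∈ maximalIdeal S → (p : S) ∉ maximalIdeal S ^ 2) :
    ∃ (D : Type) (_ : CommRing D) (_ : IsNoetherianRing D) (_ : Algebra S D),
      Module.FaithfullyFlat S D ∧ DiagGood S D := by
  obtain ⟨-, ⟨zs, hz1, hz2⟩, h3⟩ := reg_gens hS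
  by_cases hq : ((ringChar (ResidueField S) : ℕ) : S) = 0
  · exact exists_diag_core [] zs hz1 hz2 (Or.inl ⟨rfl, hq⟩)
  · have hp : (ringChar (ResidueField S)).Prime := by
      rcases CharP.char_is_prime_or_zero (ResidueField S) (ringChar (ResidueField S)) with h | h
      · exact h
      · rw [h] at hq; simp at hq
    have hqm : ((ringChar (ResidueField S) : ℕ) : S) ∈ maximalIdeal S := by
      rw [← residue_eq_zero_iff, map_natCast]
      exact ringChar.Nat.cast_ringChar
    obtain ⟨ws, h4, h5⟩ := h3 _ hqm (hun _ hp hq hqm)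
    exact exists_diag_core [_] ws h4 h5 (Or.inr rfl)
end Diag

/-! ## Glue -/
section Glue
open Function

lemma exists_min_cover {R : Type} [CommRing R] [IsLocalRing R] (N : Type) [AddCommGroup N]
    [Module R N] [Module.Finite R N] :
    ∃ (q : ℕ) (g : (Fin q → R) →ₗ[R] N), Surjective g ∧
      (LinearMap.ker g : Submodule R (Fin q → R)) ≤ (maximalIdeal R) • ⊤ := by
  classical
  have hex : ∃ q : ℕ, ∃ g : (Fin q → R) →ₗ[R] N, Surjective g := Module.Finite.exists_fin' R N
  obtain ⟨g, hg⟩ := Nat.find_spec hex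
  have hmin : ∀ k, k < Nat.find hex → ¬ ∃ g : (Fin k → R) →ₗ[R] N, Surjective g :=
    fun k hk => Nat.find_min hex hk
  generalize Nat.find hex = q at g hg hmin
  refine ⟨q, g, hg, ?_⟩
  intro x hx
  by_cases h : ∀ i, x i ∈ maximalIdeal R
  · have hx2 : x = ∑ i, x i • (Pi.single i (1:R) : Fin q → R) := by
      conv_lhs => rw [pi_eq_sum_univ' x]
    rw [hx2]
    exact Submodule.sum_mem _ fun i _ => Submodule.smul_mem_smul (h i) trivial
  · exfalso
    push Not at h
    obtain ⟨i, hi⟩ := h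
    have hu : IsUnit (x i) := by
      by_contra h2
      exact hi ((mem_maximalIdeal _).2 h2)
    obtain ⟨u, hu⟩ := hu.exists_left_inv
    cases q with
    | zero => exact i.elim0
    | succ k =>
      refine hmin k (Nat.lt_succ_self k)
        ⟨Fintype.linearCombination R (fun j => g (Pi.single (i.succAbove j) 1)), ?_⟩
      intro n
      obtain ⟨y, rfl⟩ := hg n
      let z : Fin (k+1) → R := y - (y i * u) • x
      have hz : g z = g y := by
        change g (y - (y i * u) • x) = g y
        rw [map_sub, map_smul, LinearMap.mem_ker.1 hx, smul_zero, sub_zero]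
      have hzi : z i = 0 := by
        change y i - (y i * u) * x i = 0
        rw [mul_assoc, hu, mul_one, sub_self]
      refine ⟨fun j => z (i.succAbove j), ?_⟩
      rw [Fintype.linearCombination_apply, ← hz]
      conv_rhs => rw [pi_eq_sum_univ' z]
      rw [map_sum, Fin.sum_univ_succAbove _ i, hzi, zero_smul, map_zero, zero_add]
      simp only [map_smul]

lemma exists_min_syz {R : Type} [CommRing R] [IsNoetherianRing R] [IsLocalRing R]
    (N : ModuleCat.{0} R) [Module.Finite R N] :
    ∃ K : ModuleCat.{0} R, Module.Finite R K ∧ IsSyzygyOf R N K := by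
  obtain ⟨q, g, hg, hk⟩ := exists_min_cover (R := R) N
  exact ⟨ModuleCat.of R (LinearMap.ker g),
    (inferInstance : Module.Finite R (LinearMap.ker g)), q, g, hg, hk, ⟨LinearEquiv.refl R _⟩⟩

lemma exists_nsyz {R : Type} [CommRing R] [IsNoetherianRing R] [IsLocalRing R] (n : ℕ) :
    ∀ (N : ModuleCat.{0} R) [Module.Finite R N],
    ∃ K : ModuleCat.{0} R, IsNthSyzygyOf R n N K := by
  induction n with
  | zero => exact fun N _ => ⟨N, ⟨LinearEquiv.refl R N⟩⟩
  | succ n ih =>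
    intro N _
    obtain ⟨K, hK, h⟩ := exists_min_syz N
    obtain ⟨L, hL⟩ := ih K
    exact ⟨L, K, h, hL⟩

lemma T_syz {R : Type} [CommRing R] [IsLocalRing R] (N K : ModuleCat.{0} R)
    (h : IsSyzygyOf R N K) (X : Type) [AddCommGroup X] [Module R X] (n : ℕ) :
    Nonempty (T R (n+2) N X ≃ₗ[R] T R (n+1) K X) := by
  obtain ⟨q, g, hg, -, ⟨e⟩⟩ := h
  refine T_shift (R := R) (A := K) (B := Fin q → R) (C := N) (Y := X)
    (f := (LinearMap.ker g).subtype ∘ₗ e.toLinearMap) (g := g) ?_ ?_ hg Acyc_flat n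
  · exact Subtype.val_injective.comp e.injective
  · intro x
    constructor
    · intro hx
      exact ⟨e.symm ⟨x, hx⟩, by simp⟩
    · rintro ⟨y, rfl⟩
      exact (e y).2

lemma T_nsyz {R : Type} [CommRing R] [IsLocalRing R] (X : Type) [AddCommGroup X] [Module R X]
    (n : ℕ) : ∀ (N K : ModuleCat.{0} R), IsNthSyzygyOf R n N K →
    Nonempty (T R (n+1) N X ≃ₗ[R] T R 1 K X) := by
  induction n with
  | zero =>
    rintro N K ⟨e⟩
    exact T_congr_left X e.symm 1
  | succ n ih =>
    rintro N K ⟨L, hL, hK⟩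
    obtain ⟨e1⟩ := T_syz N L hL X n
    obtain ⟨e2⟩ := ih L K hK
    exact ⟨e1.trans e2⟩

lemma glue_core {S R : Type} [CommRing S] [IsNoetherianRing S] [CommRing R] [Algebra S R]
    {D : Type} [CommRing D] [IsNoetherianRing D]
    [Algebra S D] [Module.FaithfullyFlat S D] (hD : DiagGood S D)
    (xs : List S) (hc : 1 ≤ xs.length) (hreg : RingTheory.Sequence.IsWeaklyRegular S xs)
    (hsurj : Surjective (algebraMap S R)) (hker : RingHom.ker (algebraMap S R) = Ideal.ofList xs)
    (N X : Type) [AddCommGroup N] [Module R N] [Module S N] [IsScalarTower S R N]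
    [Module.Finite S N] [AddCommGroup X] [Module R X] [Module S X] [IsScalarTower S R X]
    [Module.Finite S X] (t n0 : ℕ)
    (hper : ∀ n, n0 ≤ n → Nonempty (T R (n+1) N X ≃ₗ[R] T R (n+2) N X))
    (hz : ∀ i, t + 1 ≤ i + 1 → i + 1 ≤ t + xs.length → Subsingleton (T R (i+1) N X)) :
    ∀ i, t + 1 ≤ i + 1 → Subsingleton (T R (i+1) N X) := by
  obtain ⟨M, h0, h1, h2, h3⟩ := chain (S := S) (R := R) N X xs.length S xs rfl
    surjective_id hsurj hker hreg
  have key := step8 hD N X M xs.length t (n0+1) hc h0 h2 h3 ?_ ?_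
  · intro i hi
    obtain ⟨e⟩ := h1 i
    have := key (i+1) hi
    exact e.symm.toEquiv.subsingleton
  · intro i hi
    obtain ⟨j, rfl⟩ : ∃ j, i = j + 1 := ⟨i-1, by omega⟩
    obtain ⟨e⟩ := h1 j
    obtain ⟨e'⟩ := h1 (j+1)
    obtain ⟨e2⟩ := hper j (by omega)
    exact ⟨e'.trans ((e2.restrictScalars S).symm.trans e.symm)⟩
  · intro i hi hi2
    obtain ⟨j, rfl⟩ : ∃ j, i = j + 1 := ⟨i-1, by omega⟩
    obtain ⟨e⟩ := h1 j
    have := hz j hi hi2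
    exact e.toEquiv.subsingleton

end Glue

/-- over a complete intersection `R ≅ S/(x₁,…,x_c)` with `S` unramified
regular local and the `xᵢ` a regular sequence in `𝔪_S²`, every eventually period-one
module is `c`-Tor-rigid. -/
theorem eventually_periodic_tor_rigid
    (S : Type) [CommRing S] [IsNoetherianRing S] [IsLocalRing S]
    (hS : IsUnramifiedRegularLocal S)
    (xs : List S) (hc : 1 ≤ xs.length)
    (hreg : RingTheory.Sequence.IsRegular S xs)
    (hsq : ∀ x ∈ xs, x ∈ (maximalIdeal S) ^ 2)
    (R : Type) [CommRing R] [IsNoetherianRing R] [IsLocalRing R]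
    (e : R ≃+* S ⧸ Ideal.ofList xs)
    (N : ModuleCat.{0} R) [Module.Finite R N]
    (hper : ∃ n₀ : ℕ, ∀ n, n₀ ≤ n → ∀ A B : ModuleCat.{0} R,
      IsNthSyzygyOf R n N A → IsNthSyzygyOf R (n + 1) N B → Nonempty (↥A ≃ₗ[R] ↥B)) :
    NTorRigid R xs.length N := by
  intro X hX t hz j hj
  obtain ⟨D, _, _, _, _, hD⟩ := exists_diag hS.1 hS.2
  obtain ⟨n0, hper⟩ := hper
  let _ : Algebra S R := (e.symm.toRingHom.comp (Ideal.Quotient.mk (Ideal.ofList xs))).toAlgebra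
  have hsurj : Function.Surjective (algebraMap S R) :=
    e.symm.surjective.comp Ideal.Quotient.mk_surjective
  have hker : RingHom.ker (algebraMap S R) = Ideal.ofList xs := by
    ext x
    change e.symm (Ideal.Quotient.mk (Ideal.ofList xs) x) = 0 ↔ _
    rw [map_eq_zero_iff _ e.symm.injective, Ideal.Quotient.eq_zero_iff_mem]
  let _ : Module S N := Module.compHom N (algebraMap S R)
  let _ : Module S X := Module.compHom X (algebraMap S R)
  have : IsScalarTower S R N := IsScalarTower.of_algebraMap_smul fun r x => rfl
  have : IsScalarTower S R X := IsScalarTower.of_algebraMap_smul fun r x => rfl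
  have : Module.Finite S R := Module.Finite.of_surjective (Algebra.linearMap S R) hsurj
  have : Module.Finite S N := Module.Finite.trans R N
  have : Module.Finite S X := Module.Finite.trans R X
  have key := glue_core (S := S) (R := R) hD xs hc hreg.toIsWeaklyRegular hsurj hker N X t n0 ?_ ?_
  · obtain ⟨i, rfl⟩ : ∃ i, j = i + 1 := ⟨j-1, by omega⟩
    exact (torZero_iff N X i).2 (key i hj)
  · intro n hn
    obtain ⟨A, hA⟩ := exists_nsyz (R := R) n N
    obtain ⟨B, hB⟩ := exists_nsyz (R := R) (n+1) N
    obtain ⟨e0⟩ := hper n hn A B hA hB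
    obtain ⟨e1⟩ := T_nsyz (R := R) X n N A hA
    obtain ⟨e2⟩ := T_nsyz (R := R) X (n+1) N B hB
    obtain ⟨e3⟩ := T_congr_left (R := R) X e0 1
    exact ⟨e1.trans (e3.trans e2.symm)⟩
  · intro i h1 h2
    exact (torZero_iff N X i).1 (hz (i+1) h1 h2)
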